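/- Let V ⊂ ℝ^n (n ≥ 1) be a bounded domain with smooth boundary. Then there exists a periodic billiard trajectory on V with at most n+1 bounce times and whose length T satisfies 2r(V) ≤ T ≤ 2(n+1) r(V). -/

import Mathlib

/-!
Statement 11 (Corollary 1.7): every bounded domain `V ⊂ ℝⁿ` with smooth boundary
carries a periodic billiard trajectory with at most `n+1` bounce times and length
between `2r(V)` and `2(n+1)r(V)`, where `r(V)` is the inradius.

The smooth boundary is presented by a global defining function `f` (`V = {f < 0}`,
`∂V = {f = 0}`, `∇f ≠ 0` on `∂V`); the outward normal direction at `x ∈ ∂V` is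
`∇f(x)`.
-/

open scoped RealInnerProductSpace
open Filter

noncomputable section

abbrev E (n : ℕ) : Type := EuclideanSpace ℝ (Fin n)

/-- The inradius `r(V) = sup_{x ∈ V} dist(x, ∂V)`. -/
def inradius {n : ℕ} (V : Set (E n)) : ℝ :=
  sSup ((fun x => Metric.infDist x (frontier V)) '' V)

/-! ### Simplicial chains modulo two -/

section Chains

variable {α : Type*} [DecidableEq α]

/-- Chains modulo two of finite subsets of `α`. -/
abbrev Chain (α : Type*) : Type _ := Finset α →₀ ZMod 2

/-- The augmented simplicial boundary. -/
def bdry : Chain α →ₗ[ZMod 2] Chain α :=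
  Finsupp.linearCombination (ZMod 2) fun S => ∑ a ∈ S, Finsupp.single (S.erase a) 1

/-- The cone with apex `a`. -/
def cone (a : α) : Chain α →ₗ[ZMod 2] Chain α :=
  Finsupp.linearCombination (ZMod 2) fun S =>
    if a ∈ S then 0 else Finsupp.single (insert a S) 1

lemma bdry_single (S : Finset α) :
    bdry (Finsupp.single S 1) = ∑ a ∈ S, Finsupp.single (S.erase a) (1 : ZMod 2) := by
  simp [bdry]

lemma cone_single (a : α) (S : Finset α) :
    cone a (Finsupp.single S 1) =
      if a ∈ S then 0 else Finsupp.single (insert a S) (1 : ZMod 2) := by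
  simp [cone]

omit [DecidableEq α] in
lemma chain_add_self (z : Chain α) : z + z = 0 := by
  ext S; exact CharTwo.add_self_eq_zero _

lemma bdry_cone (a : α) (z : Chain α) : bdry (cone a z) = z + cone a (bdry z) := by
  have key : (bdry ∘ₗ cone a) = (LinearMap.id + cone a ∘ₗ bdry : Chain α →ₗ[ZMod 2] Chain α) := by
    refine Finsupp.lhom_ext' fun S => LinearMap.ext_ring ?_
    simp only [LinearMap.comp_apply, Finsupp.lsingle_apply, LinearMap.add_apply,
      LinearMap.id_apply, cone_single, bdry_single, map_sum]
    by_cases h : a ∈ S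
    · rw [if_pos h, map_zero]
      have : ∑ x ∈ S, (if a ∈ S.erase x then (0 : Chain α)
          else Finsupp.single (insert a (S.erase x)) 1) = Finsupp.single S 1 := by
        rw [Finset.sum_eq_single_of_mem a h]
        · simp [Finset.insert_erase h]
        · intro b _ hb
          simp [h, Ne.symm hb]
      rw [this, chain_add_self]
    · rw [if_neg h, bdry_single, Finset.sum_insert h, Finset.erase_insert h]
      congr 1
      refine Finset.sum_congr rfl fun b hb => ?_
      have hab : a ≠ b := fun hab => h (hab ▸ hb)
      rw [if_neg (by simp [h]), Finset.erase_insert_of_ne hab]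
  exact LinearMap.congr_fun key z

lemma bdry_bdry (z : Chain α) : bdry (bdry z) = 0 := by
  have key : (bdry ∘ₗ bdry) = (0 : Chain α →ₗ[ZMod 2] Chain α) := by
    refine Finsupp.lhom_ext' fun S => LinearMap.ext_ring ?_
    simp only [LinearMap.comp_apply, Finsupp.lsingle_apply, LinearMap.zero_apply]
    induction S using Finset.induction_on with
    | empty => simp [bdry_single]
    | insert a S ha ih =>
      have : (Finsupp.single (insert a S) 1 : Chain α) = cone a (Finsupp.single S 1) := by
        simp [cone_single, ha]
      rw [this, bdry_cone, map_add, bdry_cone, ih, map_zero, add_zero, chain_add_self]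
  exact LinearMap.congr_fun key z

/-- Evaluation of a chain on a cochain. -/
def deg (c : Finset α → ZMod 2) : Chain α →ₗ[ZMod 2] ZMod 2 :=
  Finsupp.linearCombination (ZMod 2) c

omit [DecidableEq α] in
lemma deg_single (c : Finset α → ZMod 2) (S : Finset α) : deg c (Finsupp.single S 1) = c S := by
  simp [deg]

lemma deg_bdry {c : Finset α → ZMod 2} {z : Chain α}
    (h : ∀ S ∈ z.support, ∑ a ∈ S, c (S.erase a) = 0) : deg c (bdry z) = 0 := by
  rw [bdry, Finsupp.linearCombination_apply, Finsupp.sum, map_sum]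
  refine Finset.sum_eq_zero fun S hS => ?_
  rw [map_smul, map_sum]
  simp only [deg_single]
  rw [h S hS, smul_zero]

lemma exists_of_mem_support_bdry {z : Chain α} {F : Finset α} (hF : F ∈ (bdry z).support) :
    ∃ S ∈ z.support, ∃ a ∈ S, F = S.erase a := by
  by_contra! hcon
  apply Finsupp.mem_support_iff.1 hF
  rw [bdry, Finsupp.linearCombination_apply, Finsupp.sum, Finsupp.finsetSum_apply]
  refine Finset.sum_eq_zero fun S hS => ?_
  rw [Finsupp.smul_apply, Finsupp.finsetSum_apply, Finset.sum_eq_zero, smul_zero]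
  intro a ha
  rw [Finsupp.single_apply, if_neg (fun h => hcon S hS a ha h.symm)]

lemma exists_of_mem_support_cone {a : α} {z : Chain α} {T : Finset α}
    (hT : T ∈ (cone a z).support) : ∃ S ∈ z.support, a ∉ S ∧ T = insert a S := by
  by_contra! hcon
  apply Finsupp.mem_support_iff.1 hT
  rw [cone, Finsupp.linearCombination_apply, Finsupp.sum, Finsupp.finsetSum_apply]
  refine Finset.sum_eq_zero fun S hS => ?_
  rw [Finsupp.smul_apply]
  split_ifs with h
  · simp
  · rw [Finsupp.single_apply, if_neg (fun h' => hcon S hS h h'.symm), smul_zero]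

/-- Two chains with the same boundary have the same value on a cocycle. -/
lemma deg_eq_of_bdry_eq {c : Finset α → ZMod 2} {z z' : Chain α} (a : α)
    (hb : bdry z = bdry z')
    (h : ∀ S ∈ z.support ∪ z'.support, a ∉ S → ∑ x ∈ insert a S, c ((insert a S).erase x) = 0) :
    deg c z = deg c z' := by
  have h0 : bdry (z + z') = 0 := by rw [map_add, hb, chain_add_self]
  have h1 : bdry (cone a (z + z')) = z + z' := by rw [bdry_cone, h0, map_zero, add_zero]
  have h2 : deg c (z + z') = 0 := by
    rw [← h1]
    refine deg_bdry fun T hT => ?_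
    obtain ⟨S, hS, haS, rfl⟩ := exists_of_mem_support_cone hT
    exact h S (Finsupp.support_add hS) haS
  rw [map_add] at h2
  exact CharTwo.add_eq_zero.1 h2

end Chains

/-! ### A combinatorial minimax principle -/

section Minimax

variable {α : Type*} {H : Type*} [NormedAddCommGroup H] [NormedSpace ℝ H]

/-- `y` minimises the maximum over `a ∈ S` of the functions `g a`, and the minimal value is `b`. -/
def IsMinMax (g : α → H → ℝ) (S : Finset α) (y : H) (b : ℝ) : Prop :=
  (∀ a ∈ S, g a y ≤ b) ∧ ∀ y', ∃ a ∈ S, b ≤ g a y'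

lemma exists_isMinMax [FiniteDimensional ℝ H] {g : α → H → ℝ} (hcont : ∀ a, Continuous (g a))
    (hcoer : ∀ a, Tendsto (g a) (cocompact H) atTop) {S : Finset α} (hS : S.Nonempty) :
    ∃ y b, IsMinMax g S y b := by
  have : ProperSpace H := FiniteDimensional.proper ℝ H
  have hc : Continuous fun y => S.sup' hS fun a => g a y :=
    Continuous.finset_sup'_apply hS fun a _ => hcont a
  have ht : Tendsto (fun y => S.sup' hS fun a => g a y) (cocompact H) atTop := by
    obtain ⟨a, ha⟩ := hS
    exact tendsto_atTop_mono (fun y => Finset.le_sup' (fun a => g a y) ha) (hcoer a)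
  obtain ⟨y, hy⟩ := hc.exists_forall_le ht
  refine ⟨y, S.sup' hS fun a => g a y, fun a ha => Finset.le_sup' (fun a => g a y) ha, fun y' => ?_⟩
  obtain ⟨a, ha, h⟩ := Finset.exists_mem_eq_sup' hS fun a => g a y'
  exact ⟨a, ha, h ▸ hy y'⟩

lemma IsMinMax.eq {g : α → H → ℝ} (hconv : ∀ a, StrictConvexOn ℝ Set.univ (g a))
    {S : Finset α} {y y' : H} {b : ℝ} (h : IsMinMax g S y b) (h' : ∀ a ∈ S, g a y' ≤ b) :
    y' = y := by
  by_contra hne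
  obtain ⟨a, ha, hle⟩ := h.2 ((1 / 2 : ℝ) • y' + (1 / 2 : ℝ) • y)
  have := (hconv a).2 (Set.mem_univ y') (Set.mem_univ y) hne (by norm_num : (0 : ℝ) < 1 / 2)
    (by norm_num : (0 : ℝ) < 1 / 2) (by norm_num)
  simp only [smul_eq_mul] at this
  linarith [h.1 a ha, h' a ha]

variable [DecidableEq α]

lemma IsMinMax.of_insert {g : α → H → ℝ} (hcont : ∀ a, Continuous (g a))
    (hconv : ∀ a, StrictConvexOn ℝ Set.univ (g a)) {F : Finset α} {a : α} {y : H} {b : ℝ}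
    (h : IsMinMax g (insert a F) y b) (ha : g a y < b) : IsMinMax g F y b := by
  refine ⟨fun x hx => h.1 x (Finset.mem_insert_of_mem hx), fun y' => ?_⟩
  by_contra! hlt
  have hc : Tendsto (fun t : ℝ => g a ((1 - t) • y + t • y')) (nhdsWithin 0 (Set.Ioi 0))
      (nhds (g a y)) := by
    have : Continuous fun t : ℝ => g a ((1 - t) • y + t • y') := (hcont a).comp (by fun_prop)
    have h1 := this.tendsto 0
    simp only [sub_zero, one_smul, zero_smul, add_zero] at h1
    exact h1.mono_left nhdsWithin_le_nhds
  have h1 : ∀ᶠ t : ℝ in nhdsWithin 0 (Set.Ioi 0), t < 1 :=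
    nhdsWithin_le_nhds (Iio_mem_nhds one_pos)
  obtain ⟨t, hta, ht1, ht0⟩ :=
    ((hc.eventually_lt_const ha).and (h1.and self_mem_nhdsWithin)).exists
  obtain ⟨x, hx, hle⟩ := h.2 ((1 - t) • y + t • y')
  rcases Finset.mem_insert.1 hx with rfl | hx'
  · linarith
  · have := (hconv x).convexOn.2 (Set.mem_univ y) (Set.mem_univ y') (by linarith : 0 ≤ 1 - t)
      ht0.le (by ring)
    simp only [smul_eq_mul] at this
    nlinarith [h.1 x hx, hlt x hx']

theorem exists_critical [Fintype α] [FiniteDimensional ℝ H] {n : ℕ} {g : α → H → ℝ}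
    (hcont : ∀ a, Continuous (g a)) (hconv : ∀ a, StrictConvexOn ℝ Set.univ (g a))
    (hcoer : ∀ a, Tendsto (g a) (cocompact H) atTop)
    {c : Finset α → ZMod 2} (hc : ∀ T : Finset α, T.card = n + 2 → ∑ a ∈ T, c (T.erase a) = 0)
    {z₀ : Chain α} (hcard : ∀ S ∈ z₀.support, S.card = n + 1) (hdeg : deg c z₀ = 1)
    {c₀ B : ℝ} (hlow : ∀ S : Finset α, S.card = n + 1 → c S ≠ 0 → ∀ h, ∃ a ∈ S, c₀ ≤ g a h)
    (hbd : ∀ F ∈ (bdry z₀).support, ∃ h, ∀ a ∈ F, g a h < c₀)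
    (hup : ∀ S ∈ z₀.support, ∃ h, ∀ a ∈ S, g a h ≤ B) :
    ∃ (S : Finset α) (y : H) (b : ℝ), S.card = n + 1 ∧ c₀ ≤ b ∧ b ≤ B ∧
      (∀ a ∈ S, g a y = b) ∧ (∀ a, b ≤ g a y) ∧ ∀ y', ∃ a ∈ S, b ≤ g a y' := by
  classical
  have hopt : ∀ S : Finset α, ∃ p : H × ℝ, S.Nonempty → IsMinMax g S p.1 p.2 := by
    intro S
    by_cases hS : S.Nonempty
    · obtain ⟨y, b, h⟩ := exists_isMinMax hcont hcoer hS
      exact ⟨(y, b), fun _ => h⟩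
    · exact ⟨(0, 0), fun h => absurd h hS⟩
  choose p hp using hopt
  have hpc : ∀ S : Finset α, S.card = n + 1 → IsMinMax g S (p S).1 (p S).2 := fun S hS =>
    hp S (Finset.card_pos.1 (by omega))
  let Z : Set (Chain α) := {z | bdry z = bdry z₀ ∧ deg c z = 1 ∧ ∀ S ∈ z.support, S.card = n + 1}
  have hZne : ∀ z ∈ Z, z.support.Nonempty := by
    rintro z ⟨-, h, -⟩
    rw [Finset.nonempty_iff_ne_empty, Ne, Finsupp.support_eq_empty]
    rintro rfl
    simp at h
  have hfin : Finite (Chain α) := Finite.of_injective _ DFunLike.coe_injective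
  have hmax : ∀ z : Chain α, ∃ M : ℝ, z ∈ Z →
      (∃ S ∈ z.support, (p S).2 = M) ∧ ∀ S ∈ z.support, (p S).2 ≤ M := by
    intro z
    by_cases hz : z ∈ Z
    · obtain ⟨S, hS, h⟩ := Finset.exists_max_image z.support (fun S => (p S).2) (hZne z hz)
      exact ⟨(p S).2, fun _ => ⟨⟨S, hS, rfl⟩, h⟩⟩
    · exact ⟨0, fun h => absurd h hz⟩
  choose M hM using hmax
  have hz₀ : z₀ ∈ Z := ⟨rfl, hdeg, hcard⟩
  obtain ⟨z₁, hz₁, hz₁min⟩ := Set.exists_min_image Z M (Set.toFinite _) ⟨z₀, hz₀⟩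
  let top : Chain α → Finset (Finset α) := fun z => z.support.filter fun S => (p S).2 = M z₁
  obtain ⟨z, ⟨hz, hzM⟩, hzmin⟩ := Set.exists_min_image {z | z ∈ Z ∧ M z = M z₁}
    (fun z => (top z).card) (Set.toFinite _) ⟨z₁, hz₁, rfl⟩
  set b := M z₁ with hb
  obtain ⟨⟨S, hS, hSb⟩, hle⟩ := hM z hz
  rw [hzM] at hSb hle
  have hbB : b ≤ B := by
    obtain ⟨S', hS', h'⟩ := (hM z₀ hz₀).1
    obtain ⟨h, hh⟩ := hup S' hS'
    obtain ⟨a, ha, hle⟩ := (hpc S' (hcard S' hS')).2 h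
    linarith [hz₁min z₀ hz₀, hh a ha]
  have hcb : c₀ ≤ b := by
    have : ∃ S' ∈ z.support, c S' ≠ 0 := by
      by_contra! hcon
      have h1 := hz.2.1
      rw [deg, Finsupp.linearCombination_apply, Finsupp.sum, Finset.sum_eq_zero] at h1
      · exact zero_ne_one h1
      · intro x hx
        rw [hcon x hx, smul_zero]
    obtain ⟨S', hS', hc'⟩ := this
    have h2 := hz.2.2 S' hS'
    obtain ⟨a, ha, h3⟩ := hlow S' h2 hc' (p S').1
    linarith [(hpc S' h2).1 a ha, hle S' hS']
  set y := (p S).1 with hy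
  have hSo : IsMinMax g S y b := hSb ▸ hpc S (hz.2.2 S hS)
  suffices hall : ∀ a, b ≤ g a y from
    ⟨S, y, b, hz.2.2 S hS, hcb, hbB, fun a ha => le_antisymm (hSo.1 a ha) (hall a), hall, hSo.2⟩
  by_contra! hcon
  obtain ⟨a, ha⟩ := hcon
  let w : Chain α := z.filter fun S => (p S).2 = b ∧ (p S).1 = y
  have hw : ∀ S', S' ∈ w.support ↔ S' ∈ z.support ∧ (p S').2 = b ∧ (p S').1 = y := by
    intro S'
    simp only [w, Finsupp.support_filter, Finset.mem_filter]
  have hzw : z + w = z.filter fun S => ¬((p S).2 = b ∧ (p S).1 = y) := by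
    conv_lhs => rw [← Finsupp.filter_add_filter_not z fun S => (p S).2 = b ∧ (p S).1 = y]
    rw [add_right_comm, chain_add_self, zero_add]
  have hzw' : ∀ S', S' ∈ (z + w).support ↔ S' ∈ z.support ∧ ¬((p S').2 = b ∧ (p S').1 = y) := by
    intro S'
    rw [hzw]
    simp only [Finsupp.support_filter, Finset.mem_filter]
  let z' : Chain α := z + w + cone a (bdry w)
  have hz'eq : z' = z + bdry (cone a w) := by
    simp only [z', bdry_cone, add_assoc]
  have hlt : ∀ F ∈ (bdry w).support, a ∉ F →
      (insert a F).card = n + 1 ∧ (p (insert a F)).2 < b := by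
    intro F hF haF
    obtain ⟨S₁, hS₁, x, hx, rfl⟩ := exists_of_mem_support_bdry hF
    obtain ⟨hS₁z, hS₁b, hS₁y⟩ := (hw S₁).1 hS₁
    have hS₁c := hz.2.2 S₁ hS₁z
    have hS₁o : IsMinMax g S₁ y b := hS₁b ▸ hS₁y ▸ hpc S₁ hS₁c
    set F := S₁.erase x with hFdef
    have hTc : (insert a F).card = n + 1 := by
      rw [Finset.card_insert_of_notMem haF, hFdef, Finset.card_erase_of_mem hx, hS₁c]
      rfl
    refine ⟨hTc, ?_⟩
    by_contra! hge
    have hTo : IsMinMax g (insert a F) y b := by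
      refine ⟨fun x' hx' => ?_, fun y' => ?_⟩
      · rcases Finset.mem_insert.1 hx' with rfl | hx''
        · exact ha.le
        · exact hS₁o.1 x' (Finset.mem_of_mem_erase hx'')
      · obtain ⟨x', hx', h⟩ := (hpc _ hTc).2 y'
        exact ⟨x', hx', hge.trans h⟩
    have hFo : IsMinMax g F y b := hTo.of_insert hcont hconv ha
    have hz0F : (bdry z) F = 0 := by
      rw [hz.1]
      by_contra hne
      obtain ⟨h, hh⟩ := hbd F (Finsupp.mem_support_iff.2 hne)
      obtain ⟨x', hx', hle'⟩ := hFo.2 h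
      linarith [hh x' hx']
    have hF' : F ∈ (bdry (z + w)).support := by
      rw [Finsupp.mem_support_iff, map_add, Finsupp.add_apply, hz0F, zero_add]
      exact Finsupp.mem_support_iff.1 hF
    obtain ⟨S₂, hS₂, x₂, hx₂, hFe⟩ := exists_of_mem_support_bdry hF'
    obtain ⟨hS₂z, hS₂n⟩ := (hzw' S₂).1 hS₂
    have hS₂o := hpc S₂ (hz.2.2 S₂ hS₂z)
    have hsub : ∀ x' ∈ F, x' ∈ S₂ := fun x' hx' => Finset.mem_of_mem_erase (hFe ▸ hx')
    have hS₂b : (p S₂).2 = b := by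
      refine le_antisymm (hle S₂ hS₂z) ?_
      obtain ⟨x', hx', h⟩ := hFo.2 (p S₂).1
      exact h.trans (hS₂o.1 x' (hsub x' hx'))
    exact hS₂n ⟨hS₂b, hFo.eq hconv fun x' hx' => hS₂b ▸ hS₂o.1 x' (hsub x' hx')⟩
  have hsupp : ∀ T ∈ z'.support, (T ∈ z.support ∧ ¬((p T).2 = b ∧ (p T).1 = y)) ∨
      (T.card = n + 1 ∧ (p T).2 < b) := by
    intro T hT
    rcases Finset.mem_union.1 (Finsupp.support_add hT) with h | h
    · exact Or.inl ((hzw' T).1 h)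
    · obtain ⟨F, hF, haF, rfl⟩ := exists_of_mem_support_cone h
      exact Or.inr (hlt F hF haF)
  have hz'Z : z' ∈ Z := by
    refine ⟨?_, ?_, ?_⟩
    · rw [hz'eq, map_add, bdry_bdry, add_zero, hz.1]
    · rw [hz'eq, map_add, hz.2.1, deg_bdry, add_zero]
      intro T hT
      obtain ⟨S', hS', haS', rfl⟩ := exists_of_mem_support_cone hT
      refine hc _ ?_
      rw [Finset.card_insert_of_notMem haS', hz.2.2 S' ((hw S').1 hS').1]
    · intro T hT
      rcases hsupp T hT with h | h
      · exact hz.2.2 T h.1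
      · exact h.1
  have hz'M : M z' = b := by
    refine le_antisymm ?_ (hz₁min z' hz'Z)
    obtain ⟨T, hT, h⟩ := (hM z' hz'Z).1
    rw [← h]
    rcases hsupp T hT with h | h
    · exact hle T h.1
    · exact h.2.le
  have hcount := hzmin z' ⟨hz'Z, hz'M⟩
  have hss : top z' ⊂ top z := by
    rw [Finset.ssubset_iff_of_subset]
    · refine ⟨S, Finset.mem_filter.2 ⟨hS, hSb⟩, fun hmem => ?_⟩
      obtain ⟨h1, h2⟩ := Finset.mem_filter.1 hmem
      rcases hsupp S h1 with h | h
      · exact h.2 ⟨h2, rfl⟩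
      · exact h.2.ne h2
    · intro T hT
      obtain ⟨h1, h2⟩ := Finset.mem_filter.1 hT
      rcases hsupp T h1 with h | h
      · exact Finset.mem_filter.2 ⟨h.1, h2⟩
      · exact absurd h2 h.2.ne
  exact absurd (Finset.card_lt_card hss) (not_lt.2 hcount)

end Minimax

/-! ### Parity of the facets of a simplex containing a generic point in their hull -/

section Parity

variable {α : Type*} {W : Type*} [AddCommGroup W] [Module ℝ W]

/-- `w` gives barycentric weights of `x` with respect to the points `pos a`, `a ∈ F`. -/
def IsBary (pos : α → W) (F : Finset α) (x : W) (w : α → ℝ) : Prop :=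
  (∀ a ∈ F, 0 ≤ w a) ∧ ∑ a ∈ F, w a = 1 ∧ ∑ a ∈ F, w a • pos a = x

/-- `x` is a convex combination of the points `pos a`, `a ∈ F`. -/
def InHull (pos : α → W) (F : Finset α) (x : W) : Prop :=
  ∃ w, IsBary pos F x w

lemma IsBary.mono {pos : α → W} {F G : Finset α} {x : W} {w : α → ℝ} (h : IsBary pos G x w)
    (hFG : F ⊆ G) (h0 : ∀ a ∈ G, a ∉ F → w a = 0) : IsBary pos F x w := by
  refine ⟨fun a ha => h.1 a (hFG ha), ?_, ?_⟩
  · rw [Finset.sum_subset hFG h0, h.2.1]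
  · rw [Finset.sum_subset hFG fun a ha ha' => by rw [h0 a ha ha', zero_smul], h.2.2]

lemma InHull.exists_extend {pos : α → W} {F G : Finset α} {x : W} (h : InHull pos F x)
    (hFG : F ⊆ G) : ∃ w, IsBary pos G x w ∧ ∀ a ∉ F, w a = 0 := by
  classical
  obtain ⟨w, hw⟩ := h
  refine ⟨fun a => if a ∈ F then w a else 0, ⟨fun a _ => ?_, ?_, ?_⟩, fun a ha => if_neg ha⟩
  · dsimp only
    split_ifs with h
    · exact hw.1 a h
    · exact le_rfl
  · rw [← Finset.sum_subset hFG fun a _ ha => if_neg ha, ← hw.2.1]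
    exact Finset.sum_congr rfl fun a ha => if_pos ha
  · rw [← Finset.sum_subset hFG fun a _ ha => by simp only [if_neg ha, zero_smul], ← hw.2.2]
    exact Finset.sum_congr rfl fun a ha => by simp only [if_pos ha]

lemma InHull.mono {pos : α → W} {F G : Finset α} {x : W} (h : InHull pos F x) (hFG : F ⊆ G) :
    InHull pos G x :=
  let ⟨w, hw, _⟩ := h.exists_extend hFG
  ⟨w, hw⟩

lemma exists_slide {T : Finset α} {w d : α → ℝ} (hw : ∀ a ∈ T, 0 ≤ w a)
    (hpos : ∀ a ∈ T, d a < 0 → 0 < w a) (hneg : ∃ a ∈ T, d a < 0) :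
    ∃ t > 0, (∀ a ∈ T, 0 ≤ w a + t * d a) ∧ ∃ a ∈ T, d a < 0 ∧ w a + t * d a = 0 := by
  classical
  obtain ⟨a₀, ha₀, hd₀⟩ := hneg
  obtain ⟨a, ha, hmin⟩ := Finset.exists_min_image (T.filter fun a => d a < 0)
    (fun a => w a / (-d a)) ⟨a₀, Finset.mem_filter.2 ⟨ha₀, hd₀⟩⟩
  obtain ⟨haT, had⟩ := Finset.mem_filter.1 ha
  have hne : d a ≠ 0 := had.ne
  refine ⟨w a / (-d a), div_pos (hpos a haT had) (by linarith), fun x hx => ?_, a, haT, had, ?_⟩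
  · by_cases hdx : d x < 0
    · have := hmin x (Finset.mem_filter.2 ⟨hx, hdx⟩)
      rw [le_div_iff₀ (by linarith)] at this
      linarith
    · have : 0 ≤ w a / (-d a) := div_nonneg (hw a haT) (by linarith)
      nlinarith [hw x hx]
  · field_simp
    ring

variable [DecidableEq α] [FiniteDimensional ℝ W]

lemma exists_affine_relation (pos : α → W) {T : Finset α}
    (hT : Module.finrank ℝ W + 1 < T.card) :
    ∃ d : α → ℝ, (∃ a ∈ T, d a ≠ 0) ∧ ∑ a ∈ T, d a = 0 ∧ ∑ a ∈ T, d a • pos a = 0 := by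
  let L : (T → ℝ) →ₗ[ℝ] W × ℝ :=
    (Fintype.linearCombination ℝ fun a : T => pos a).prod
      (Fintype.linearCombination ℝ fun _ : T => (1 : ℝ))
  have hker : LinearMap.ker L ≠ ⊥ := LinearMap.ker_ne_bot_of_finrank_lt (by
    simpa [Module.finrank_prod] using hT)
  obtain ⟨d, hd, hne⟩ := Submodule.exists_mem_ne_zero_of_ne_bot hker
  obtain ⟨⟨a, ha⟩, hda⟩ := Function.ne_iff.1 hne
  have hL : ∑ a : T, d a • pos a = 0 ∧ ∑ a : T, d a = 0 := by
    have := LinearMap.mem_ker.1 hd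
    rw [Prod.ext_iff] at this
    simpa [L, Fintype.linearCombination_apply] using this
  refine ⟨fun x => if hx : x ∈ T then d ⟨x, hx⟩ else 0, ⟨a, ha, ?_⟩, ?_, ?_⟩
  · simpa [ha] using hda
  · rw [← Finset.sum_coe_sort, ← hL.2]
    exact Finset.sum_congr rfl fun x _ => by simp
  · rw [← Finset.sum_coe_sort, ← hL.1]
    exact Finset.sum_congr rfl fun x _ => by simp

open Classical in
/-- A generic point lies in the hull of an even number of facets of an `(n+1)`-simplex
in an `n`-dimensional space. -/
theorem sum_inHull_erase (pos : α → W) {T : Finset α} {n : ℕ} (hW : Module.finrank ℝ W = n)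
    (hT : T.card = n + 2) {x : W} (hx : ∀ F ⊆ T, F.card ≤ n → ¬InHull pos F x) :
    ∑ a ∈ T, (if InHull pos (T.erase a) x then 1 else 0 : ZMod 2) = 0 := by
  have two : ∀ w, IsBary pos T x w → ∀ a ∈ T, ∀ b ∈ T, w a = 0 → w b = 0 → a = b := by
    intro w hw a ha b hb hwa hwb
    by_contra hne
    refine hx ((T.erase a).erase b) (fun _ h => Finset.mem_of_mem_erase
      (Finset.mem_of_mem_erase h)) ?_ ⟨w, hw.mono (fun _ h => Finset.mem_of_mem_erase
      (Finset.mem_of_mem_erase h)) fun y hy hy' => ?_⟩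
    · rw [Finset.card_erase_of_mem (Finset.mem_erase.2 ⟨Ne.symm hne, hb⟩),
        Finset.card_erase_of_mem ha]
      omega
    · simp only [Finset.mem_erase, not_and] at hy'
      by_cases hya : y = a
      · rw [hya, hwa]
      · by_cases hyb : y = b
        · rw [hyb, hwb]
        · exact absurd hy (hy' hyb hya)
  have hN : ∀ a ∈ T, InHull pos (T.erase a) x ↔ ∃ w, IsBary pos T x w ∧ w a = 0 := by
    intro a ha
    constructor
    · intro h
      obtain ⟨w, hw, h0⟩ := h.exists_extend (Finset.erase_subset a T)
      exact ⟨w, hw, h0 a (Finset.notMem_erase a T)⟩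
    · rintro ⟨w, hw, h0⟩
      refine ⟨w, hw.mono (Finset.erase_subset a T) fun y hy hy' => ?_⟩
      have : y = a := by simpa [hy] using hy'
      rw [this, h0]
  by_cases hex : ∃ a₁ ∈ T, InHull pos (T.erase a₁) x
  swap
  · push Not at hex
    exact Finset.sum_eq_zero fun a ha => if_neg (hex a ha)
  obtain ⟨a₁, ha₁, h₁⟩ := hex
  obtain ⟨w, hw, hwa₁⟩ := (hN a₁ ha₁).1 h₁
  have hwpos : ∀ a ∈ T, a ≠ a₁ → 0 < w a := fun a ha hne =>
    lt_of_le_of_ne (hw.1 a ha) fun h => hne (two w hw a ha a₁ ha₁ h.symm hwa₁)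
  have hadd : ∀ d : α → ℝ, ∑ a ∈ T, d a = 0 → ∑ a ∈ T, d a • pos a = 0 → ∀ t : ℝ,
      (∀ a ∈ T, 0 ≤ w a + t * d a) → IsBary pos T x fun a => w a + t * d a := by
    intro d hd hd' t ht
    refine ⟨ht, ?_, ?_⟩
    · rw [Finset.sum_add_distrib, ← Finset.mul_sum, hd, mul_zero, add_zero, hw.2.1]
    · simp only [add_smul, mul_smul]
      rw [Finset.sum_add_distrib, ← Finset.smul_sum, hd', smul_zero, add_zero, hw.2.2]
  have hexneg : ∀ d : α → ℝ, ∑ a ∈ T, d a = 0 → (∃ a ∈ T, d a ≠ 0) → ∃ a ∈ T, d a < 0 := by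
    intro d hd ⟨a, ha, hne⟩
    by_contra! hcon
    exact hne ((Finset.sum_eq_zero_iff_of_nonneg hcon).1 hd a ha)
  have hker : ∀ d : α → ℝ, ∑ a ∈ T, d a = 0 → ∑ a ∈ T, d a • pos a = 0 → d a₁ = 0 →
      ∀ a ∈ T, d a = 0 := by
    intro d hd hd' hd₁ a ha
    by_contra hne
    obtain ⟨t, -, ht, b, hb, hdb, hb0⟩ := exists_slide (d := d) hw.1
      (fun y hy hyd => hwpos y hy fun h => by rw [h, hd₁] at hyd; exact lt_irrefl _ hyd)
      (hexneg d hd ⟨a, ha, hne⟩)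
    have := two _ (hadd d hd hd' t ht) b hb a₁ ha₁ hb0 (by simp [hwa₁, hd₁])
    rw [this, hd₁] at hdb
    exact lt_irrefl _ hdb
  obtain ⟨d, hd, hd', hdne, hda⟩ : ∃ d : α → ℝ, ∑ a ∈ T, d a = 0 ∧ ∑ a ∈ T, d a • pos a = 0 ∧
      (∃ a ∈ T, d a ≠ 0) ∧ 0 < d a₁ := by
    obtain ⟨d, ⟨a, ha, hne⟩, hd, hd'⟩ := exists_affine_relation pos (T := T) (by omega)
    have hd₁ : d a₁ ≠ 0 := fun h => hne (hker d hd hd' h a ha)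
    rcases hd₁.lt_or_gt with h | h
    · exact ⟨fun y => -d y, by simp [hd], by simp [hd'], ⟨a, ha, by simpa using hne⟩,
        by simpa using h⟩
    · exact ⟨d, hd, hd', ⟨a, ha, hne⟩, h⟩
  obtain ⟨t, ht0, ht, a₂, ha₂, hda₂, ha₂0⟩ := exists_slide (d := d) hw.1
      (fun y hy hyd => hwpos y hy fun h => by rw [h] at hyd; linarith)
      (hexneg d hd hdne)
  have hne : a₁ ≠ a₂ := by
    rintro rfl
    linarith
  have hmem : ∀ a ∈ T, InHull pos (T.erase a) x ↔ a = a₁ ∨ a = a₂ := by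
    intro a₃ ha₃
    constructor
    · intro h₃
      by_contra! hcon
      obtain ⟨w₃, hw₃, hw₃0⟩ := (hN a₃ ha₃).1 h₃
      set s := w₃ a₁ / d a₁ with hs
      have hw₃₁ : 0 < w₃ a₁ := lt_of_le_of_ne (hw₃.1 a₁ ha₁) fun h =>
        hcon.1 (two w₃ hw₃ a₃ ha₃ a₁ ha₁ hw₃0 h.symm)
      have hspos : 0 < s := div_pos hw₃₁ hda
      have heq : ∀ a ∈ T, w₃ a - w a - s * d a = 0 := by
        refine hker (fun a => w₃ a - w a - s * d a) ?_ ?_ ?_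
        · rw [Finset.sum_sub_distrib, Finset.sum_sub_distrib, ← Finset.mul_sum, hd, hw.2.1,
            hw₃.2.1]
          ring
        · simp only [sub_smul, mul_smul]
          rw [Finset.sum_sub_distrib, Finset.sum_sub_distrib, ← Finset.smul_sum, hd', hw.2.2,
            hw₃.2.2]
          simp
        · simp only [hwa₁, hs]
          field_simp
          ring
      have e2 := heq a₂ ha₂
      have e3 := heq a₃ ha₃
      have p3 := hwpos a₃ ha₃ hcon.1
      have t3 := ht a₃ ha₃
      have p2 : 0 ≤ w₃ a₂ := hw₃.1 a₂ ha₂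
      have hst : s ≤ t := by
        by_contra! h
        nlinarith
      have hd3 : d a₃ < 0 := by
        by_contra! h
        nlinarith [mul_nonneg hspos.le h]
      have hts : t ≤ s := by
        by_contra! h
        nlinarith
      have hst' : s = t := le_antisymm hst hts
      have : w₃ a₂ = 0 := by rw [hst'] at e2; linarith
      exact hcon.2 (two w₃ hw₃ a₃ ha₃ a₂ ha₂ hw₃0 this)
    · rintro (rfl | rfl)
      · exact h₁
      · exact (hN _ ha₂).2 ⟨_, hadd d hd hd' t ht, ha₂0⟩
  rw [← Finset.sum_filter, Finset.sum_const,
    show T.filter (fun a => InHull pos (T.erase a) x) = {a₁, a₂} from ?_, Finset.card_pair hne]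
  · decide
  · ext a
    simp only [Finset.mem_filter, Finset.mem_insert, Finset.mem_singleton]
    constructor
    · rintro ⟨h1, h2⟩
      exact (hmem a h1).1 h2
    · intro h
      have haT : a ∈ T := by rcases h with rfl | rfl <;> assumption
      exact ⟨haT, (hmem a haT).2 h⟩

end Parity

/-- In an open ball one can avoid the hulls of all small subsets of a finite set of points. -/
theorem exists_generic {α : Type*} (Q : Finset α) {n : ℕ} (pos : α → E n) (x : E n) {ε : ℝ}
    (hε : 0 < ε) : ∃ y ∈ Metric.ball x ε, ∀ F ⊆ Q, F.card ≤ n → ¬InHull pos F y := by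
  classical
  by_contra! hcon
  have hnull : ∀ F : Finset α, F.card ≤ n →
      MeasureTheory.volume {y | InHull pos F y} = 0 := by
    intro F hF
    have hsub : {y | InHull pos F y} ⊆ (affineSpan ℝ (F.image pos : Set (E n)) : Set (E n)) := by
      rintro y ⟨w, hw, h1, h2⟩
      have := affineCombination_mem_affineSpan_image (k := ℝ) (s := F) (w := w) h1 (s' := F)
        (fun i hi hi' => absurd hi hi') pos
      rw [Finset.affineCombination_eq_linear_combination _ _ _ h1, h2] at this
      simpa using this
    refine MeasureTheory.measure_mono_null hsub ?_
    refine MeasureTheory.Measure.addHaar_affineSubspace _ _ fun htop => ?_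
    rcases F.eq_empty_or_nonempty with rfl | hne
    · simp at htop
    · have h1 : Module.finrank ℝ (vectorSpan ℝ (F.image pos : Set (E n))) ≤ F.card - 1 :=
        finrank_vectorSpan_image_finset_le ℝ pos F (by have := hne.card_pos; omega)
      have h2 : vectorSpan ℝ (F.image pos : Set (E n)) = ⊤ := by
        rw [← direction_affineSpan, htop, AffineSubspace.direction_top]
      rw [h2, finrank_top, finrank_euclideanSpace_fin] at h1
      have := hne.card_pos
      omega
  have hball : Metric.ball x ε ⊆ ⋃ F ∈ Q.powerset.filter fun F => F.card ≤ n, {y | InHull pos F y} := by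
    intro y hy
    obtain ⟨F, hFQ, hF, h⟩ := hcon y hy
    exact Set.mem_iUnion₂.2 ⟨F, Finset.mem_filter.2 ⟨Finset.mem_powerset.2 hFQ, hF⟩, h⟩
  have hz : MeasureTheory.volume (Metric.ball x ε) = 0 := by
    refine MeasureTheory.measure_mono_null hball ?_
    refine (MeasureTheory.measure_biUnion_null_iff (Finset.countable_toSet _)).2 fun F hF => ?_
    exact hnull F (Finset.mem_filter.1 hF).2
  exact (Metric.measure_ball_pos _ x hε).ne' hz

/-! ### The Kuhn triangulation of a cube -/

section Push

variable {α β : Type*} [DecidableEq α] [DecidableEq β]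

/-- The push-forward of chains. -/
def push (L : α → β) : Chain α →ₗ[ZMod 2] Chain β :=
  Finsupp.linearCombination (ZMod 2) fun S => Finsupp.single (S.image L) 1

omit [DecidableEq α] in
lemma push_single (L : α → β) (S : Finset α) :
    push L (Finsupp.single S 1) = Finsupp.single (S.image L) 1 := by
  simp [push]

omit [DecidableEq α] in
lemma push_apply (L : α → β) (z : Chain α) :
    push L z = ∑ S ∈ z.support, z S • Finsupp.single (S.image L) 1 := by
  rw [push, Finsupp.linearCombination_apply, Finsupp.sum]

omit [DecidableEq β] in
lemma deg_apply (c : Finset β → ZMod 2) (z : Chain β) :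
    deg c z = ∑ S ∈ z.support, z S • c S := by
  rw [deg, Finsupp.linearCombination_apply, Finsupp.sum]

lemma bdry_apply (z : Chain α) :
    bdry z = ∑ S ∈ z.support, z S • ∑ a ∈ S, Finsupp.single (S.erase a) 1 := by
  rw [bdry, Finsupp.linearCombination_apply, Finsupp.sum]

omit [DecidableEq α] in
lemma exists_of_mem_support_push {L : α → β} {z : Chain α} {T : Finset β}
    (hT : T ∈ (push L z).support) : ∃ S ∈ z.support, T = S.image L := by
  by_contra! hcon
  apply Finsupp.mem_support_iff.1 hT
  rw [push, Finsupp.linearCombination_apply, Finsupp.sum, Finsupp.finsetSum_apply]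
  refine Finset.sum_eq_zero fun S hS => ?_
  rw [Finsupp.smul_apply, Finsupp.single_apply, if_neg fun h => hcon S hS h.symm, smul_zero]

lemma bdry_push {L : α → β} {z : Chain α} (hL : ∀ S ∈ z.support, Set.InjOn L S) :
    bdry (push L z) = push L (bdry z) := by
  rw [push_apply, bdry_apply z, map_sum, map_sum]
  refine Finset.sum_congr rfl fun S hS => ?_
  rw [map_smul, map_smul, map_sum, bdry_single, Finset.sum_image (hL S hS)]
  congr 1
  refine Finset.sum_congr rfl fun a ha => ?_
  rw [push_single]
  congr 1
  ext b
  simp only [Finset.mem_erase, Finset.mem_image]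
  constructor
  · rintro ⟨hne, x, hx, rfl⟩
    exact ⟨x, ⟨fun h => hne (h ▸ rfl), hx⟩, rfl⟩
  · rintro ⟨x, ⟨hne, hx⟩, rfl⟩
    exact ⟨fun h => hne (hL S hS hx ha h), x, hx, rfl⟩

omit [DecidableEq α] in
lemma push_congr {L L' : α → β} {z : Chain α} (h : ∀ S ∈ z.support, ∀ a ∈ S, L a = L' a) :
    push L z = push L' z := by
  rw [push, push, Finsupp.linearCombination_apply, Finsupp.linearCombination_apply]
  refine Finset.sum_congr rfl fun S hS => ?_
  dsimp only
  rw [Finset.image_congr (h S hS)]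

omit [DecidableEq α] in
lemma deg_push (c : Finset β → ZMod 2) (L : α → β) (z : Chain α) :
    deg c (push L z) = deg (fun S => c (S.image L)) z := by
  rw [push_apply, deg_apply _ z, map_sum]
  refine Finset.sum_congr rfl fun S hS => ?_
  rw [map_smul, deg_single]

end Push

section Kuhn

variable {n : ℕ}

/-- The vertices of a simplex of the Kuhn triangulation. -/
def kuhnVertex (x : Fin n → ℕ) (σ : Equiv.Perm (Fin n)) (k : ℕ) : Fin n → ℕ :=
  fun i => x i + if (σ.symm i : ℕ) < k then 1 else 0

/-- A simplex of the Kuhn triangulation. -/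
def kuhnSimplex (x : Fin n → ℕ) (σ : Equiv.Perm (Fin n)) : Finset (Fin n → ℕ) :=
  (Finset.range (n + 1)).image (kuhnVertex x σ)

/-- The fundamental chain of the Kuhn triangulation of the cube `[0,m]ⁿ`. -/
def kuhn (n m : ℕ) : Chain (Fin n → ℕ) :=
  ∑ x ∈ Fintype.piFinset fun _ : Fin n => Finset.range m, ∑ σ : Equiv.Perm (Fin n),
    Finsupp.single (kuhnSimplex x σ) 1

lemma kuhnVertex_apply_perm (x : Fin n → ℕ) (σ : Equiv.Perm (Fin n)) (k : ℕ) (j : Fin n) :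
    kuhnVertex x σ k (σ j) = x (σ j) + if (j : ℕ) < k then 1 else 0 := by
  simp [kuhnVertex]

lemma sum_kuhnVertex (x : Fin n → ℕ) (σ : Equiv.Perm (Fin n)) {k : ℕ} (hk : k ≤ n) :
    ∑ i, kuhnVertex x σ k i = ∑ i, x i + k := by
  simp only [kuhnVertex, Finset.sum_add_distrib]
  congr 1
  rw [Equiv.sum_comp σ.symm fun j : Fin n => if (j : ℕ) < k then 1 else 0,
    Fin.sum_univ_eq_sum_range (fun j => if j < k then 1 else 0), ← Finset.sum_filter,
    Finset.sum_const, smul_eq_mul, mul_one]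
  have : (Finset.range n).filter (fun j => j < k) = Finset.range k := by
    ext j
    simp only [Finset.mem_filter, Finset.mem_range]
    omega
  rw [this, Finset.card_range]

lemma kuhnVertex_injOn (x : Fin n → ℕ) (σ : Equiv.Perm (Fin n)) :
    Set.InjOn (kuhnVertex x σ) (Finset.range (n + 1)) := by
  intro k hk k' hk' h
  simp only [Finset.coe_range, Set.mem_Iio] at hk hk'
  have h1 := sum_kuhnVertex x σ (Nat.lt_succ_iff.1 hk)
  have h2 := sum_kuhnVertex x σ (Nat.lt_succ_iff.1 hk')
  rw [h, h2] at h1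
  omega

lemma exists_of_mem_support_kuhn {m : ℕ} {S : Finset (Fin n → ℕ)} (hS : S ∈ (kuhn n m).support) :
    ∃ x σ, (∀ i, x i < m) ∧ S = kuhnSimplex x σ := by
  by_contra! hcon
  apply Finsupp.mem_support_iff.1 hS
  rw [kuhn, Finsupp.finsetSum_apply]
  refine Finset.sum_eq_zero fun x hx => ?_
  rw [Finsupp.finsetSum_apply]
  refine Finset.sum_eq_zero fun σ _ => ?_
  rw [Finsupp.single_apply, if_neg fun h => hcon x σ (by simpa using hx) h.symm]

lemma card_kuhnSimplex (x : Fin n → ℕ) (σ : Equiv.Perm (Fin n)) :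
    (kuhnSimplex x σ).card = n + 1 := by
  rw [kuhnSimplex, Finset.card_image_of_injOn (kuhnVertex_injOn x σ), Finset.card_range]

lemma le_of_mem_kuhnSimplex {x : Fin n → ℕ} {σ : Equiv.Perm (Fin n)} {v : Fin n → ℕ}
    (hv : v ∈ kuhnSimplex x σ) (i : Fin n) : x i ≤ v i ∧ v i ≤ x i + 1 := by
  obtain ⟨k, -, rfl⟩ := Finset.mem_image.1 hv
  simp only [kuhnVertex]
  split_ifs <;> omega

lemma color_injOn_kuhnSimplex (x : Fin n → ℕ) (σ : Equiv.Perm (Fin n)) :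
    Set.InjOn (fun v : Fin n → ℕ => (∑ i, v i) % (n + 1)) (kuhnSimplex x σ) := by
  intro v hv v' hv' h
  obtain ⟨k, hk, rfl⟩ := Finset.mem_image.1 hv
  obtain ⟨k', hk', rfl⟩ := Finset.mem_image.1 hv'
  rw [Finset.mem_range] at hk hk'
  dsimp only at h
  rw [sum_kuhnVertex x σ (Nat.lt_succ_iff.1 hk), sum_kuhnVertex x σ (Nat.lt_succ_iff.1 hk')] at h
  have h1 : k ≡ k' [MOD n + 1] := Nat.ModEq.add_left_cancel' _ h
  rw [Nat.ModEq.eq_of_lt_of_lt h1 hk hk']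

/-- The facet of a Kuhn simplex opposite to a vertex. -/
def kuhnFacet (x : Fin n → ℕ) (σ : Equiv.Perm (Fin n)) (k : ℕ) : Finset (Fin n → ℕ) :=
  ((Finset.range (n + 1)).erase k).image (kuhnVertex x σ)

lemma bdry_single_kuhnSimplex (x : Fin n → ℕ) (σ : Equiv.Perm (Fin n)) :
    bdry (Finsupp.single (kuhnSimplex x σ) 1) =
      ∑ k ∈ Finset.range (n + 1), Finsupp.single (kuhnFacet x σ k) (1 : ZMod 2) := by
  rw [bdry_single, kuhnSimplex, Finset.sum_image (kuhnVertex_injOn x σ)]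
  refine Finset.sum_congr rfl fun k hk => ?_
  congr 1
  ext v
  simp only [kuhnFacet, Finset.mem_erase, Finset.mem_image]
  constructor
  · rintro ⟨hne, k', hk', rfl⟩
    exact ⟨k', ⟨fun h => hne (h ▸ rfl), hk'⟩, rfl⟩
  · rintro ⟨k', ⟨hne, hk'⟩, rfl⟩
    exact ⟨fun h => hne (kuhnVertex_injOn x σ hk' hk h), k', hk', rfl⟩

lemma kuhnFacet_mul_swap (x : Fin n → ℕ) (σ : Equiv.Perm (Fin n)) {k : ℕ} (hk : k + 1 < n) :
    kuhnFacet x (σ * Equiv.swap ⟨k, by omega⟩ ⟨k + 1, hk⟩) (k + 1) = kuhnFacet x σ (k + 1) := by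
  refine Finset.image_congr fun k' hk' => ?_
  have hne : k' ≠ k + 1 := (Finset.mem_erase.1 hk').1
  funext i
  simp only [kuhnVertex]
  congr 1
  have : (σ * Equiv.swap (⟨k, by omega⟩ : Fin n) ⟨k + 1, hk⟩).symm i =
      Equiv.swap (⟨k, by omega⟩ : Fin n) ⟨k + 1, hk⟩ (σ.symm i) := rfl
  rw [this]
  refine if_congr ?_ rfl rfl
  rw [Equiv.swap_apply_def]
  split_ifs with h1 h2
  · rw [h1]
    simp only
    omega
  · rw [h2]
    simp only
    omega
  · rfl

lemma sum_kuhnFacet_inner (x : Fin n → ℕ) {k : ℕ} (hk : k + 1 < n) :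
    ∑ σ : Equiv.Perm (Fin n), Finsupp.single (kuhnFacet x σ (k + 1)) (1 : ZMod 2) = 0 := by
  refine Finset.sum_involution
    (fun σ _ => σ * Equiv.swap ⟨k, by omega⟩ ⟨k + 1, hk⟩) (fun σ _ => ?_) (fun σ _ _ => ?_)
    (fun _ _ => Finset.mem_univ _) (fun σ _ => ?_)
  · rw [kuhnFacet_mul_swap x σ hk, chain_add_self]
  · rw [Ne, mul_eq_left, Equiv.swap_eq_one_iff]
    simp
  · rw [mul_assoc, Equiv.swap_mul_self, mul_one]

lemma kuhnFacet_zero (x : Fin (n + 1) → ℕ) (σ : Equiv.Perm (Fin (n + 1))) :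
    kuhnFacet x σ 0 = kuhnFacet (x + Pi.single (σ 0) 1) (σ * finRotate (n + 1)) (n + 1) := by
  have h1 : (Finset.range (n + 1 + 1)).erase 0 = (Finset.range (n + 1)).image (· + 1) := by
    ext k
    simp only [Finset.mem_erase, Finset.mem_range, Finset.mem_image]
    constructor
    · rintro ⟨h, h'⟩
      exact ⟨k - 1, by omega, by omega⟩
    · rintro ⟨j, h, rfl⟩
      omega
  have h2 : (Finset.range (n + 1 + 1)).erase (n + 1) = Finset.range (n + 1) := by
    rw [Finset.range_add_one (n := n + 1), Finset.erase_insert (by simp)]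
  rw [kuhnFacet, kuhnFacet, h1, h2, Finset.image_image]
  refine Finset.image_congr fun k hk => ?_
  have hk' : k < n + 1 := by simpa using hk
  funext i
  obtain ⟨j, rfl⟩ := (σ * finRotate (n + 1)).surjective i
  rw [kuhnVertex_apply_perm, Equiv.Perm.mul_apply, Function.comp, kuhnVertex_apply_perm,
    Pi.add_apply, add_assoc, Pi.single_apply]
  congr 1
  simp only [EmbeddingLike.apply_eq_iff_eq]
  rcases eq_or_ne j (Fin.last n) with rfl | hj
  · rw [finRotate_last]
    simp
    omega
  · have h3 : ((finRotate (n + 1) j : Fin (n + 1)) : ℕ) = j + 1 :=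
      coe_finRotate_of_ne_last hj
    have h4 : finRotate (n + 1) j ≠ 0 := by
      intro h
      rw [h] at h3
      simp at h3
    rw [h3, if_neg h4]
    simp

lemma apply_of_mem_kuhnFacet_last {x : Fin (n + 1) → ℕ} {σ : Equiv.Perm (Fin (n + 1))}
    {v : Fin (n + 1) → ℕ} (hv : v ∈ kuhnFacet x σ (n + 1)) :
    v (σ (Fin.last n)) = x (σ (Fin.last n)) := by
  obtain ⟨k, hk, rfl⟩ := Finset.mem_image.1 hv
  simp only [Finset.mem_erase, Finset.mem_range] at hk
  simp only [kuhnVertex, Equiv.symm_apply_apply, Fin.val_last]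
  rw [if_neg (by omega), add_zero]

/-- The boundary of the Kuhn chain is carried by the boundary of the cube. -/
theorem mem_boundary_of_mem_support_bdry_kuhn {m : ℕ} (hn : 1 ≤ n) {F : Finset (Fin n → ℕ)}
    (hF : F ∈ (bdry (kuhn n m)).support) :
    ∃ i, (∀ v ∈ F, v i = 0) ∨ ∀ v ∈ F, v i = m := by
  obtain ⟨n, rfl⟩ : ∃ k, n = k + 1 := ⟨n - 1, by omega⟩
  by_contra! hcon
  apply Finsupp.mem_support_iff.1 hF
  set box := Fintype.piFinset fun _ : Fin (n + 1) => Finset.range m with hbox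
  have e1 : bdry (kuhn (n + 1) m) = ∑ x ∈ box, ∑ σ : Equiv.Perm (Fin (n + 1)),
      (Finsupp.single (kuhnFacet x σ 0) 1 + Finsupp.single (kuhnFacet x σ (n + 1)) 1) := by
    rw [kuhn, map_sum]
    refine Finset.sum_congr rfl fun x _ => ?_
    rw [map_sum]
    simp only [bdry_single_kuhnSimplex]
    rw [Finset.sum_comm, Finset.sum_range_succ, Finset.sum_range_succ',
      Finset.sum_eq_zero, zero_add, Finset.sum_add_distrib]
    intro k hk
    rw [Finset.mem_range] at hk
    exact sum_kuhnFacet_inner x (by omega)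
  have e2 : bdry (kuhn (n + 1) m) = ∑ σ : Equiv.Perm (Fin (n + 1)), ∑ x ∈ box,
      (Finsupp.single (kuhnFacet (x + Pi.single (σ (Fin.last n)) 1) σ (n + 1)) 1 +
        Finsupp.single (kuhnFacet x σ (n + 1)) 1) := by
    rw [e1, Finset.sum_comm]
    simp only [Finset.sum_add_distrib]
    congr 1
    conv_rhs => rw [← Equiv.sum_comp (Equiv.mulRight (finRotate (n + 1)))]
    refine Finset.sum_congr rfl fun σ _ => Finset.sum_congr rfl fun x _ => ?_
    rw [kuhnFacet_zero, Equiv.coe_mulRight, Equiv.Perm.mul_apply, finRotate_last]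
  rw [e2, Finsupp.finsetSum_apply]
  refine Finset.sum_eq_zero fun σ _ => ?_
  rw [Finset.sum_add_distrib, Finsupp.add_apply, CharTwo.add_eq_zero, Finsupp.finsetSum_apply,
    Finsupp.finsetSum_apply]
  set i := σ (Fin.last n) with hi
  obtain ⟨⟨v₀, hv₀, h₀⟩, v₁, hv₁, h₁⟩ := hcon i
  refine Finset.sum_bij_ne_zero (fun x _ _ => x + Pi.single i 1) ?_ ?_ ?_ ?_
  · intro x hx hne
    have hFx : kuhnFacet (x + Pi.single i 1) σ (n + 1) = F := by
      by_contra h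
      exact hne (by rw [Finsupp.single_apply, if_neg h])
    have := apply_of_mem_kuhnFacet_last (hFx ▸ hv₁)
    rw [← hi] at this
    rw [this] at h₁
    rw [hbox, Fintype.mem_piFinset] at hx ⊢
    intro j
    have hxj := Finset.mem_range.1 (hx j)
    rw [Finset.mem_range]
    by_cases hji : j = i
    · subst hji
      simp only [Pi.add_apply, Pi.single_eq_same] at h₁ ⊢
      omega
    · simpa [Pi.single_eq_of_ne hji] using hxj
  · intro x _ _ x' _ _ h
    exact add_right_cancel h
  · intro x hx hne
    have hFx : kuhnFacet x σ (n + 1) = F := by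
      by_contra h
      exact hne (by rw [Finsupp.single_apply, if_neg h])
    have := apply_of_mem_kuhnFacet_last (hFx ▸ hv₀)
    rw [← hi] at this
    rw [this] at h₀
    have hadd : Function.update x i (x i - 1) + Pi.single i 1 = x := by
      funext j
      by_cases hji : j = i
      · subst hji
        simp only [Pi.add_apply, Function.update_self, Pi.single_eq_same]
        omega
      · simp [Pi.single_eq_of_ne hji, Function.update_of_ne hji]
    refine ⟨Function.update x i (x i - 1), ?_, ?_, hadd⟩
    · rw [hbox, Fintype.mem_piFinset] at hx ⊢
      intro j
      have hxj := Finset.mem_range.1 (hx j)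
      rw [Finset.mem_range]
      by_cases hji : j = i
      · subst hji
        rw [Function.update_self]
        omega
      · rwa [Function.update_of_ne hji]
    · rw [hadd]
      exact hne
  · intro x _ _
    rfl

end Kuhn

section KuhnDegree

variable {n : ℕ}

/-- The lattice point with coordinates `v`. -/
def latticePoint (v : Fin n → ℕ) : E n := WithLp.toLp 2 fun i => (v i : ℝ)

/-- The lattice points of the cube `[0,m]ⁿ`. -/
def latticeCube (n m : ℕ) : Finset (Fin n → ℕ) :=
  Fintype.piFinset fun _ => Finset.range (m + 1)

lemma kuhnSimplex_subset_latticeCube {m : ℕ} {x : Fin n → ℕ} (hx : ∀ i, x i < m)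
    (σ : Equiv.Perm (Fin n)) : kuhnSimplex x σ ⊆ latticeCube n m := by
  intro v hv
  rw [latticeCube, Fintype.mem_piFinset]
  intro i
  rw [Finset.mem_range]
  have := (le_of_mem_kuhnSimplex hv i).2
  have := hx i
  omega

lemma sum_smul_latticePoint_apply (x : Fin n → ℕ) (σ : Equiv.Perm (Fin n))
    (w : (Fin n → ℕ) → ℝ) (j : Fin n) :
    (∑ v ∈ kuhnSimplex x σ, w v • latticePoint v) (σ j) =
      x (σ j) * ∑ v ∈ kuhnSimplex x σ, w v +
        ∑ k ∈ Finset.range (n + 1), w (kuhnVertex x σ k) * if (j : ℕ) < k then 1 else 0 := by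
  rw [kuhnSimplex, Finset.sum_image (kuhnVertex_injOn x σ),
    Finset.sum_image (kuhnVertex_injOn x σ), Finset.mul_sum, ← Finset.sum_add_distrib,
    WithLp.ofLp_sum, Finset.sum_apply]
  refine Finset.sum_congr rfl fun k _ => ?_
  simp only [latticePoint, WithLp.ofLp_smul, Pi.smul_apply, smul_eq_mul, kuhnVertex_apply_perm]
  push_cast
  ring

lemma coords_of_inHull_kuhnSimplex {x : Fin n → ℕ} {σ : Equiv.Perm (Fin n)} {y : E n}
    (hgen : ∀ F ⊆ kuhnSimplex x σ, F.card ≤ n → ¬InHull latticePoint F y)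
    (h : InHull latticePoint (kuhnSimplex x σ) y) :
    (∀ i, (x i : ℝ) < y i ∧ y i < x i + 1) ∧ StrictAnti ((fun i => y i - x i) ∘ σ) := by
  obtain ⟨w, hw⟩ := h
  have hpos : ∀ k ∈ Finset.range (n + 1), 0 < w (kuhnVertex x σ k) := by
    intro k hk
    have hmem : kuhnVertex x σ k ∈ kuhnSimplex x σ := Finset.mem_image_of_mem _ hk
    refine lt_of_le_of_ne (hw.1 _ hmem) fun h0 => ?_
    refine hgen ((kuhnSimplex x σ).erase (kuhnVertex x σ k)) (Finset.erase_subset _ _) ?_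
      ⟨w, hw.mono (Finset.erase_subset _ _) fun a ha ha' => ?_⟩
    · rw [Finset.card_erase_of_mem hmem, card_kuhnSimplex]
      rfl
    · have : a = kuhnVertex x σ k := by simpa [ha] using ha'
      rw [this, h0]
  have hsum : ∑ k ∈ Finset.range (n + 1), w (kuhnVertex x σ k) = 1 := by
    rw [← hw.2.1, kuhnSimplex, Finset.sum_image (kuhnVertex_injOn x σ)]
  have hy : ∀ j, y (σ j) - x (σ j) =
      ∑ k ∈ Finset.range (n + 1), w (kuhnVertex x σ k) * if (j : ℕ) < k then 1 else 0 := by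
    intro j
    have := sum_smul_latticePoint_apply x σ w j
    rw [hw.2.2, hw.2.1] at this
    rw [this]
    ring
  refine ⟨fun i => ?_, fun j j' hjj' => ?_⟩
  · obtain ⟨j, rfl⟩ := σ.surjective i
    have h1 : 0 < y (σ j) - x (σ j) := by
      rw [hy j]
      refine Finset.sum_pos' (fun k hk => mul_nonneg (hpos k hk).le (by split_ifs <;> norm_num))
        ⟨n, Finset.mem_range.2 (Nat.lt_succ_self n), ?_⟩
      rw [if_pos j.2, mul_one]
      exact hpos n (Finset.mem_range.2 (Nat.lt_succ_self n))
    have h2 : y (σ j) - x (σ j) < 1 := by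
      rw [hy j]
      refine lt_of_lt_of_eq (Finset.sum_lt_sum (fun k hk => ?_)
        ⟨0, Finset.mem_range.2 (Nat.succ_pos n), ?_⟩) hsum
      · have := hpos k hk
        split_ifs <;> linarith
      · simpa using hpos 0 (Finset.mem_range.2 (Nat.succ_pos n))
    constructor <;> linarith
  · simp only [Function.comp]
    rw [hy j, hy j']
    have hlt : (j : ℕ) < j' := hjj'
    have hj' : (j' : ℕ) ∈ Finset.range (n + 1) := Finset.mem_range.2 (by omega)
    refine Finset.sum_lt_sum (fun k hk => ?_) ⟨j', hj', ?_⟩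
    · have := hpos k hk
      split_ifs <;> linarith
    · rw [if_neg (lt_irrefl _), if_pos hlt]
      linarith [hpos _ hj']

lemma sum_range_sub_mul_ite (S : ℕ → ℝ) (j N : ℕ) :
    ∑ k ∈ Finset.range N, (S k - S (k + 1)) * (if j < k then 1 else 0) =
      if j + 1 ≤ N then S (j + 1) - S N else 0 := by
  induction N with
  | zero => simp
  | succ N ih =>
    rw [Finset.sum_range_succ, ih]
    rcases lt_trichotomy j N with h | h | h
    · rw [if_pos (by omega), if_pos h, if_pos (by omega)]
      ring
    · subst h
      simp
    · rw [if_neg (by omega), if_neg (by omega), if_neg (by omega)]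
      ring

lemma inHull_kuhnSimplex {x : Fin n → ℕ} {σ : Equiv.Perm (Fin n)} {y : E n}
    (h0 : ∀ i, (x i : ℝ) ≤ y i) (h1 : ∀ i, y i ≤ x i + 1)
    (hanti : Antitone ((fun i => y i - x i) ∘ σ)) : InHull latticePoint (kuhnSimplex x σ) y := by
  let S : ℕ → ℝ := fun k => match k with
    | 0 => 1
    | j + 1 => if h : j < n then y (σ ⟨j, h⟩) - x (σ ⟨j, h⟩) else 0
  have hS : ∀ k, S (k + 1) ≤ S k := by
    intro k
    cases k with
    | zero =>
      simp only [S]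
      split_ifs
      · linarith [h1 (σ ⟨0, ‹_›⟩)]
      · norm_num
    | succ k =>
      simp only [S]
      split_ifs with h2 h3 h3
      · exact hanti (a := ⟨k, h3⟩) (b := ⟨k + 1, h2⟩) (by simp)
      · omega
      · linarith [h0 (σ ⟨k, h3⟩)]
      · exact le_rfl
  have hS0 : S 0 = 1 := rfl
  have hSn : S (n + 1) = 0 := dif_neg (lt_irrefl n)
  let w : (Fin n → ℕ) → ℝ := fun v => S (∑ i, v i - ∑ i, x i) - S (∑ i, v i - ∑ i, x i + 1)
  have hw : ∀ k ∈ Finset.range (n + 1), w (kuhnVertex x σ k) = S k - S (k + 1) := by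
    intro k hk
    simp only [w]
    rw [sum_kuhnVertex x σ (Nat.lt_succ_iff.1 (Finset.mem_range.1 hk)), Nat.add_sub_cancel_left]
  have hsum : ∑ v ∈ kuhnSimplex x σ, w v = 1 := by
    rw [kuhnSimplex, Finset.sum_image (kuhnVertex_injOn x σ), Finset.sum_congr rfl hw,
      Finset.sum_range_sub', hS0, hSn, sub_zero]
  refine ⟨w, fun v _ => sub_nonneg.2 (hS _), hsum, ?_⟩
  ext i
  obtain ⟨j, rfl⟩ := σ.surjective i
  rw [sum_smul_latticePoint_apply, hsum, mul_one,
    Finset.sum_congr rfl fun k hk => by rw [hw k hk], sum_range_sub_mul_ite, if_pos (by omega),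
    hSn, sub_zero]
  simp only [S]
  rw [dif_pos j.2]
  simp

open Classical in
lemma deg_kuhn_latticePoint {m : ℕ} {y : E n} (hy : ∀ i, 0 < y i ∧ y i < m)
    (hgen : ∀ F ⊆ latticeCube n m, F.card ≤ n → ¬InHull latticePoint F y) :
    deg (fun S => if InHull latticePoint S y then 1 else 0) (kuhn n m) = 1 := by
  let x₀ : Fin n → ℕ := fun i => ⌊y i⌋₊
  have hx₀ : ∀ i, x₀ i < m := fun i => (Nat.floor_lt (hy i).1.le).2 (hy i).2
  let σ₀ : Equiv.Perm (Fin n) := Tuple.sort fun i => -(y i - x₀ i)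
  have hσ₀ : Antitone ((fun i => y i - x₀ i) ∘ σ₀) := by
    intro j j' h
    have := Tuple.monotone_sort (fun i => -(y i - x₀ i)) h
    exact neg_le_neg_iff.1 this
  have hin : InHull latticePoint (kuhnSimplex x₀ σ₀) y :=
    inHull_kuhnSimplex (fun i => Nat.floor_le (hy i).1.le) (fun i => (Nat.lt_floor_add_one _).le)
      hσ₀
  have hiff : ∀ x ∈ Fintype.piFinset (fun _ : Fin n => Finset.range m), ∀ σ,
      InHull latticePoint (kuhnSimplex x σ) y → x = x₀ ∧ σ = σ₀ := by
    intro x hx σ h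
    have hxm : ∀ i, x i < m := by simpa using hx
    obtain ⟨h1, h2⟩ := coords_of_inHull_kuhnSimplex
      (fun F hF => hgen F (hF.trans (kuhnSimplex_subset_latticeCube hxm σ))) h
    obtain rfl : x = x₀ := by
      funext i
      exact ((Nat.floor_eq_iff (hy i).1.le).2 ⟨(h1 i).1.le, (h1 i).2⟩).symm
    refine ⟨rfl, ?_⟩
    have heq := Tuple.unique_antitone h2.antitone hσ₀
    have hinj : Function.Injective fun i => y i - x₀ i := by
      have := h2.injective
      rwa [Function.Injective.of_comp_iff' _ σ.bijective] at this
    exact Equiv.ext fun j => hinj (congrFun heq j)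
  rw [kuhn, map_sum, Finset.sum_eq_single_of_mem x₀ (by simpa using hx₀), map_sum,
    Finset.sum_eq_single_of_mem σ₀ (Finset.mem_univ _), deg_single, if_pos hin]
  · intro σ _ hne
    rw [deg_single, if_neg fun h => hne (hiff x₀ (by simpa using hx₀) σ h).2]
  · intro x hx hne
    rw [map_sum]
    refine Finset.sum_eq_zero fun σ _ => ?_
    rw [deg_single, if_neg fun h => hne (hiff x hx σ h).1]

lemma inHull_image {α β : Type*} [DecidableEq β] {W : Type*} [AddCommGroup W] [Module ℝ W]
    {pos : β → W} {L : α → β} {F : Finset α} (hL : Set.InjOn L F) {x : W} :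
    InHull pos (F.image L) x ↔ InHull (pos ∘ L) F x := by
  constructor
  · rintro ⟨w, h1, h2, h3⟩
    rw [Finset.sum_image hL] at h2 h3
    exact ⟨w ∘ L, fun a ha => h1 _ (Finset.mem_image_of_mem _ ha), h2, h3⟩
  · rintro ⟨w, h1, h2, h3⟩
    have hw : ∀ a ∈ F, (fun b => if h : ∃ a ∈ F, L a = b then w h.choose else 0) (L a) = w a := by
      intro a ha
      have hex : ∃ a' ∈ F, L a' = L a := ⟨a, ha, rfl⟩
      dsimp only
      rw [dif_pos hex, hL hex.choose_spec.1 ha hex.choose_spec.2]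
    classical
    refine ⟨fun b => if h : ∃ a ∈ F, L a = b then w h.choose else 0, ?_, ?_, ?_⟩
    · intro b hb
      obtain ⟨a, ha, rfl⟩ := Finset.mem_image.1 hb
      rw [hw a ha]
      exact h1 a ha
    · rw [Finset.sum_image hL, Finset.sum_congr rfl hw, h2]
    · rw [Finset.sum_image hL, ← h3]
      exact Finset.sum_congr rfl fun a ha => by rw [hw a ha]; rfl

open Classical in
/-- A vertex map that fixes the boundary of the cube has degree one. -/
theorem deg_kuhn {m : ℕ} (hn : 1 ≤ n) {y : E n} (hy : ∀ i, 0 < y i ∧ y i < m)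
    (p : (Fin n → ℕ) → E n)
    (hp : ∀ v, (∃ i, v i = 0 ∨ v i = m) → p v = latticePoint v)
    (hgen : ∀ F ⊆ (latticeCube n m) ×ˢ (Finset.univ : Finset Bool), F.card ≤ n →
      ¬InHull (fun q : (Fin n → ℕ) × Bool => if q.2 then p q.1 else latticePoint q.1) F y) :
    deg (fun S => if InHull p S y then 1 else 0) (kuhn n m) = 1 := by
  set pos := fun q : (Fin n → ℕ) × Bool => if q.2 then p q.1 else latticePoint q.1 with hpos
  set c : Finset ((Fin n → ℕ) × Bool) → ZMod 2 := fun S => if InHull pos S y then 1 else 0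
  let L : (Fin n → ℕ) → (Fin n → ℕ) × Bool := fun v => (v, false)
  let L' : (Fin n → ℕ) → (Fin n → ℕ) × Bool := fun v =>
    (v, !decide (∃ i, v i = 0 ∨ v i = m))
  have hL : Function.Injective L := fun v v' h => congrArg Prod.fst h
  have hL' : Function.Injective L' := fun v v' h => congrArg Prod.fst h
  have hposL : pos ∘ L = latticePoint := by
    funext v
    simp [pos, L]
  have hposL' : pos ∘ L' = p := by
    funext v
    by_cases h : ∃ i, v i = 0 ∨ v i = m
    · simp only [hpos, L', Function.comp, h, hp v h]
      simp
    · simp only [hpos, L', Function.comp, h]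
      simp
  have hbdry : bdry (push L (kuhn n m)) = bdry (push L' (kuhn n m)) := by
    rw [bdry_push fun _ _ => hL.injOn, bdry_push fun _ _ => hL'.injOn]
    refine push_congr fun F hF v hv => ?_
    obtain ⟨i, hi⟩ := mem_boundary_of_mem_support_bdry_kuhn hn hF
    have : ∃ i, v i = 0 ∨ v i = m := ⟨i, hi.imp (fun h => h v hv) fun h => h v hv⟩
    simp [L, L', this]
  have hQ : ∀ S ∈ (push L (kuhn n m)).support ∪ (push L' (kuhn n m)).support,
      S.card = n + 1 ∧ S ⊆ (latticeCube n m) ×ˢ (Finset.univ : Finset Bool) := by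
    intro S hS
    obtain ⟨M, hM, S', hS', rfl⟩ : ∃ M : (Fin n → ℕ) → (Fin n → ℕ) × Bool,
        (Function.Injective M ∧ ∀ v, (M v).1 = v) ∧ ∃ S' ∈ (kuhn n m).support, S = S'.image M := by
      rcases Finset.mem_union.1 hS with h | h
      · exact ⟨L, ⟨hL, fun _ => rfl⟩, exists_of_mem_support_push h⟩
      · exact ⟨L', ⟨hL', fun _ => rfl⟩, exists_of_mem_support_push h⟩
    obtain ⟨x, σ, hx, rfl⟩ := exists_of_mem_support_kuhn hS'
    refine ⟨by rw [Finset.card_image_of_injective _ hM.1, card_kuhnSimplex], fun q hq => ?_⟩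
    obtain ⟨v, hv, rfl⟩ := Finset.mem_image.1 hq
    simp only [Finset.mem_product, Finset.mem_univ, and_true, hM.2]
    exact kuhnSimplex_subset_latticeCube hx σ hv
  have h0 : ((0 : Fin n → ℕ), false) ∈ (latticeCube n m) ×ˢ (Finset.univ : Finset Bool) := by
    simp [latticeCube]
  have hdeg : deg c (push L (kuhn n m)) = deg c (push L' (kuhn n m)) := by
    refine deg_eq_of_bdry_eq (0, false) hbdry fun S hS hS0 => ?_
    refine sum_inHull_erase pos (n := n) (by simp) ?_ fun F hF hFc => hgen F (hF.trans ?_) hFc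
    · rw [Finset.card_insert_of_notMem hS0, (hQ S hS).1]
    · exact Finset.insert_subset h0 (hQ S hS).2
  rw [deg_push, deg_push] at hdeg
  have e1 : (fun S : Finset (Fin n → ℕ) => c (S.image L)) =
      fun S => if InHull latticePoint S y then 1 else 0 := by
    funext S
    simp only [c, inHull_image hL.injOn, hposL]
  have e2 : (fun S : Finset (Fin n → ℕ) => c (S.image L')) =
      fun S => if InHull p S y then 1 else 0 := by
    funext S
    simp only [c, inHull_image hL'.injOn, hposL']
  rw [e1, e2] at hdeg
  rw [← hdeg]
  refine deg_kuhn_latticePoint hy fun F hF hFc h => ?_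
  refine hgen (F.image L) ?_ (Finset.card_image_le.trans hFc) ?_
  · intro q hq
    obtain ⟨v, hv, rfl⟩ := Finset.mem_image.1 hq
    simpa [L] using hF hv
  · rw [inHull_image hL.injOn, hposL]
    exact h

end KuhnDegree

section ScaledCube

lemma InHull.image {α β W : Type*} [DecidableEq β] [AddCommGroup W] [Module ℝ W]
    (L : α → β) {pos : β → W} {F : Finset α} {x : W} (h : InHull (fun a => pos (L a)) F x) :
    InHull pos (F.image L) x := by
  classical
  obtain ⟨w, h0, h1, h2⟩ := h
  refine ⟨fun b => ∑ a ∈ F with L a = b, w a, fun b _ => Finset.sum_nonneg fun a ha =>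
    h0 a (Finset.mem_filter.1 ha).1, ?_, ?_⟩
  · rw [Finset.sum_fiberwise_of_maps_to fun a ha => Finset.mem_image_of_mem L ha, h1]
  · rw [← h2, ← Finset.sum_fiberwise_of_maps_to (fun a ha => Finset.mem_image_of_mem L ha)
      fun a => w a • pos (L a)]
    refine Finset.sum_congr rfl fun b _ => ?_
    rw [Finset.sum_smul]
    refine Finset.sum_congr rfl fun a ha => ?_
    rw [(Finset.mem_filter.1 ha).2]

lemma InHull.affine {α W : Type*} [AddCommGroup W] [Module ℝ W] {pos : α → W} {F : Finset α}
    {x : W} (h : InHull pos F x) (s : ℝ) (o : W) :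
    InHull (fun a => o + s • pos a) F (o + s • x) := by
  obtain ⟨w, h0, h1, h2⟩ := h
  refine ⟨w, h0, h1, ?_⟩
  simp only [smul_add, Finset.sum_add_distrib, ← Finset.sum_smul, h1, one_smul]
  congr 1
  rw [← h2, Finset.smul_sum]
  exact Finset.sum_congr rfl fun a _ => smul_comm _ _ _

variable {n : ℕ}

open Classical in
/-- A labelling of the scaled Kuhn triangulation that fixes the boundary has degree one. -/
theorem deg_push_kuhn {m : ℕ} (hn : 1 ≤ n) {α : Type*} [DecidableEq α] (pos : α → E n)
    (L : (Fin n → ℕ) → α) (o : E n) {s : ℝ} (hs : 0 < s) {x₀ : E n}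
    (hx₀ : ∀ i, o i < x₀ i ∧ x₀ i < o i + s * m)
    (hbd : ∀ v ∈ latticeCube n m, (∃ i, v i = 0 ∨ v i = m) → pos (L v) = o + s • latticePoint v)
    (hinj : ∀ S ∈ (kuhn n m).support, Set.InjOn L S) {Q : Finset (E n)}
    (hgen : ∀ F ⊆ Q, F.card ≤ n → ¬InHull id F x₀)
    (hQ : ∀ v ∈ latticeCube n m, pos (L v) ∈ Q ∧ o + s • latticePoint v ∈ Q) :
    deg (fun S => if InHull pos S x₀ then 1 else 0) (push L (kuhn n m)) = 1 := by
  set p : (Fin n → ℕ) → E n := fun v =>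
    if v ∈ latticeCube n m then s⁻¹ • (pos (L v) - o) else latticePoint v with hp
  set y : E n := s⁻¹ • (x₀ - o) with hy
  have hback : ∀ x : E n, o + s • s⁻¹ • (x - o) = x := fun x => by
    rw [smul_inv_smul₀ hs.ne']
    abel
  have hmain : deg (fun S => if InHull p S y then 1 else 0) (kuhn n m) = 1 := by
    refine deg_kuhn hn (fun i => ?_) p (fun v hv => ?_) fun F hF hcard hin => ?_
    · simp only [hy, PiLp.smul_apply, PiLp.sub_apply, smul_eq_mul]
      have h1 := hx₀ i
      constructor
      · have : 0 < x₀ i - o i := by linarith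
        positivity
      · rw [inv_mul_lt_iff₀ hs]
        linarith
    · simp only [hp]
      split_ifs with h
      · rw [hbd v h hv, add_sub_cancel_left, inv_smul_smul₀ hs.ne']
      · rfl
    · have h1 := hin.affine s o
      rw [hy, hback] at h1
      have h2 := InHull.image (pos := (id : E n → E n)) _ h1
      refine hgen _ ?_ (Finset.card_image_le.trans hcard) h2
      intro q hq
      obtain ⟨⟨v, b⟩, hvb, rfl⟩ := Finset.mem_image.1 hq
      have hv := (Finset.mem_product.1 (hF hvb)).1
      cases b
      · simpa using (hQ v hv).2
      · simp only [if_true, hp, if_pos hv, hback]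
        exact (hQ v hv).1
  rw [deg_push]
  rw [deg_apply] at hmain ⊢
  refine (Finset.sum_congr rfl fun S hS => ?_).trans hmain
  have hSc : ∀ v ∈ S, v ∈ latticeCube n m := by
    obtain ⟨x, σ, hx, rfl⟩ := exists_of_mem_support_kuhn hS
    exact fun v hv => kuhnSimplex_subset_latticeCube hx σ hv
  have hiff : InHull pos (S.image L) x₀ ↔ InHull p S y := by
    rw [inHull_image (hinj S hS)]
    constructor
    · intro h
      have h1 := h.affine s⁻¹ (-(s⁻¹ • o))
      have e : -(s⁻¹ • o) + s⁻¹ • x₀ = y := by rw [hy]; module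
      rw [e] at h1
      obtain ⟨w, w0, w1, w2⟩ := h1
      refine ⟨w, w0, w1, ?_⟩
      rw [← w2]
      refine Finset.sum_congr rfl fun v hv => ?_
      simp only [hp, if_pos (hSc v hv), Function.comp_apply]
      module
    · intro h
      have h1 := h.affine s o
      rw [hy, hback] at h1
      obtain ⟨w, w0, w1, w2⟩ := h1
      refine ⟨w, w0, w1, ?_⟩
      rw [← w2]
      refine Finset.sum_congr rfl fun v hv => ?_
      simp only [hp, if_pos (hSc v hv), Function.comp_apply, hback]
  simp only [hiff]

end ScaledCube

/-! ### The Green kernel of the circle and its smoothings -/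

section Kernel

/-- The periodic Green kernel of the circle, up to an additive constant. -/
def green (t : ℝ) : ℝ := (Int.fract t ^ 2 - Int.fract t) / 2

lemma green_add_int (t : ℝ) (k : ℤ) : green (t + k) = green t := by
  simp [green]

lemma green_eq {t : ℝ} {k : ℤ} (h1 : (k : ℝ) ≤ t) (h2 : t ≤ k + 1) :
    green t = ((t - k) ^ 2 - (t - k)) / 2 := by
  rcases h2.lt_or_eq with h | h
  · have : Int.fract t = t - k := by
      rw [Int.fract, Int.floor_eq_iff.2 ⟨h1, h⟩]
    rw [green, this]
  · have : t = ((k + 1 : ℤ) : ℝ) := by rw [h]; push_cast; ring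
    rw [green, this, Int.fract_intCast]
    push_cast
    ring

lemma green_neg (t : ℝ) : green (-t) = green t := by
  have h1 := Int.floor_le t
  have h2 := (Int.lt_floor_add_one t).le
  rw [green_eq h1 h2, green_eq (k := -⌊t⌋ - 1) (by push_cast; linarith) (by push_cast; linarith)]
  push_cast
  ring

lemma green_nonpos (t : ℝ) : green t ≤ 0 := by
  have h1 := Int.fract_nonneg t
  have h2 := (Int.fract_lt_one t).le
  rw [green]
  nlinarith

lemma neg_le_green (t : ℝ) : -(1 / 8) ≤ green t := by
  rw [green]
  nlinarith [sq_nonneg (Int.fract t - 1 / 2)]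

lemma green_zero : green 0 = 0 := by simp [green]

lemma green_le (t : ℝ) (k : ℤ) : green t ≤ ((t - k) ^ 2 - (t - k)) / 2 := by
  rw [green_eq (Int.floor_le t) (Int.lt_floor_add_one t).le]
  have h1 := Int.floor_le t
  have h2 := (Int.lt_floor_add_one t).le
  rcases lt_trichotomy k ⌊t⌋ with h | h | h
  · have h' : (k : ℝ) + 1 ≤ ⌊t⌋ := by exact_mod_cast h
    nlinarith
  · rw [h]
  · have h' : (⌊t⌋ : ℝ) + 1 ≤ k := by exact_mod_cast h
    nlinarith

/-- `green t - t ^ 2 / 2` is concave, with supporting slope `fract t - t - 1 / 2`. -/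
lemma green_add_le (t s : ℝ) :
    green (t + s) ≤ green t + (Int.fract t - 1 / 2) * s + s ^ 2 / 2 := by
  have h1 := green_le (t + s) ⌊t⌋
  have h2 : green t = ((t - ⌊t⌋) ^ 2 - (t - ⌊t⌋)) / 2 := rfl
  rw [h2, Int.fract]
  linarith

lemma abs_green_sub_le (s t : ℝ) : |green s - green t| ≤ |s - t| := by
  have key : ∀ s t : ℝ, green s - green t ≤ |s - t| := by
    intro s t
    by_cases h : |s - t| ≤ 1
    · have h1 := green_add_le t (s - t)
      rw [add_sub_cancel] at h1
      have h2 := Int.fract_nonneg t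
      have h3 := (Int.fract_lt_one t).le
      have h4 : (Int.fract t - 1 / 2) * (s - t) ≤ 1 / 2 * |s - t| := by
        refine (le_abs_self _).trans ?_
        rw [abs_mul]
        refine mul_le_mul_of_nonneg_right ?_ (abs_nonneg _)
        rw [abs_le]
        constructor <;> linarith
      have h5 : (s - t) ^ 2 ≤ |s - t| := by
        rw [← sq_abs]
        nlinarith [abs_nonneg (s - t)]
      linarith
    · have := green_nonpos s
      have := neg_le_green t
      linarith
  rw [abs_le]
  have h1 := key s t
  have h2 := key t s
  rw [abs_sub_comm] at h2
  constructor <;> linarith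

lemma continuous_green : Continuous green := by
  refine (LipschitzWith.of_dist_le_mul (K := 1) fun s t => ?_).continuous
  simpa [Real.dist_eq] using abs_green_sub_le s t

variable {N : ℕ} [NeZero N]

/-- The Green kernel on the discrete circle with `N` points. -/
def greenZ (d : ZMod N) : ℝ := green (d.val / N)

lemma greenZ_intCast (z : ℤ) : greenZ (z : ZMod N) = green (z / N) := by
  have hN : (N : ℝ) ≠ 0 := NeZero.ne _
  have h1 : (((z : ZMod N).val : ℤ) : ℝ) = ((z % N : ℤ) : ℝ) := by
    rw [ZMod.val_intCast]
  have h2 : (z : ℝ) = ((z % N : ℤ) : ℝ) + N * ((z / N : ℤ) : ℝ) := by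
    exact_mod_cast (Int.emod_add_mul_ediv z N).symm
  rw [greenZ, ← green_add_int _ (z / N)]
  congr 1
  rw [h2, ← h1]
  push_cast
  field_simp

lemma greenZ_second_difference (d : ZMod N) :
    greenZ (d + 1) + greenZ (d - 1) - 2 * greenZ d =
      1 / N ^ 2 - if d = 0 then 1 / (N : ℝ) else 0 := by
  have hN : (0 : ℝ) < N := Nat.cast_pos.2 (NeZero.pos N)
  have hN1 : (1 : ℝ) ≤ N := Nat.one_le_cast.2 (NeZero.pos N)
  have hd : d = ((d.val : ℤ) : ZMod N) := by simp
  have e1 : greenZ (d + 1) = green ((d.val + 1 : ℝ) / N) := by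
    have : d + 1 = ((d.val + 1 : ℤ) : ZMod N) := by simp
    rw [this, greenZ_intCast]
    push_cast
    rfl
  have e2 : greenZ (d - 1) = green ((d.val - 1 : ℝ) / N) := by
    have : d - 1 = ((d.val - 1 : ℤ) : ZMod N) := by simp
    rw [this, greenZ_intCast]
    push_cast
    rfl
  rw [e1, e2, greenZ]
  have hlt : (d.val : ℝ) + 1 ≤ N := by exact_mod_cast d.val_lt
  have hinv : 1 / (N : ℝ) ≤ 1 := by rw [div_le_one hN]; exact hN1
  by_cases h0 : d = 0
  · subst h0
    rw [if_pos rfl]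
    simp only [ZMod.val_zero, Nat.cast_zero, zero_add, zero_sub, zero_div]
    have hpos : 0 < 1 / (N : ℝ) := by positivity
    rw [neg_div, green_neg, green_zero, green_eq (k := 0) (by push_cast; exact hpos.le)
      (by push_cast; linarith)]
    push_cast
    field_simp
    ring
  · rw [if_neg h0]
    have hpos : (1 : ℝ) ≤ d.val := by
      exact_mod_cast Nat.pos_of_ne_zero fun h => h0 ((ZMod.val_eq_zero d).1 h)
    have b1 : (d.val + 1 : ℝ) / N ≤ 1 := by rw [div_le_one hN]; exact hlt
    have b2 : 0 ≤ (d.val - 1 : ℝ) / N := div_nonneg (by linarith) hN.le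
    have b3 : (d.val : ℝ) / N ≤ 1 := by rw [div_le_one hN]; linarith
    have b4 : (d.val - 1 : ℝ) / N ≤ 1 := by rw [div_le_one hN]; linarith
    rw [green_eq (k := 0) (by push_cast; positivity) (by push_cast; linarith),
      green_eq (k := 0) (by push_cast; exact b2) (by push_cast; linarith),
      green_eq (k := 0) (by push_cast; positivity) (by push_cast; linarith)]
    push_cast
    field_simp
    ring

/-- The smoothed Green kernel, for a window of `M` steps of length `1 / N`. -/
def smoothGreen (M N : ℕ) (t : ℝ) : ℝ :=
  (1 / (M : ℝ) ^ 2) * ∑ j ∈ Finset.range M, ∑ k ∈ Finset.range M, green (t + ((j : ℝ) - k) / N)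

variable {M : ℕ}

omit [NeZero N] in
lemma smoothGreen_neg (t : ℝ) : smoothGreen M N (-t) = smoothGreen M N t := by
  rw [smoothGreen, smoothGreen, Finset.sum_comm]
  congr 1
  refine Finset.sum_congr rfl fun j _ => Finset.sum_congr rfl fun k _ => ?_
  rw [← green_neg]
  congr 1
  ring

omit [NeZero N] in
lemma smoothGreen_add_int (t : ℝ) (z : ℤ) : smoothGreen M N (t + z) = smoothGreen M N t := by
  rw [smoothGreen, smoothGreen]
  congr 1
  refine Finset.sum_congr rfl fun j _ => Finset.sum_congr rfl fun k _ => ?_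
  rw [add_right_comm, green_add_int]

lemma average_const (hM : 0 < M) (a : ℝ) :
    (1 / (M : ℝ) ^ 2) * ∑ _j ∈ Finset.range M, ∑ _k ∈ Finset.range M, a = a := by
  have : (M : ℝ) ≠ 0 := by positivity
  simp only [Finset.sum_const, Finset.card_range, nsmul_eq_mul]
  field_simp

lemma average_le (hM : 0 < M) {f : ℕ → ℕ → ℝ} {a : ℝ}
    (h : ∀ j ∈ Finset.range M, ∀ k ∈ Finset.range M, f j k ≤ a) :
    (1 / (M : ℝ) ^ 2) * ∑ j ∈ Finset.range M, ∑ k ∈ Finset.range M, f j k ≤ a := by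
  refine le_trans ?_ (average_const hM a).le
  refine mul_le_mul_of_nonneg_left ?_ (by positivity)
  exact Finset.sum_le_sum fun j hj => Finset.sum_le_sum fun k hk => h j hj k hk

lemma le_average (hM : 0 < M) {f : ℕ → ℕ → ℝ} {a : ℝ}
    (h : ∀ j ∈ Finset.range M, ∀ k ∈ Finset.range M, a ≤ f j k) :
    a ≤ (1 / (M : ℝ) ^ 2) * ∑ j ∈ Finset.range M, ∑ k ∈ Finset.range M, f j k := by
  refine le_trans (average_const hM a).ge ?_
  refine mul_le_mul_of_nonneg_left ?_ (by positivity)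
  exact Finset.sum_le_sum fun j hj => Finset.sum_le_sum fun k hk => h j hj k hk

omit [NeZero N] in
lemma smoothGreen_sub_le (hM : 0 < M) {s t a : ℝ}
    (h : ∀ x, green (s + x) - green (t + x) ≤ a) :
    smoothGreen M N s - smoothGreen M N t ≤ a := by
  rw [smoothGreen, smoothGreen, ← mul_sub, ← Finset.sum_sub_distrib]
  simp only [← Finset.sum_sub_distrib]
  exact average_le hM fun j _ k _ => h _

omit [NeZero N] in
lemma abs_smoothGreen_sub_le (hM : 0 < M) (s t : ℝ) :
    |smoothGreen M N s - smoothGreen M N t| ≤ |s - t| := by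
  rw [abs_le]
  constructor
  · rw [neg_le, neg_sub]
    refine smoothGreen_sub_le hM fun x => (le_abs_self _).trans ((abs_green_sub_le _ _).trans ?_)
    rw [add_sub_add_right_eq_sub, abs_sub_comm]
  · refine smoothGreen_sub_le hM fun x => (le_abs_self _).trans ((abs_green_sub_le _ _).trans ?_)
    rw [add_sub_add_right_eq_sub]

omit [NeZero N] in
lemma abs_smoothGreen_sub_green_le (hM : 0 < M) (t : ℝ) :
    |smoothGreen M N t - green t| ≤ M / N := by
  have key : ∀ j ∈ Finset.range M, ∀ k ∈ Finset.range M,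
      |green (t + ((j : ℝ) - k) / N) - green t| ≤ M / N := by
    intro j hj k hk
    refine (abs_green_sub_le _ _).trans ?_
    have hj' : (j : ℝ) < M := by exact_mod_cast Finset.mem_range.1 hj
    have hk' : (k : ℝ) < M := by exact_mod_cast Finset.mem_range.1 hk
    rw [add_sub_cancel_left, abs_div, Nat.abs_cast]
    refine div_le_div_of_nonneg_right ?_ (Nat.cast_nonneg _)
    rw [abs_le]
    have : (0 : ℝ) ≤ j := Nat.cast_nonneg _
    have : (0 : ℝ) ≤ k := Nat.cast_nonneg _
    constructor <;> linarith
  rw [abs_le]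
  constructor
  · rw [neg_le_sub_iff_le_add, ← sub_le_iff_le_add]
    exact le_average hM fun j hj k hk => by linarith [(abs_le.1 (key j hj k hk)).1]
  · rw [sub_le_iff_le_add]
    exact average_le hM fun j hj k hk => by linarith [(abs_le.1 (key j hj k hk)).2]

omit [NeZero N] in
lemma smoothGreen_supporting (hM : 0 < M) (t : ℝ) :
    ∃ q, ∀ s, smoothGreen M N (t + s) ≤ smoothGreen M N t + q * s + s ^ 2 / 2 := by
  refine ⟨(1 / (M : ℝ) ^ 2) * ∑ j ∈ Finset.range M, ∑ k ∈ Finset.range M,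
    (Int.fract (t + ((j : ℝ) - k) / N) - 1 / 2), fun s => ?_⟩
  rw [smoothGreen, smoothGreen, mul_assoc, Finset.sum_mul, ← mul_add, ← Finset.sum_add_distrib,
    ← sub_le_iff_le_add', ← mul_sub, ← Finset.sum_sub_distrib]
  simp only [Finset.sum_mul, ← Finset.sum_add_distrib, ← Finset.sum_sub_distrib]
  refine average_le hM fun j _ k _ => ?_
  have := green_add_le (t + ((j : ℝ) - k) / N) s
  rw [add_right_comm] at this
  linarith

omit [NeZero N] in
lemma concaveOn_smoothGreen (hM : 0 < M) :
    ConcaveOn ℝ Set.univ fun t => smoothGreen M N t - t ^ 2 / 2 := by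
  refine ⟨convex_univ, fun x _ y _ a b ha hb hab => ?_⟩
  simp only [smul_eq_mul]
  obtain ⟨q, hq⟩ := smoothGreen_supporting (N := N) hM (a * x + b * y)
  have h1 := hq (x - (a * x + b * y))
  have h2 := hq (y - (a * x + b * y))
  rw [add_sub_cancel] at h1 h2
  have hb' : b = 1 - a := by linarith
  subst hb'
  nlinarith [mul_le_mul_of_nonneg_left h1 ha, mul_le_mul_of_nonneg_left h2 hb]

lemma abs_smoothGreen_second_difference_le (hM : 0 < M) (hMN : M ≤ N) (z : ℤ) :
    |smoothGreen M N (z / N + 1 / N) + smoothGreen M N (z / N - 1 / N) -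
      2 * smoothGreen M N (z / N)| ≤ 1 / N ^ 2 + 1 / (N * M) := by
  have hN : (0 : ℝ) < N := Nat.cast_pos.2 (NeZero.pos N)
  have hM' : (0 : ℝ) < M := Nat.cast_pos.2 hM
  have e : smoothGreen M N (z / N + 1 / N) + smoothGreen M N (z / N - 1 / N) -
      2 * smoothGreen M N (z / N) = 1 / N ^ 2 - (1 / (M : ℝ) ^ 2) *
        ∑ j ∈ Finset.range M, ∑ k ∈ Finset.range M,
          if ((z + j - k : ℤ) : ZMod N) = 0 then 1 / (N : ℝ) else 0 := by
    rw [eq_sub_iff_add_eq, ← average_const hM (1 / (N : ℝ) ^ 2)]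
    simp only [smoothGreen]
    rw [mul_left_comm, ← mul_add, ← mul_sub, ← mul_add, Finset.mul_sum, ← Finset.sum_add_distrib,
      ← Finset.sum_sub_distrib, ← Finset.sum_add_distrib]
    simp only [Finset.mul_sum, ← Finset.sum_add_distrib, ← Finset.sum_sub_distrib]
    refine Finset.sum_congr rfl fun j _ => Finset.sum_congr rfl fun k _ => ?_
    congr 1
    have := greenZ_second_difference ((z + j - k : ℤ) : ZMod N)
    have e1 : ((z + j - k : ℤ) : ZMod N) + 1 = ((z + j - k + 1 : ℤ) : ZMod N) := by push_cast; ring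
    have e2 : ((z + j - k : ℤ) : ZMod N) - 1 = ((z + j - k - 1 : ℤ) : ZMod N) := by push_cast; ring
    rw [e1, e2, greenZ_intCast, greenZ_intCast, greenZ_intCast] at this
    have f1 : (((z + j - k + 1 : ℤ) : ℝ) / N) = z / N + 1 / N + ((j : ℝ) - k) / N := by
      push_cast; ring
    have f2 : (((z + j - k - 1 : ℤ) : ℝ) / N) = z / N - 1 / N + ((j : ℝ) - k) / N := by
      push_cast; ring
    have f3 : (((z + j - k : ℤ) : ℝ) / N) = z / N + ((j : ℝ) - k) / N := by
      push_cast; ring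
    rw [f1, f2, f3] at this
    linarith
  have hnn : ∀ j k : ℕ, 0 ≤ if ((z + j - k : ℤ) : ZMod N) = 0 then 1 / (N : ℝ) else 0 := by
    intro j k
    split_ifs <;> positivity
  have inner : ∀ j ∈ Finset.range M, ∑ k ∈ Finset.range M,
      (if ((z + j - k : ℤ) : ZMod N) = 0 then 1 / (N : ℝ) else 0) ≤ 1 / N := by
    intro j _
    rw [← Finset.sum_filter, Finset.sum_const, nsmul_eq_mul]
    refine mul_le_of_le_one_left (by positivity) ?_
    rw [← Nat.cast_one, Nat.cast_le, Finset.card_le_one]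
    intro a ha b hb
    rw [Finset.mem_filter, Finset.mem_range] at ha hb
    have hab : ((a : ℕ) : ZMod N) = b := by
      have h1 := ha.2
      have h2 := hb.2
      push_cast at h1 h2
      rw [sub_eq_zero] at h1 h2
      rw [← h1, ← h2]
    rw [ZMod.natCast_eq_natCast_iff'] at hab
    rwa [Nat.mod_eq_of_lt (ha.1.trans_le hMN), Nat.mod_eq_of_lt (hb.1.trans_le hMN)] at hab
  have hsum : ∑ j ∈ Finset.range M, ∑ k ∈ Finset.range M,
      (if ((z + j - k : ℤ) : ZMod N) = 0 then 1 / (N : ℝ) else 0) ≤ M * (1 / N) := by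
    refine (Finset.sum_le_sum inner).trans (le_of_eq ?_)
    rw [Finset.sum_const, Finset.card_range, nsmul_eq_mul]
  have hsum0 : 0 ≤ ∑ j ∈ Finset.range M, ∑ k ∈ Finset.range M,
      (if ((z + j - k : ℤ) : ZMod N) = 0 then 1 / (N : ℝ) else 0) :=
    Finset.sum_nonneg fun j _ => Finset.sum_nonneg fun k _ => hnn j k
  have h1 := mul_le_mul_of_nonneg_left hsum (a := 1 / (M : ℝ) ^ 2) (by positivity)
  have h2 := mul_nonneg (a := 1 / (M : ℝ) ^ 2) (by positivity) hsum0
  have h3 : (1 / (M : ℝ) ^ 2) * (M * (1 / N)) = 1 / (N * M) := by field_simp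
  have h4 : 0 < 1 / ((N : ℝ) * M) := by positivity
  have h5 : 0 < 1 / ((N : ℝ) ^ 2) := by positivity
  rw [e, abs_le]
  constructor <;> linarith

end Kernel

/-! ### The energy of discrete loops -/

section Energy

variable {n N : ℕ} [NeZero N]

/-- The barycentre of a discrete loop. -/
def loopMean : (ZMod N → E n) →ₗ[ℝ] E n := (1 / (N : ℝ)) • ∑ i, LinearMap.proj i

lemma loopMean_apply (h : ZMod N → E n) : loopMean h = (1 / (N : ℝ)) • ∑ i, h i := by
  simp [loopMean]

/-- The Dirichlet energy of discrete loops, with a weak penalization of the barycentre. -/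
def energy (C : ℝ) : (ZMod N → E n) →ₗ[ℝ] (ZMod N → E n) →ₗ[ℝ] ℝ :=
  LinearMap.mk₂ ℝ
    (fun h k => C⁻¹ * ⟪loopMean h, loopMean k⟫ +
      N * ∑ i, ⟪h (i + 1) - h i, k (i + 1) - k i⟫)
    (fun h h' k => by
      simp only [map_add, inner_add_left, Pi.add_apply, add_sub_add_comm, Finset.sum_add_distrib]
      ring)
    (fun c h k => by
      simp only [map_smul, Pi.smul_apply, ← smul_sub, real_inner_smul_left, ← Finset.mul_sum,
        smul_eq_mul]
      ring)
    (fun h k k' => by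
      simp only [map_add, inner_add_right, Pi.add_apply, add_sub_add_comm, Finset.sum_add_distrib]
      ring)
    (fun c h k => by
      simp only [map_smul, Pi.smul_apply, ← smul_sub, real_inner_smul_right, ← Finset.mul_sum,
        smul_eq_mul]
      ring)

lemma energy_apply (C : ℝ) (h k : ZMod N → E n) :
    energy C h k = C⁻¹ * ⟪loopMean h, loopMean k⟫ +
      N * ∑ i, ⟪h (i + 1) - h i, k (i + 1) - k i⟫ := rfl

lemma energy_comm (C : ℝ) (h k : ZMod N → E n) : energy C h k = energy C k h := by
  simp only [energy_apply]
  rw [real_inner_comm]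
  congr 2
  exact Finset.sum_congr rfl fun i _ => real_inner_comm _ _

lemma energy_self (C : ℝ) (h : ZMod N → E n) :
    energy C h h = C⁻¹ * ‖loopMean h‖ ^ 2 + N * ∑ i, ‖h (i + 1) - h i‖ ^ 2 := by
  simp only [energy_apply, real_inner_self_eq_norm_sq]

lemma energy_self_nonneg {C : ℝ} (hC : 0 < C) (h : ZMod N → E n) : 0 ≤ energy C h h := by
  rw [energy_self]
  positivity

lemma sq_energy_le {C : ℝ} (hC : 0 < C) (h k : ZMod N → E n) :
    energy C h k ^ 2 ≤ energy C h h * energy C k k := by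
  have := discrim_le_zero (a := energy C k k) (b := 2 * energy C h k) (c := energy C h h)
    fun x => by
      have := energy_self_nonneg hC (h + x • k)
      simp only [map_add, LinearMap.add_apply, map_smul, LinearMap.smul_apply, smul_eq_mul] at this
      rw [energy_comm C k h] at this
      linarith
  rw [discrim] at this
  linarith

/-- The average of the discrete Green kernel. -/
def greenAvg (N : ℕ) [NeZero N] : ℝ := (1 / (N : ℝ)) * ∑ i : ZMod N, greenZ i

lemma greenAvg_nonpos : greenAvg N ≤ 0 := by
  refine mul_nonpos_of_nonneg_of_nonpos (by positivity) ?_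
  exact Finset.sum_nonpos fun i _ => green_nonpos _

/-- The reproducing kernel of the energy. -/
def reproducing (C : ℝ) (i : ZMod N) (u : E n) : ZMod N → E n :=
  fun l => (C - greenAvg N + greenZ (l - i)) • u

lemma loopMean_reproducing (C : ℝ) (i : ZMod N) (u : E n) :
    loopMean (reproducing C i u) = C • u := by
  have hN : (N : ℝ) ≠ 0 := NeZero.ne _
  simp only [loopMean_apply, reproducing]
  have e : ∑ l : ZMod N, greenZ (l - i) = ∑ l : ZMod N, greenZ l :=
    Equiv.sum_comp (Equiv.subRight i) (fun l => greenZ l)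
  rw [← Finset.sum_smul, smul_smul, Finset.sum_add_distrib, e]
  congr 1
  simp only [Finset.sum_const, Finset.card_univ, ZMod.card, nsmul_eq_mul, mul_add, greenAvg]
  field_simp
  ring

lemma energy_reproducing {C : ℝ} (hC : 0 < C) (h : ZMod N → E n) (i : ZMod N) (u : E n) :
    energy C h (reproducing C i u) = ⟪h i, u⟫ := by
  have hN : (N : ℝ) ≠ 0 := NeZero.ne _
  rw [energy_apply, loopMean_reproducing, real_inner_smul_right, inv_mul_cancel_left₀ hC.ne']
  have e1 : ∀ l : ZMod N, ⟪h (l + 1) - h l,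
      reproducing C i u (l + 1) - reproducing C i u l⟫ =
      (greenZ (l + 1 - i) - greenZ (l - i)) * ⟪h (l + 1), u⟫ -
        (greenZ (l + 1 - i) - greenZ (l - i)) * ⟪h l, u⟫ := by
    intro l
    simp only [reproducing]
    rw [← sub_smul, real_inner_smul_right, inner_sub_left]
    ring
  have e2 : ∑ l : ZMod N, (greenZ (l + 1 - i) - greenZ (l - i)) * ⟪h (l + 1), u⟫ =
      ∑ l : ZMod N, (greenZ (l - i) - greenZ (l - 1 - i)) * ⟪h l, u⟫ := by
    rw [← Equiv.sum_comp (Equiv.subRight (1 : ZMod N))]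
    simp
  simp only [e1]
  rw [Finset.sum_sub_distrib, e2, ← Finset.sum_sub_distrib]
  have e3 : ∀ l : ZMod N, (greenZ (l - i) - greenZ (l - 1 - i)) * ⟪h l, u⟫ -
      (greenZ (l + 1 - i) - greenZ (l - i)) * ⟪h l, u⟫ =
      (if l = i then 1 / (N : ℝ) * ⟪h l, u⟫ else 0) - 1 / N ^ 2 * ⟪h l, u⟫ := by
    intro l
    have := greenZ_second_difference (l - i)
    simp only [sub_eq_zero] at this
    rw [sub_add_eq_add_sub, sub_right_comm] at this
    split_ifs at this ⊢ <;> linear_combination (-⟪h l, u⟫) * this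
  simp only [e3]
  rw [Finset.sum_sub_distrib, Finset.sum_ite_eq' Finset.univ i, ← Finset.mul_sum, loopMean_apply,
    real_inner_smul_left, sum_inner]
  simp only [Finset.mem_univ, if_true]
  field_simp
  ring

lemma norm_sq_apply_le {C : ℝ} (hC : 0 < C) (h : ZMod N → E n) (i : ZMod N) :
    ‖h i‖ ^ 2 ≤ (C - greenAvg N) * energy C h h := by
  have h1 := sq_energy_le hC h (reproducing C i (h i))
  rw [energy_reproducing hC, energy_reproducing hC, reproducing, real_inner_smul_left, sub_self,
    real_inner_self_eq_norm_sq] at h1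
  have h0 : greenZ (0 : ZMod N) = 0 := by simp [greenZ, green_zero]
  rw [h0, add_zero] at h1
  rcases eq_or_ne (h i) 0 with hi | hi
  · rw [hi, norm_zero]
    have := energy_self_nonneg hC h
    have := greenAvg_nonpos (N := N)
    have : 0 ≤ (C - greenAvg N) * energy C h h := mul_nonneg (by linarith) (by assumption)
    simpa using this
  · have : 0 < ‖h i‖ ^ 2 := by positivity
    nlinarith

variable (M : ℕ)

/-- The average of a discrete loop over a window of length `M`. -/
def window (i : ZMod N) : (ZMod N → E n) →ₗ[ℝ] E n :=
  (1 / (M : ℝ)) • ∑ j ∈ Finset.range M, LinearMap.proj (i + (j : ZMod N))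

omit [NeZero N] in
lemma window_apply (i : ZMod N) (h : ZMod N → E n) :
    window M i h = (1 / (M : ℝ)) • ∑ j ∈ Finset.range M, h (i + j) := by
  simp [window]

/-- The window averages of the reproducing kernel. -/
def windowKernel (C : ℝ) (i : ZMod N) (u : E n) : ZMod N → E n :=
  (1 / (M : ℝ)) • ∑ j ∈ Finset.range M, reproducing C (i + (j : ZMod N)) u

lemma energy_windowKernel {C : ℝ} (hC : 0 < C) (h : ZMod N → E n) (i : ZMod N) (u : E n) :
    energy C h (windowKernel M C i u) = ⟪window M i h, u⟫ := by
  rw [windowKernel, map_smul, map_sum, window_apply, real_inner_smul_left, sum_inner, smul_eq_mul]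
  simp only [energy_reproducing hC]

/-- The smoothed Green kernel on the discrete circle. -/
def smoothZ (d : ZMod N) : ℝ :=
  (1 / (M : ℝ) ^ 2) * ∑ j ∈ Finset.range M, ∑ k ∈ Finset.range M,
    greenZ (d + (j : ZMod N) - (k : ZMod N))

lemma smoothZ_intCast (z : ℤ) : smoothZ M (z : ZMod N) = smoothGreen M N (z / N) := by
  rw [smoothZ, smoothGreen]
  congr 1
  refine Finset.sum_congr rfl fun j _ => Finset.sum_congr rfl fun k _ => ?_
  have : (z : ZMod N) + (j : ZMod N) - (k : ZMod N) = ((z + j - k : ℤ) : ZMod N) := by push_cast; rfl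
  rw [this, greenZ_intCast]
  congr 1
  push_cast
  ring

lemma smoothZ_neg (d : ZMod N) : smoothZ M (-d) = smoothZ M d := by
  have h : ((d.val : ℤ) : ZMod N) = d := by simp
  rw [← h, ← Int.cast_neg, smoothZ_intCast, smoothZ_intCast, ← smoothGreen_neg]
  congr 1
  push_cast
  ring

variable {M}

lemma window_windowKernel (hM : 0 < M) (C : ℝ) (i l : ZMod N) (u : E n) :
    window M i (windowKernel M C l u) = (C - greenAvg N + smoothZ M (i - l)) • u := by
  have e : C - greenAvg N = (1 / (M : ℝ) ^ 2) * ∑ _j ∈ Finset.range M, ∑ _k ∈ Finset.range M,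
      (C - greenAvg N) := (average_const hM _).symm
  rw [smoothZ, e, ← mul_add, ← Finset.sum_add_distrib, window_apply]
  simp only [windowKernel, Pi.smul_apply, Finset.sum_apply, reproducing,
    ← Finset.sum_smul, smul_smul, ← Finset.sum_add_distrib, ← Finset.mul_sum]
  congr 1
  rw [← mul_assoc]
  congr 1
  · ring
  · refine Finset.sum_congr rfl fun j _ => Finset.sum_congr rfl fun k _ => ?_
    congr 2
    ring

lemma energy_windowKernel_sub {C : ℝ} (hC : 0 < C) (hM : 0 < M) (i l : ZMod N) (u : E n) :
    energy C (windowKernel M C i u - windowKernel M C l u)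
      (windowKernel M C i u - windowKernel M C l u) =
        2 * (smoothZ M (0 : ZMod N) - smoothZ M (i - l)) * ‖u‖ ^ 2 := by
  rw [map_sub, energy_windowKernel M hC, energy_windowKernel M hC, map_sub, map_sub,
    window_windowKernel hM, window_windowKernel hM, window_windowKernel hM,
    window_windowKernel hM, sub_self, sub_self, ← neg_sub i l, smoothZ_neg, ← sub_smul, ← sub_smul,
    real_inner_smul_left, real_inner_smul_left, real_inner_self_eq_norm_sq]
  ring

lemma smoothZ_le (hM : 0 < M) (d : ZMod N) : smoothZ M d ≤ smoothZ M (0 : ZMod N) := by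
  have h := energy_windowKernel_sub one_pos hM d 0 (EuclideanSpace.single (0 : Fin 1) (1 : ℝ))
  have h' := energy_self_nonneg one_pos
    (windowKernel M 1 d (EuclideanSpace.single (0 : Fin 1) (1 : ℝ)) -
      windowKernel M 1 (0 : ZMod N) (EuclideanSpace.single (0 : Fin 1) (1 : ℝ)))
  rw [h] at h'
  simp at h'
  linarith

lemma norm_sq_window_sub_le {C : ℝ} (hC : 0 < C) (hM : 0 < M) (h : ZMod N → E n) (i l : ZMod N) :
    ‖window M i h - window M l h‖ ^ 2 ≤ 2 * energy C h h * (smoothZ M (0 : ZMod N) - smoothZ M (i - l)) := by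
  set u := window M i h - window M l h with hu
  have h1 := sq_energy_le hC h (windowKernel M C i u - windowKernel M C l u)
  rw [energy_windowKernel_sub hC hM, map_sub, energy_windowKernel M hC, energy_windowKernel M hC,
    ← inner_sub_left, ← hu, real_inner_self_eq_norm_sq] at h1
  rcases eq_or_ne u 0 with hu0 | hu0
  · rw [hu0, norm_zero]
    have hnn : 0 ≤ smoothZ M (0 : ZMod N) - smoothZ M (i - l) := sub_nonneg.2 (smoothZ_le hM _)
    have := energy_self_nonneg hC h
    have := mul_nonneg (mul_nonneg zero_le_two this) hnn
    simpa using this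
  · have : 0 < ‖u‖ ^ 2 := by positivity
    nlinarith

end Energy

section Penalty

variable {n N : ℕ} [NeZero N]

/-- The energy of a discrete loop, plus a penalty for missing the point `p` at time `i`. -/
def penalty (C κ : ℝ) (M : ℕ) (i : ZMod N) (p : E n) (h : ZMod N → E n) : ℝ :=
  energy C h h + κ * ‖window M i h - p‖ ^ 2

lemma continuous_penalty (C κ : ℝ) (M : ℕ) (i : ZMod N) (p : E n) :
    Continuous (penalty C κ M i p) := by
  have h1 : Continuous (loopMean : (ZMod N → E n) →ₗ[ℝ] E n) :=
    LinearMap.continuous_of_finiteDimensional _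
  have h2 : Continuous (window M i : (ZMod N → E n) →ₗ[ℝ] E n) :=
    LinearMap.continuous_of_finiteDimensional _
  unfold penalty
  simp only [energy_self]
  fun_prop

lemma norm_sq_le_mul_energy {C : ℝ} (hC : 0 < C) (h : ZMod N → E n) :
    ‖h‖ ^ 2 ≤ (C - greenAvg N) * energy C h h := by
  have h0 : 0 ≤ (C - greenAvg N) * energy C h h :=
    mul_nonneg (by linarith [greenAvg_nonpos (N := N)]) (energy_self_nonneg hC h)
  have : ‖h‖ ≤ √((C - greenAvg N) * energy C h h) :=
    (pi_norm_le_iff_of_nonneg (Real.sqrt_nonneg _)).2 fun i =>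
      Real.le_sqrt_of_sq_le (norm_sq_apply_le hC h i)
  calc ‖h‖ ^ 2 ≤ √((C - greenAvg N) * energy C h h) ^ 2 := by gcongr
    _ = _ := Real.sq_sqrt h0

lemma energy_self_pos {C : ℝ} (hC : 0 < C) {h : ZMod N → E n} (hh : h ≠ 0) :
    0 < energy C h h := by
  have h1 := norm_sq_le_mul_energy hC h
  have h2 : 0 < ‖h‖ ^ 2 := by
    have := norm_pos_iff.2 hh
    positivity
  exact pos_of_mul_pos_right (h2.trans_le h1) (by linarith [greenAvg_nonpos (N := N)])

lemma strictConvexOn_penalty {C κ : ℝ} (hC : 0 < C) (hκ : 0 ≤ κ) (M : ℕ) (i : ZMod N) (p : E n) :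
    StrictConvexOn ℝ Set.univ (penalty C κ M i p) := by
  refine ⟨convex_univ, fun x _ y _ hxy a b ha hb hab => ?_⟩
  have h1 := energy_self_pos hC (sub_ne_zero.2 hxy)
  have hb' : b = 1 - a := by linarith
  subst hb'
  have h2 : energy C (a • x + (1 - a) • y) (a • x + (1 - a) • y) =
      a * energy C x x + (1 - a) * energy C y y - a * (1 - a) * energy C (x - y) (x - y) := by
    simp only [map_add, map_sub, map_smul, LinearMap.add_apply, LinearMap.sub_apply,
      LinearMap.smul_apply, smul_eq_mul, energy_comm C y x]
    ring
  have h3 : ‖window M i (a • x + (1 - a) • y) - p‖ ^ 2 ≤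
      a * ‖window M i x - p‖ ^ 2 + (1 - a) * ‖window M i y - p‖ ^ 2 := by
    have e : window M i (a • x + (1 - a) • y) - p =
        a • (window M i x - p) + (1 - a) • (window M i y - p) := by
      rw [map_add, map_smul, map_smul]
      module
    have h4 : ‖window M i (a • x + (1 - a) • y) - p‖ ≤
        a * ‖window M i x - p‖ + (1 - a) * ‖window M i y - p‖ := by
      rw [e]
      refine (norm_add_le _ _).trans (le_of_eq ?_)
      rw [norm_smul, norm_smul, Real.norm_of_nonneg ha.le, Real.norm_of_nonneg hb.le]
    have h5 := pow_le_pow_left₀ (norm_nonneg _) h4 2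
    nlinarith [mul_nonneg (mul_pos ha hb).le
      (sq_nonneg (‖window M i x - p‖ - ‖window M i y - p‖))]
  simp only [penalty, smul_eq_mul]
  rw [h2]
  have h6 := mul_le_mul_of_nonneg_left h3 hκ
  have h7 := mul_pos (mul_pos ha hb) h1
  nlinarith

lemma tendsto_penalty {C κ : ℝ} (hC : 0 < C) (hκ : 0 ≤ κ) (M : ℕ) (i : ZMod N) (p : E n) :
    Tendsto (penalty C κ M i p) (cocompact _) atTop := by
  have hK : 0 < C - greenAvg N := by linarith [greenAvg_nonpos (N := N)]
  have h1 : Tendsto (fun h : ZMod N → E n => (C - greenAvg N)⁻¹ * ‖h‖ ^ 2) (cocompact _) atTop :=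
    ((tendsto_pow_atTop two_ne_zero).comp tendsto_norm_cocompact_atTop).const_mul_atTop
      (inv_pos.2 hK)
  refine tendsto_atTop_mono (fun h => ?_) h1
  have h2 := norm_sq_le_mul_energy hC h
  rw [inv_mul_le_iff₀ hK]
  refine h2.trans (mul_le_mul_of_nonneg_left ?_ hK.le)
  have : 0 ≤ κ * ‖window M i h - p‖ ^ 2 := by positivity
  simp only [penalty]
  linarith

end Penalty

section Interpolation

variable {n : ℕ}

lemma sum_range_mul_mod (φ : ℕ → ℝ) (a b : ℕ) :
    ∑ v ∈ Finset.range (a * b), φ (v % b) = a * ∑ r ∈ Finset.range b, φ r := by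
  induction a with
  | zero => simp
  | succ k ih =>
    rw [Nat.succ_mul, Finset.sum_range_add, ih]
    push_cast
    rw [add_mul, one_mul]
    congr 1
    refine Finset.sum_congr rfl fun r hr => ?_
    rw [mul_comm, Nat.mul_add_mod, Nat.mod_eq_of_lt (Finset.mem_range.1 hr)]

/-- The loop that waits at `q c` for `M` steps and then moves uniformly to `q (c + 1)`. -/
def polygon (q : ℕ → E n) (D M : ℕ) (v : ℕ) : E n :=
  q (v / (D * M)) + (((v % (D * M) - M : ℕ) : ℝ) / (((D : ℝ) - 1) * M)) •
    (q (v / (D * M) + 1) - q (v / (D * M)))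

variable {q : ℕ → E n} {D M : ℕ}

lemma polygon_add (hD : 2 ≤ D) (hM : 0 < M) (hq : ∀ c, q (c + (n + 1)) = q c) (v : ℕ) :
    polygon q D M (v + (n + 1) * (D * M)) = polygon q D M v := by
  have : 0 < D * M := by positivity
  rw [polygon, Nat.add_mul_div_right _ _ this, Nat.add_mul_mod_self_right, hq, add_right_comm, hq]
  rfl

lemma polygon_window (hD : 2 ≤ D) (c : ℕ) {j : ℕ} (hj : j < M) :
    polygon q D M (c * (D * M) + j) = q c := by
  have h1 : j < D * M := by nlinarith
  rw [polygon, mul_comm c, Nat.mul_add_mod, Nat.mul_add_div (by omega), Nat.div_eq_of_lt h1,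
    Nat.mod_eq_of_lt h1, Nat.sub_eq_zero_of_le hj.le]
  simp

lemma norm_polygon_le (hD : 2 ≤ D) (hM : 0 < M) {R : ℝ} (hq : ∀ c, ‖q c‖ ≤ R) (v : ℕ) :
    ‖polygon q D M v‖ ≤ R := by
  have hpos : 0 < D * M := by positivity
  have hD' : (2 : ℝ) ≤ D := by exact_mod_cast hD
  have hM' : (0 : ℝ) < M := by exact_mod_cast hM
  have hden : 0 < ((D : ℝ) - 1) * M := mul_pos (by linarith) hM'
  set t := (((v % (D * M) - M : ℕ) : ℝ) / (((D : ℝ) - 1) * M)) with ht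
  have ht0 : 0 ≤ t := by positivity
  have ht1 : t ≤ 1 := by
    rw [ht, div_le_one hden]
    have h1 : v % (D * M) - M ≤ D * M - M := by
      have := Nat.mod_lt v hpos
      omega
    have h2 : ((D * M - M : ℕ) : ℝ) = (D - 1) * M := by
      rw [Nat.cast_sub (by nlinarith)]
      push_cast
      ring
    rw [← h2]
    exact_mod_cast h1
  have e : polygon q D M v = (1 - t) • q (v / (D * M)) + t • q (v / (D * M) + 1) := by
    rw [polygon]
    module
  rw [e]
  refine (norm_add_le _ _).trans ?_
  rw [norm_smul, norm_smul, Real.norm_of_nonneg ht0, Real.norm_of_nonneg (by linarith)]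
  have := mul_le_mul_of_nonneg_left (hq (v / (D * M))) (a := 1 - t) (by linarith)
  have := mul_le_mul_of_nonneg_left (hq (v / (D * M) + 1)) ht0
  linarith

lemma norm_polygon_succ_sub_sq_le (hD : 2 ≤ D) (hM : 0 < M) {L : ℝ}
    (hq : ∀ c, ‖q (c + 1) - q c‖ ≤ L) (v : ℕ) :
    ‖polygon q D M (v + 1) - polygon q D M v‖ ^ 2 ≤
      if M ≤ v % (D * M) then L ^ 2 / (((D : ℝ) - 1) * M) ^ 2 else 0 := by
  have hpos : 0 < D * M := by positivity
  have hD' : (2 : ℝ) ≤ D := by exact_mod_cast hD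
  have hM' : (0 : ℝ) < M := by exact_mod_cast hM
  have hden : 0 < ((D : ℝ) - 1) * M := mul_pos (by linarith) hM'
  obtain ⟨c, r, hr, rfl⟩ : ∃ c r, r < D * M ∧ v = c * (D * M) + r :=
    ⟨v / (D * M), v % (D * M), Nat.mod_lt _ hpos, (Nat.div_add_mod' v _).symm⟩
  have e1 : polygon q D M (c * (D * M) + r) =
      q c + (((r - M : ℕ) : ℝ) / (((D : ℝ) - 1) * M)) • (q (c + 1) - q c) := by
    rw [polygon, mul_comm c, Nat.mul_add_mod, Nat.mul_add_div hpos, Nat.div_eq_of_lt hr,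
      Nat.mod_eq_of_lt hr]
    rfl
  have e2 : polygon q D M (c * (D * M) + r + 1) =
      q c + (((r + 1 - M : ℕ) : ℝ) / (((D : ℝ) - 1) * M)) • (q (c + 1) - q c) := by
    rcases Nat.lt_or_eq_of_le (Nat.succ_le_of_lt hr) with h | h
    · rw [polygon, mul_comm c, add_assoc, Nat.mul_add_mod, Nat.mul_add_div hpos,
        Nat.div_eq_of_lt h, Nat.mod_eq_of_lt h]
      rfl
    · have h3 : c * (D * M) + r + 1 = (c + 1) * (D * M) + 0 := by
        rw [add_mul, one_mul, add_assoc, ← Nat.succ_eq_add_one r, h, add_zero]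
      have h4 : ((r + 1 - M : ℕ) : ℝ) = (D - 1) * M := by
        rw [← Nat.succ_eq_add_one, h, Nat.cast_sub (by nlinarith)]
        push_cast
        ring
      rw [h3, polygon_window hD _ hM, h4, div_self hden.ne']
      module
  have e3 : (c * (D * M) + r) % (D * M) = r := by
    rw [mul_comm c, Nat.mul_add_mod, Nat.mod_eq_of_lt hr]
  rw [e1, e2, e3, add_sub_add_left_eq_sub, ← sub_smul, norm_smul, mul_pow, Real.norm_eq_abs,
    sq_abs, ← sub_div]
  split_ifs with h
  · have h5 : ((r + 1 - M : ℕ) : ℝ) - ((r - M : ℕ) : ℝ) = 1 := by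
      rw [Nat.sub_add_comm h]
      push_cast
      ring
    rw [h5, div_pow, one_pow, one_div_mul_eq_div]
    gcongr
    exact hq c
  · rw [Nat.sub_eq_zero_of_le (by omega), Nat.sub_eq_zero_of_le (by omega)]
    simp

lemma sum_zmod_val {N : ℕ} [NeZero N] (φ : ℕ → ℝ) :
    ∑ i : ZMod N, φ i.val = ∑ v ∈ Finset.range N, φ v := by
  refine Finset.sum_bij (fun i _ => i.val) (fun i _ => Finset.mem_range.2 i.val_lt)
    (fun i _ j _ hij => ZMod.val_injective N hij) (fun v hv => ⟨v, Finset.mem_univ _, ?_⟩)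
    fun i _ => rfl
  exact ZMod.val_cast_of_lt (Finset.mem_range.1 hv)

/-- Closed polygons through prescribed points have controlled energy. -/
lemma exists_energy_le {C : ℝ} (hC : 0 < C) {N : ℕ} [NeZero N] (hD : 2 ≤ D) (hM : 0 < M)
    (hN : N = (n + 1) * (D * M)) {R L : ℝ} (q : Fin (n + 1) → E n) (hR : ∀ c, ‖q c‖ ≤ R)
    (hL : ∀ c c', ‖q c - q c'‖ ≤ L) :
    ∃ h : ZMod N → E n, (∀ c : Fin (n + 1), window M (((c : ℕ) * (D * M) : ℕ) : ZMod N) h = q c) ∧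
      energy C h h ≤ R ^ 2 / C + (n + 1) ^ 2 * L ^ 2 * (D / (D - 1)) := by
  have hD' : (2 : ℝ) ≤ D := by exact_mod_cast hD
  have hM' : (0 : ℝ) < M := by exact_mod_cast hM
  have hNpos : (0 : ℝ) < N := Nat.cast_pos.2 (NeZero.pos N)
  set q' : ℕ → E n := fun c => q (Fin.ofNat (n + 1) c) with hq'
  have hper : ∀ c, q' (c + (n + 1)) = q' c := fun c => by
    simp only [hq']
    congr 1
    ext
    simp [Fin.ofNat]
  have hstep : ∀ c, ‖q' (c + 1) - q' c‖ ≤ L := fun c =>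
    hL (Fin.ofNat (n + 1) (c + 1)) (Fin.ofNat (n + 1) c)
  have hperN : Function.Periodic (polygon q' D M) N := fun v => by
    rw [hN]
    exact polygon_add hD hM hper v
  set h : ZMod N → E n := fun i => polygon q' D M i.val with hh
  have hcast : ∀ v : ℕ, h (v : ZMod N) = polygon q' D M v := fun v => by
    simp only [hh, ZMod.val_natCast]
    exact hperN.map_mod_nat v
  refine ⟨h, fun c => ?_, ?_⟩
  · rw [window_apply]
    have : ∀ j ∈ Finset.range M,
        h ((((c : ℕ) * (D * M) : ℕ) : ZMod N) + (j : ZMod N)) = q c := by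
      intro j hj
      rw [← Nat.cast_add, hcast, polygon_window hD _ (Finset.mem_range.1 hj)]
      simp only [hq']
      congr 1
      ext
      simp [Fin.ofNat, Nat.mod_eq_of_lt c.isLt]
    rw [Finset.sum_congr rfl this, Finset.sum_const, Finset.card_range, ← Nat.cast_smul_eq_nsmul ℝ,
      smul_smul, one_div_mul_cancel hM'.ne', one_smul]
  · rw [energy_self]
    have hR0 : 0 ≤ R := (norm_nonneg _).trans (hR 0)
    have hmean : ‖loopMean h‖ ≤ R := by
      rw [loopMean_apply, norm_smul, Real.norm_of_nonneg (by positivity)]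
      have : ‖∑ i, h i‖ ≤ ∑ _i : ZMod N, R :=
        norm_sum_le_of_le _ fun i _ => norm_polygon_le hD hM (fun c => hR _) _
      rw [Finset.sum_const, Finset.card_univ, ZMod.card, nsmul_eq_mul] at this
      rw [one_div, inv_mul_le_iff₀ hNpos]
      exact this
    have h1 : C⁻¹ * ‖loopMean h‖ ^ 2 ≤ R ^ 2 / C := by
      rw [div_eq_inv_mul]
      gcongr
    have h2 : ∑ i, ‖h (i + 1) - h i‖ ^ 2 ≤
        (n + 1) * (((D - 1) * M) * (L ^ 2 / (((D : ℝ) - 1) * M) ^ 2)) := by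
      have e1 : ∑ i : ZMod N, ‖h (i + 1) - h i‖ ^ 2 ≤ ∑ i : ZMod N,
          (fun r => if M ≤ r then L ^ 2 / (((D : ℝ) - 1) * M) ^ 2 else 0) (i.val % (D * M)) := by
        refine Finset.sum_le_sum fun i _ => ?_
        have : h (i + 1) = polygon q' D M (i.val + 1) := by
          rw [← hcast]
          simp
        rw [this]
        exact norm_polygon_succ_sub_sq_le (q := q') hD hM hstep i.val
      refine e1.trans (le_of_eq ?_)
      rw [sum_zmod_val (fun v => (fun r => if M ≤ r then L ^ 2 / (((D : ℝ) - 1) * M) ^ 2 else 0)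
        (v % (D * M))), hN,
        sum_range_mul_mod (fun r => if M ≤ r then L ^ 2 / (((D : ℝ) - 1) * M) ^ 2 else 0), ← Finset.sum_filter,
        Finset.sum_const, nsmul_eq_mul]
      have e3 : (Finset.range (D * M)).filter (fun r => M ≤ r) = Finset.Ico M (D * M) := by
        ext r
        simp [and_comm]
      rw [e3, Nat.card_Ico, Nat.cast_sub (by nlinarith)]
      push_cast
      ring
    have h3 := mul_le_mul_of_nonneg_left h2 hNpos.le
    have h4 : (N : ℝ) * ((n + 1) * (((D - 1) * M) * (L ^ 2 / (((D : ℝ) - 1) * M) ^ 2))) =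
        (n + 1) ^ 2 * L ^ 2 * (D / (D - 1)) := by
      have : (D : ℝ) - 1 ≠ 0 := by linarith
      rw [hN]
      push_cast
      field_simp
    linarith

end Interpolation

section Multipliers

/-- Gordan's alternative. -/
lemma exists_multiplier_of_forall_exists_nonneg {ι H : Type*} [AddCommGroup H] [Module ℝ H]
    (S : Finset ι) (φ : ι → H →ₗ[ℝ] ℝ) (h : ∀ k, ∃ a ∈ S, 0 ≤ φ a k) :
    ∃ μ : ι → ℝ, (∀ a ∈ S, 0 ≤ μ a) ∧ ∑ a ∈ S, μ a = 1 ∧ ∀ k, ∑ a ∈ S, μ a * φ a k = 0 := by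
  classical
  set O : Set (S → ℝ) := Set.univ.pi fun _ => Set.Iio 0 with hO
  set R : Set (S → ℝ) := ↑(LinearMap.range (LinearMap.pi fun a : S => φ a)) with hR
  have hOconv : Convex ℝ O := convex_pi fun _ _ => convex_Iio 0
  have hOopen : IsOpen O := isOpen_set_pi Set.finite_univ fun _ _ => isOpen_Iio
  have hRconv : Convex ℝ R := Submodule.convex _
  have hdisj : Disjoint O R := by
    rw [Set.disjoint_left]
    rintro w hw ⟨k, rfl⟩
    obtain ⟨a, ha, hk⟩ := h k
    have := hw ⟨a, ha⟩ (Set.mem_univ _)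
    simp only [LinearMap.pi_apply, Set.mem_Iio] at this
    linarith
  obtain ⟨f, u, h1, h2⟩ := geometric_hahn_banach_open hOconv hOopen hRconv hdisj
  have hu : u ≤ 0 := by simpa using h2 0 (Submodule.zero_mem _)
  have hf0 : ∀ k, f (fun a : S => φ a k) = 0 := by
    intro k
    by_contra hne
    have := h2 (((u - 1) / f fun a : S => φ a k) • fun a : S => φ a k)
      (Submodule.smul_mem _ _ ⟨k, rfl⟩)
    rw [map_smul, smul_eq_mul, div_mul_cancel₀ _ hne] at this
    linarith
  have hone : 0 < f (fun _ => 1) := by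
    have h3 := h1 (-fun _ => 1) fun a _ => by simp
    rw [map_neg] at h3
    linarith
  have hnn : ∀ a : S, 0 ≤ f (Pi.single a 1) := by
    intro a
    by_contra hneg
    push Not at hneg
    have hs : 0 < f (fun _ => 1) / -f (Pi.single a 1) := div_pos hone (by linarith)
    have h3 := h1 (-(f (fun _ => 1) / -f (Pi.single a 1)) • Pi.single a 1 - fun _ => 1) fun b _ => by
      by_cases hb : b = a
      · subst hb
        simp only [Pi.sub_apply, Pi.smul_apply, Pi.single_eq_same, smul_eq_mul, Set.mem_Iio]
        linarith
      · simp [hb]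
    rw [map_sub, map_smul, smul_eq_mul] at h3
    have : -(f (fun _ => 1) / -f (Pi.single a 1)) * f (Pi.single a 1) = f (fun _ => 1) := by
      rw [neg_mul, ← mul_neg, div_mul_cancel₀ _ (by linarith)]
    linarith
  have hsum : ∀ w : S → ℝ, f w = ∑ a : S, f (Pi.single a 1) * w a := by
    intro w
    conv_lhs => rw [← Finset.univ_sum_single w, map_sum]
    refine Finset.sum_congr rfl fun a _ => ?_
    have : (Pi.single a (w a) : S → ℝ) = w a • Pi.single a 1 := by
      rw [← Pi.single_smul, smul_eq_mul, mul_one]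
    rw [this, map_smul, smul_eq_mul, mul_comm]
  set ν : ι → ℝ := fun a => if ha : a ∈ S then f (Pi.single ⟨a, ha⟩ 1) else 0 with hν
  have hν' : ∀ a : S, ν a = f (Pi.single a 1) := fun a => by simp [hν]
  have hsum' : ∀ w : ι → ℝ, ∑ a ∈ S, ν a * w a = f fun a : S => w a := by
    intro w
    rw [hsum, ← Finset.sum_coe_sort]
    exact Finset.sum_congr rfl fun a _ => by rw [hν']
  refine ⟨fun a => ν a / f fun _ => 1, fun a ha => ?_, ?_, fun k => ?_⟩
  · have := hnn ⟨a, ha⟩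
    rw [← hν'] at this
    positivity
  · have := hsum' fun _ => 1
    simp only [mul_one] at this
    rw [← Finset.sum_div, this, div_self hone.ne']
  · have := hsum' fun a => φ a k
    rw [hf0] at this
    rw [← zero_div (f fun _ => 1), ← this, Finset.sum_div]
    exact Finset.sum_congr rfl fun a _ => by ring

variable {n N : ℕ} [NeZero N]

lemma penalty_add_smul (C κ : ℝ) (M : ℕ) (i : ZMod N) (p : E n) (y k : ZMod N → E n) (t : ℝ) :
    penalty C κ M i p (y + t • k) = penalty C κ M i p y +
      t * (2 * (energy C y k + κ * ⟪window M i y - p, window M i k⟫) +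
        t * (energy C k k + κ * ‖window M i k‖ ^ 2)) := by
  have e : window M i (y + t • k) - p = (window M i y - p) + t • window M i k := by
    rw [map_add, map_smul]
    abel
  simp only [penalty]
  rw [e, norm_add_sq_real, norm_smul, real_inner_smul_right, mul_pow, Real.norm_eq_abs, sq_abs]
  simp only [map_add, map_smul, LinearMap.add_apply, LinearMap.smul_apply, smul_eq_mul,
    energy_comm C k y]
  ring

/-- The Euler–Lagrange equations of a minimax critical loop. -/
lemma exists_forces {C κ : ℝ} (hC : 0 < C) {M : ℕ} (hM : 0 < M) {ι : Type*} (S : Finset ι)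
    (τ : ι → ZMod N) (p : ι → E n) {y : ZMod N → E n} {b : ℝ}
    (hb : ∀ a ∈ S, penalty C κ M (τ a) (p a) y = b)
    (hmin : ∀ y', ∃ a ∈ S, b ≤ penalty C κ M (τ a) (p a) y') :
    ∃ (μ : ι → ℝ) (F : ι → E n), (∀ a ∈ S, 0 ≤ μ a) ∧ ∑ a ∈ S, μ a = 1 ∧
      (∀ a, F a = (κ * μ a) • (p a - window M (τ a) y)) ∧
      (∀ i, window M i y = ∑ a ∈ S, (C - greenAvg N + smoothZ M (i - τ a)) • F a) ∧
      energy C y y = ∑ a ∈ S, ⟪F a, window M (τ a) y⟫ ∧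
      C * ‖∑ a ∈ S, F a‖ ^ 2 ≤ energy C y y := by
  obtain ⟨μ, hμ0, hμ1, hμ⟩ := exists_multiplier_of_forall_exists_nonneg S
    (fun a => energy C y + κ • (innerₛₗ ℝ (window M (τ a) y - p a)).comp (window M (τ a)))
    (fun k => by
      by_contra! hcon
      simp only [LinearMap.add_apply, LinearMap.smul_apply, LinearMap.comp_apply,
        innerₛₗ_apply_apply, smul_eq_mul] at hcon
      have hev : ∀ᶠ t in nhdsWithin (0 : ℝ) (Set.Ioi 0), ∀ a ∈ S,
          2 * (energy C y k + κ * ⟪window M (τ a) y - p a, window M (τ a) k⟫) +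
            t * (energy C k k + κ * ‖window M (τ a) k‖ ^ 2) < 0 := by
        rw [Filter.eventually_all_finset]
        intro a ha
        have hc : Continuous fun t : ℝ =>
            2 * (energy C y k + κ * ⟪window M (τ a) y - p a, window M (τ a) k⟫) +
              t * (energy C k k + κ * ‖window M (τ a) k‖ ^ 2) := by fun_prop
        refine (hc.tendsto 0).mono_left nhdsWithin_le_nhds |>.eventually_lt_const ?_
        have := hcon a ha
        linarith
      obtain ⟨t, ht, ht0⟩ := (hev.and self_mem_nhdsWithin).exists
      obtain ⟨a, ha, hle⟩ := hmin (y + t • k)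
      rw [penalty_add_smul, hb a ha] at hle
      have := mul_neg_of_pos_of_neg (Set.mem_Ioi.1 ht0) (ht a ha)
      linarith)
  simp only [LinearMap.add_apply, LinearMap.smul_apply, LinearMap.comp_apply,
    innerₛₗ_apply_apply, smul_eq_mul, mul_add, Finset.sum_add_distrib, ← Finset.sum_mul, hμ1,
    one_mul] at hμ
  set F : ι → E n := fun a => (κ * μ a) • (p a - window M (τ a) y) with hF
  have key : ∀ k, energy C y k = ∑ a ∈ S, ⟪F a, window M (τ a) k⟫ := by
    intro k
    rw [eq_neg_of_add_eq_zero_left (hμ k), ← Finset.sum_neg_distrib]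
    refine Finset.sum_congr rfl fun a _ => ?_
    rw [hF, real_inner_smul_left, ← neg_sub (window M (τ a) y), inner_neg_left]
    ring
  refine ⟨μ, F, hμ0, hμ1, fun a => rfl, fun i => ?_, key y, ?_⟩
  · refine ext_inner_right ℝ fun u => ?_
    rw [← energy_windowKernel M hC, key, sum_inner]
    refine Finset.sum_congr rfl fun a _ => ?_
    rw [window_windowKernel hM, real_inner_smul_left (F a), real_inner_smul_right, ← neg_sub i,
      smoothZ_neg]
  · have hmean : C⁻¹ • loopMean y = ∑ a ∈ S, F a := by
      refine ext_inner_right ℝ fun u => ?_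
      have h1 := key fun _ => u
      have hN : (N : ℝ) ≠ 0 := NeZero.ne _
      have hM' : (M : ℝ) ≠ 0 := by positivity
      have h2 : loopMean (fun _ : ZMod N => u) = u := by
        rw [loopMean_apply, Finset.sum_const, Finset.card_univ, ZMod.card,
          ← Nat.cast_smul_eq_nsmul ℝ, smul_smul, one_div_mul_cancel hN, one_smul]
      have h3 : ∀ i, window M i (fun _ : ZMod N => u) = u := fun i => by
        rw [window_apply, Finset.sum_const, Finset.card_range,
          ← Nat.cast_smul_eq_nsmul ℝ, smul_smul, one_div_mul_cancel hM', one_smul]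
      rw [energy_apply, h2] at h1
      simp only [h3, sub_self, inner_zero_right, Finset.sum_const_zero, mul_zero, add_zero] at h1
      rw [real_inner_smul_left, h1, sum_inner]
    rw [← hmean, norm_smul, mul_pow, energy_self, Real.norm_of_nonneg (by positivity)]
    have : C * (C⁻¹ ^ 2 * ‖loopMean y‖ ^ 2) = C⁻¹ * ‖loopMean y‖ ^ 2 := by field_simp
    rw [this]
    have : 0 ≤ (N : ℝ) * ∑ i, ‖y (i + 1) - y i‖ ^ 2 := by positivity
    linarith

end Multipliers

section Minimax

variable {n N : ℕ} [NeZero N] {D M : ℕ}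

/-- The colour of a lattice point, as a time on the discrete circle. -/
def colorTime (N D M : ℕ) (v : Fin n → ℕ) : ZMod N :=
  (((∑ i, v i) % (n + 1) * (D * M) : ℕ) : ZMod N)

omit [NeZero N] in
lemma colorTime_inj (hD : 2 ≤ D) (hM : 0 < M) (hN : N = (n + 1) * (D * M)) {v w : Fin n → ℕ}
    (h : colorTime N D M v = colorTime N D M w) : (∑ i, v i) % (n + 1) = (∑ i, w i) % (n + 1) := by
  have hpos : 0 < D * M := by positivity
  have hlt : ∀ u : Fin n → ℕ, (∑ i, u i) % (n + 1) * (D * M) < N := fun u => by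
    rw [hN]
    exact Nat.mul_lt_mul_of_pos_right (Nat.mod_lt _ n.succ_pos) hpos
  rw [colorTime, colorTime, ZMod.natCast_eq_natCast_iff', Nat.mod_eq_of_lt (hlt v),
    Nat.mod_eq_of_lt (hlt w)] at h
  exact Nat.eq_of_mul_eq_mul_right hpos h

lemma exists_penalty_le {C κ : ℝ} (hC : 0 < C) (hD : 2 ≤ D) (hM : 0 < M)
    (hN : N = (n + 1) * (D * M)) (lab : (Fin n → ℕ) → E n) {R L : ℝ}
    {F : Finset (Fin n → ℕ)} (hF : F.Nonempty)
    (hcol : Set.InjOn (fun v : Fin n → ℕ => (∑ i, v i) % (n + 1)) F)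
    (hR : ∀ v ∈ F, ‖lab v‖ ≤ R) (hL : ∀ v ∈ F, ∀ w ∈ F, ‖lab v - lab w‖ ≤ L) :
    ∃ h : ZMod N → E n, ∀ v ∈ F, penalty C κ M (colorTime N D M v) (lab v) h ≤
      R ^ 2 / C + (n + 1) ^ 2 * L ^ 2 * (D / (D - 1)) := by
  have hvert : ∀ c : Fin (n + 1), ∃ v ∈ F, ∀ w ∈ F, (∑ i, w i) % (n + 1) = c → v = w := by
    intro c
    by_cases h : ∃ w ∈ F, (∑ i, w i) % (n + 1) = c
    · obtain ⟨w, hw, hwc⟩ := h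
      exact ⟨w, hw, fun w' hw' h' => hcol hw hw' (hwc.trans h'.symm)⟩
    · push Not at h
      obtain ⟨v, hv⟩ := hF
      exact ⟨v, hv, fun w hw hwc => absurd hwc (h w hw)⟩
  choose vert hvF hvert using hvert
  obtain ⟨h, h1, h2⟩ := exists_energy_le hC hD hM hN (fun c => lab (vert c))
    (fun c => hR _ (hvF c)) fun c c' => hL _ (hvF c) _ (hvF c')
  refine ⟨h, fun v hv => ?_⟩
  have h3 := h1 ⟨(∑ i, v i) % (n + 1), Nat.mod_lt _ n.succ_pos⟩
  rw [hvert _ v hv rfl] at h3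
  rw [penalty, colorTime, h3, sub_self, norm_zero]
  simpa using h2

lemma exists_inner_nonpos {α : Type*} {pos : α → E n} {S : Finset α} {x : E n}
    (h : InHull pos S x) : ∃ a ∈ S, ∃ b ∈ S, ⟪pos a - x, pos b - x⟫ ≤ 0 := by
  obtain ⟨w, h0, h1, h2⟩ := h
  obtain ⟨a, ha⟩ : S.Nonempty := by
    by_contra hS
    rw [Finset.not_nonempty_iff_eq_empty] at hS
    simp [hS] at h1
  refine ⟨a, ha, ?_⟩
  by_contra! hcon
  have h3 : ∑ b ∈ S, w b * ⟪pos a - x, pos b - x⟫ = 0 := by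
    have : ∑ b ∈ S, w b * ⟪pos a - x, pos b - x⟫ = ⟪pos a - x, ∑ b ∈ S, w b • (pos b - x)⟫ := by
      simp only [inner_sum, real_inner_smul_right]
    rw [this]
    simp only [smul_sub, Finset.sum_sub_distrib, ← Finset.sum_smul, h1, h2, one_smul, sub_self,
      inner_zero_right]
  have h4 := (Finset.sum_eq_zero_iff_of_nonneg fun b hb =>
    mul_nonneg (h0 b hb) (hcon b hb).le).1 h3
  have h5 : ∑ b ∈ S, w b = 0 := Finset.sum_eq_zero fun b hb =>
    (mul_eq_zero.1 (h4 b hb)).resolve_right (hcon b hb).ne'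
  linarith

lemma smoothZ_sub_le (hM : 0 < M) (d : ZMod N) :
    smoothZ M (0 : ZMod N) - smoothZ M d ≤ 1 / 8 + 2 * (M / N) := by
  have h1 : ((d.val : ℤ) : ZMod N) = d := by simp
  have h2 : ((0 : ℤ) : ZMod N) = 0 := by simp
  rw [← h1, ← h2, smoothZ_intCast, smoothZ_intCast]
  have h3 := abs_le.1 (abs_smoothGreen_sub_green_le (N := N) hM (((0 : ℤ) : ℝ) / N))
  have h4 := abs_le.1 (abs_smoothGreen_sub_green_le (N := N) hM ((((d.val : ℤ) : ℤ) : ℝ) / N))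
  have h5 := green_nonpos (((0 : ℤ) : ℝ) / N)
  have h6 := neg_le_green ((((d.val : ℤ) : ℤ) : ℝ) / N)
  linarith [h3.2, h4.1]

/-- Loops visiting all labels of a simplex around `x₀` have a definite energy. -/
lemma exists_le_penalty {C κ : ℝ} (hC : 0 < C) (hκ : 0 < κ) (hM : 0 < M) {α : Type*}
    {τ : α → ZMod N} {pos : α → E n} {S : Finset α} {x : E n} (h : InHull pos S x) {ρ c₀ : ℝ}
    (hρ0 : 0 ≤ ρ) (hρ : ∀ a ∈ S, ρ ≤ ‖pos a - x‖) (hc₀ : 0 < c₀)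
    (hlow : 2 * √(c₀ / κ) + √(2 * c₀ * (1 / 8 + 2 * (M / N))) < √2 * ρ) (y : ZMod N → E n) :
    ∃ a ∈ S, c₀ ≤ penalty C κ M (τ a) (pos a) y := by
  obtain ⟨a, ha, b, hb, hab⟩ := exists_inner_nonpos h
  by_contra! hcon
  have hE := energy_self_nonneg hC y
  have hwin : ∀ a ∈ S, ‖window M (τ a) y - pos a‖ ≤ √(c₀ / κ) := by
    intro a ha
    refine Real.le_sqrt_of_sq_le ?_
    have := hcon a ha
    rw [penalty] at this
    rw [le_div_iff₀ hκ]
    linarith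
  have hEc : energy C y y ≤ c₀ := by
    have h1 := hcon a ha
    rw [penalty] at h1
    have : 0 ≤ κ * ‖window M (τ a) y - pos a‖ ^ 2 := by positivity
    linarith
  have h1 : ‖window M (τ a) y - window M (τ b) y‖ ≤ √(2 * c₀ * (1 / 8 + 2 * (M / N))) := by
    refine Real.le_sqrt_of_sq_le ((norm_sq_window_sub_le hC hM y _ _).trans ?_)
    have := smoothZ_sub_le hM (τ a - τ b)
    have := smoothZ_le hM (τ a - τ b)
    gcongr
  have h2 : √2 * ρ ≤ ‖pos a - pos b‖ := by
    refine (sq_le_sq₀ (by positivity) (norm_nonneg _)).1 ?_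
    have e : pos a - pos b = (pos a - x) - (pos b - x) := by abel
    rw [e, norm_sub_sq_real, mul_pow, Real.sq_sqrt zero_le_two]
    have := pow_le_pow_left₀ hρ0 (hρ a ha) 2
    have := pow_le_pow_left₀ hρ0 (hρ b hb) 2
    linarith
  have h3 : ‖pos a - pos b‖ ≤ ‖window M (τ a) y - pos a‖ +
      ‖window M (τ a) y - window M (τ b) y‖ + ‖window M (τ b) y - pos b‖ := by
    have e : pos a - pos b = -(window M (τ a) y - pos a) +
      (window M (τ a) y - window M (τ b) y) + (window M (τ b) y - pos b) := by abel
    rw [e]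
    refine (norm_add₃_le).trans (le_of_eq ?_)
    rw [norm_neg]
  have := hwin a ha
  have := hwin b hb
  linarith

/-- The minimax principle for discrete loops. -/
theorem exists_minimax_loop (hn : 1 ≤ n) {C κ : ℝ} (hC : 0 < C) (hκ : 0 < κ) (hD : 2 ≤ D)
    (hM : 0 < M) (hN : N = (n + 1) * (D * M)) {m : ℕ} (o : E n) {s : ℝ} (hs : 0 < s)
    (P : Finset (E n)) (lab : (Fin n → ℕ) → E n) (hlab : ∀ v, lab v ∈ P)
    (hbd : ∀ v ∈ latticeCube n m, (∃ i, v i = 0 ∨ v i = m) → lab v = o + s • latticePoint v)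
    {R Li Lb c₀ B ρ : ℝ} (hR : ∀ v, ‖lab v‖ ≤ R)
    (hLi : ∀ v ∈ latticeCube n m, ∀ w ∈ latticeCube n m, (∀ i, v i ≤ w i + 1 ∧ w i ≤ v i + 1) →
      ‖lab v - lab w‖ ≤ Li)
    (hLb : ∀ v ∈ latticeCube n m, ∀ w ∈ latticeCube n m, (∀ i, v i ≤ w i + 1 ∧ w i ≤ v i + 1) →
      (∃ i, v i = 0 ∨ v i = m) → (∃ i, w i = 0 ∨ w i = m) → ‖lab v - lab w‖ ≤ Lb)
    (hB : R ^ 2 / C + (n + 1) ^ 2 * Li ^ 2 * (D / (D - 1)) ≤ B)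
    (hc₀ : R ^ 2 / C + (n + 1) ^ 2 * Lb ^ 2 * (D / (D - 1)) < c₀)
    {x₀ : E n} (hx₀ : ∀ i, o i < x₀ i ∧ x₀ i < o i + s * m) {Q : Finset (E n)}
    (hgen : ∀ F ⊆ Q, F.card ≤ n → ¬InHull id F x₀) (hPQ : P ⊆ Q)
    (hQ : ∀ v ∈ latticeCube n m, o + s • latticePoint v ∈ Q)
    (hρ0 : 0 ≤ ρ) (hρ : ∀ p ∈ P, ρ ≤ ‖p - x₀‖) (hc₀' : 0 < c₀)
    (hlow : 2 * √(c₀ / κ) + √(2 * c₀ * (1 / 8 + 2 * (M / N))) < √2 * ρ) :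
    ∃ (S : Finset (ZMod N × P)) (y : ZMod N → E n) (b : ℝ), S.card = n + 1 ∧ c₀ ≤ b ∧ b ≤ B ∧
      (∀ a ∈ S, penalty C κ M a.1 (a.2 : E n) y = b) ∧ (∀ i, ∀ p ∈ P, b ≤ penalty C κ M i p y) ∧
      ∀ y', ∃ a ∈ S, b ≤ penalty C κ M a.1 (a.2 : E n) y' := by
  classical
  set L : (Fin n → ℕ) → ZMod N × P := fun v => (colorTime N D M v, ⟨lab v, hlab v⟩) with hL
  set pos : ZMod N × P → E n := fun a => a.2 with hpos
  have hinj : ∀ S ∈ (kuhn n m).support, Set.InjOn L S := by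
    intro S hS v hv w hw h
    obtain ⟨x, σ, hx, rfl⟩ := exists_of_mem_support_kuhn hS
    exact color_injOn_kuhnSimplex x σ hv hw (colorTime_inj hD hM hN (Prod.ext_iff.1 h).1)
  have hgenα : ∀ F : Finset (ZMod N × P), F.card ≤ n → ¬InHull pos F x₀ := by
    intro F hF hin
    refine hgen (F.image pos) (fun q hq => ?_) (Finset.card_image_le.trans hF)
      (InHull.image (pos := (id : E n → E n)) pos hin)
    obtain ⟨a, -, rfl⟩ := Finset.mem_image.1 hq
    exact hPQ a.2.2
  have hadj : ∀ {x : Fin n → ℕ} {σ : Equiv.Perm (Fin n)} {v w : Fin n → ℕ}, v ∈ kuhnSimplex x σ →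
      w ∈ kuhnSimplex x σ → ∀ i, v i ≤ w i + 1 ∧ w i ≤ v i + 1 := by
    intro x σ v w hv hw i
    have h1 := le_of_mem_kuhnSimplex hv i
    have h2 := le_of_mem_kuhnSimplex hw i
    omega
  have hcard : ∀ S ∈ (push L (kuhn n m)).support, S.card = n + 1 := fun S hS => by
      obtain ⟨S', hS', rfl⟩ := exists_of_mem_support_push hS
      rw [Finset.card_image_of_injOn (hinj S' hS')]
      obtain ⟨x, σ, hx, rfl⟩ := exists_of_mem_support_kuhn hS'
      exact card_kuhnSimplex x σ
  have hdeg : deg (fun S => if InHull pos S x₀ then 1 else 0) (push L (kuhn n m)) = 1 :=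
    deg_push_kuhn hn pos L o hs hx₀ hbd hinj hgen fun v hv => ⟨hPQ (hlab v), hQ v hv⟩
  have hlow' : ∀ S : Finset (ZMod N × P), S.card = n + 1 →
      (if InHull pos S x₀ then (1 : ZMod 2) else 0) ≠ 0 → ∀ y : ZMod N → E n,
      ∃ a ∈ S, c₀ ≤ penalty C κ M a.1 (a.2 : E n) y :=
    fun S _ hS y => by
      have hin : InHull pos S x₀ := by
        by_contra hcon
        exact hS (if_neg hcon)
      exact exists_le_penalty (τ := Prod.fst) hC hκ hM hin hρ0 (fun a _ => hρ _ a.2.2) hc₀' hlow y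
  have hbdry : ∀ F ∈ (bdry (push L (kuhn n m))).support, ∃ h : ZMod N → E n, ∀ a ∈ F,
      penalty C κ M a.1 (a.2 : E n) h < c₀ := fun F hF => by
      rw [bdry_push hinj] at hF
      obtain ⟨F', hF', rfl⟩ := exists_of_mem_support_push hF
      obtain ⟨i, hi⟩ := mem_boundary_of_mem_support_bdry_kuhn hn hF'
      have hside : ∀ v ∈ F', ∃ i, v i = 0 ∨ v i = m := fun v hv =>
        ⟨i, hi.imp (fun h => h v hv) fun h => h v hv⟩
      obtain ⟨S, hS, a, ha, rfl⟩ := exists_of_mem_support_bdry hF'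
      obtain ⟨x, σ, hx, rfl⟩ := exists_of_mem_support_kuhn hS
      have hcube : ∀ v ∈ (kuhnSimplex x σ).erase a, v ∈ latticeCube n m := fun v hv =>
        kuhnSimplex_subset_latticeCube hx σ (Finset.mem_of_mem_erase hv)
      obtain ⟨h, hh⟩ := exists_penalty_le (κ := κ) hC hD hM hN lab (R := R) (L := Lb)
        (F := (kuhnSimplex x σ).erase a)
        (Finset.card_pos.1 (by
          rw [Finset.card_erase_of_mem ha, card_kuhnSimplex]
          omega))
        ((color_injOn_kuhnSimplex x σ).mono (by
          rw [Finset.coe_erase]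
          exact Set.sdiff_subset))
        (fun v _ => hR v)
        fun v hv w hw => hLb v (hcube v hv) w (hcube w hw)
          (hadj (Finset.mem_of_mem_erase hv) (Finset.mem_of_mem_erase hw)) (hside v hv) (hside w hw)
      refine ⟨h, fun a ha => ?_⟩
      obtain ⟨v, hv, rfl⟩ := Finset.mem_image.1 ha
      exact (hh v hv).trans_lt hc₀
  have hup : ∀ S ∈ (push L (kuhn n m)).support, ∃ h : ZMod N → E n, ∀ a ∈ S,
      penalty C κ M a.1 (a.2 : E n) h ≤ B := fun S hS => by
      obtain ⟨S', hS', rfl⟩ := exists_of_mem_support_push hS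
      obtain ⟨x, σ, hx, rfl⟩ := exists_of_mem_support_kuhn hS'
      have hcube : ∀ v ∈ kuhnSimplex x σ, v ∈ latticeCube n m := fun v hv =>
        kuhnSimplex_subset_latticeCube hx σ hv
      obtain ⟨h, hh⟩ := exists_penalty_le (κ := κ) hC hD hM hN lab (R := R) (L := Li)
        (F := kuhnSimplex x σ)
        (Finset.card_pos.1 (by
          rw [card_kuhnSimplex]
          omega))
        (color_injOn_kuhnSimplex x σ)
        (fun v _ => hR v)
        fun v hv w hw => hLi v (hcube v hv) w (hcube w hw) (hadj hv hw)
      refine ⟨h, fun a ha => ?_⟩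
      obtain ⟨v, hv, rfl⟩ := Finset.mem_image.1 ha
      exact (hh v hv).trans hB
  obtain ⟨S, y, b, h1, h2, h3, h4, h5, h6⟩ := exists_critical (n := n)
    (g := fun (a : ZMod N × P) => penalty C κ M a.1 (a.2 : E n))
    (fun a => continuous_penalty _ _ _ _ _) (fun a => strictConvexOn_penalty hC hκ.le _ _ _)
    (fun a => tendsto_penalty hC hκ.le _ _ _)
    (c := fun S => if InHull pos S x₀ then 1 else 0)
    (fun T hT => sum_inHull_erase pos (by simp) hT fun F _ hF => hgenα F hF)
    hcard hdeg hlow' hbdry hup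
  exact ⟨S, y, b, h1, h2, h3, h4, fun i p hp => h5 (i, ⟨p, hp⟩), h6⟩

end Minimax

/-- The loop with forces `F j` exerted at the times `θ j`, and interaction kernel `g`. -/
def forcedLoop {n : ℕ} {ι : Type*} [Fintype ι] (g : ℝ → ℝ) (θ : ι → ℝ) (F : ι → E n) (m : E n)
    (t : ℝ) : E n :=
  m + ∑ j, g (t - θ j) • F j

/-- A loop which is an approximate billiard trajectory up to an error `ε`, and whose squared length
is approximately between `lo` and `hi`. -/
structure ApproxOrbit {n : ℕ} (V : Set (E n)) (lo hi ε : ℝ) where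
  /-- The interaction kernel. -/
  g : ℝ → ℝ
  /-- The times at which the loop stays in the domain. -/
  grid : Set ℝ
  /-- The bounce times. -/
  θ : Fin (n + 1) → ℝ
  /-- The approximate normal vectors. -/
  ν : Fin (n + 1) → E n
  /-- The approximate bounce points. -/
  p : Fin (n + 1) → E n
  /-- The forces. -/
  F : Fin (n + 1) → E n
  /-- The relative intensities of the forces. -/
  μ : Fin (n + 1) → ℝ
  /-- The centre of the loop. -/
  m : E n
  /-- The total intensity of the forces. -/
  Λ : ℝ
  /-- The distance to the complement of the domain. -/
  η : ℝ
  /-- The squared length. -/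
  b : ℝ
  /-- The time step. -/
  s : ℝ
  abs_g_sub_green_le : ∀ t, |g t - green t| ≤ ε
  g_neg : ∀ t, g (-t) = g t
  g_add_int : ∀ t (k : ℤ), g (t + k) = g t
  concaveOn_g : ConcaveOn ℝ Set.univ fun t => g t - t ^ 2 / 2
  θ_mem : ∀ j, θ j ∈ Set.Icc (0 : ℝ) 1
  θ_mem_grid : ∀ j, θ j ∈ grid
  exists_grid : ∀ t, ∃ t' ∈ grid, |t' - t| ≤ ε
  norm_ν : ∀ j, ‖ν j‖ = 1
  μ_nonneg : ∀ j, 0 ≤ μ j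
  sum_μ : ∑ j, μ j = 1
  Λ_pos : 0 < Λ
  η_pos : 0 < η
  η_le : η ≤ ε
  F_eq : ∀ j, F j = (Λ * μ j) • ν j
  p_notMem : ∀ j, p j ∉ V
  loop_θ : ∀ j, forcedLoop g θ F m (θ j) = p j - η • ν j
  le_norm_loop_sub : ∀ t ∈ grid, ∀ x ∉ V, (1 - ε) * η ≤ ‖forcedLoop g θ F m t - x‖
  norm_sq_loop_sub_le : ∀ t ∈ grid, ∀ t' ∈ grid,
    ‖forcedLoop g θ F m t - forcedLoop g θ F m t'‖ ^ 2 ≤ 2 * b * (g 0 - g (t - t'))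
  s_pos : 0 < s
  s_le : s ≤ ε
  abs_balance_le : ∀ i, |∑ j, ⟪F i, F j⟫ * (g (θ i - θ j + s) - g (θ i - θ j - s))| ≤ ε * s
  b_eq : b = ∑ j, ⟪F j, forcedLoop g θ F m (θ j)⟫ + Λ * η
  lo_le : lo ≤ b
  le_hi : b ≤ hi + ε
  norm_sum_F_le : ‖∑ j, F j‖ ≤ ε

section ApproxOrbit

variable {n N M : ℕ} [NeZero N]

omit [NeZero N] in
lemma norm_window_le (hM : 0 < M) {h : ZMod N → E n} {R : ℝ} (hR : ∀ i, ‖h i‖ ≤ R) (i : ZMod N) :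
    ‖window M i h‖ ≤ R := by
  have hM' : (0 : ℝ) < M := Nat.cast_pos.2 hM
  rw [window_apply, norm_smul, Real.norm_of_nonneg (by positivity)]
  have : ‖∑ j ∈ Finset.range M, h (i + (j : ZMod N))‖ ≤ M * R := by
    refine (norm_sum_le _ _).trans ((Finset.sum_le_sum fun j _ => hR _).trans_eq ?_)
    simp
  rw [div_mul_eq_mul_div, one_mul, div_le_iff₀ hM']
  linarith

lemma neg_le_greenAvg : -1 ≤ greenAvg N := by
  have hN : (0 : ℝ) < N := Nat.cast_pos.2 (NeZero.pos N)
  have h : ∑ _i : ZMod N, (-1 : ℝ) ≤ ∑ i : ZMod N, greenZ i :=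
    Finset.sum_le_sum fun i _ => by
      have := neg_le_green ((i.val : ℝ) / N)
      rw [greenZ]
      linarith
  rw [Finset.sum_const, Finset.card_univ, ZMod.card, nsmul_eq_mul] at h
  rw [greenAvg, div_mul_eq_mul_div, one_mul, le_div_iff₀ hN]
  linarith

/-- Forces at a minimax loop are almost balanced by the loop. -/
lemma inner_le_of_le_norm_add {κ μ η : ℝ} (hκ : 0 ≤ κ) (hμ0 : 0 ≤ μ) (hμ : μ ≤ 1) {w D : E n}
    (hw : ‖w‖ = η) (h : η ≤ ‖w + D‖) : ⟪(κ * μ) • -w, D⟫ ≤ κ * ‖D‖ ^ 2 / 2 := by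
  have h1 : ‖w‖ ^ 2 ≤ ‖w + D‖ ^ 2 := by
    rw [hw]
    exact pow_le_pow_left₀ (hw ▸ norm_nonneg w) h 2
  rw [norm_add_sq_real] at h1
  rw [real_inner_smul_left, inner_neg_left]
  have h2 : -⟪w, D⟫ ≤ ‖D‖ ^ 2 / 2 := by linarith
  have h3 : μ * (-⟪w, D⟫) ≤ ‖D‖ ^ 2 / 2 := by
    refine (mul_le_mul_of_nonneg_left h2 hμ0).trans (mul_le_of_le_one_left (by positivity) hμ)
  calc κ * μ * -⟪w, D⟫ = κ * (μ * -⟪w, D⟫) := by ring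
    _ ≤ κ * (‖D‖ ^ 2 / 2) := mul_le_mul_of_nonneg_left h3 hκ
    _ = _ := by ring

theorem nonempty_approxOrbit_of_minimax {C κ : ℝ} (hC : 0 < C) (hκ : 0 < κ) (hM : 0 < M)
    (hMN : M ≤ N) {V : Set (E n)} {P : Finset (E n)} (hPV : ∀ p ∈ P, p ∉ V)
    {S : Finset (ZMod N × P)} (hS : S.card = n + 1) {y : ZMod N → E n} {b : ℝ}
    (hb : ∀ a ∈ S, penalty C κ M a.1 (a.2 : E n) y = b)
    (hle : ∀ i, ∀ p ∈ P, b ≤ penalty C κ M i p y)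
    (hmin : ∀ y', ∃ a ∈ S, b ≤ penalty C κ M a.1 (a.2 : E n) y')
    {ε lo hi R : ℝ} (hε : 0 < ε) (hε1 : ε ≤ 1) (hlo : 0 < lo) (hlob : lo ≤ b) (hbhi : b ≤ hi + ε)
    (hR : √((C + 1) * (hi + 1)) + 1 ≤ R)
    (hnet : ∀ x ∉ V, ‖x‖ ≤ R → ∃ p ∈ P, ‖x - p‖ ≤ ε * (lo / (κ * R)))
    (hCε : (hi + 1) / C ≤ ε ^ 2) (hκε : (hi + 1) / κ ≤ ε ^ 2) (hMNε : (M : ℝ) / N ≤ ε)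
    (hMε : (κ + 2) * κ ^ 2 / M ≤ ε) : Nonempty (ApproxOrbit V lo hi ε) := by
  obtain ⟨μ, F, hμ0, hμ1, hF, hwin, hE, hsum⟩ :=
    exists_forces hC hM S Prod.fst (fun a => (a.2 : E n)) hb hmin
  have hN : (0 : ℝ) < N := Nat.cast_pos.2 (NeZero.pos N)
  have hM' : (0 : ℝ) < M := Nat.cast_pos.2 hM
  have hMN' : (M : ℝ) ≤ N := Nat.cast_le.2 hMN
  have hE0 := energy_self_nonneg hC y
  set Q := energy C y y with hQ
  set η := √((b - Q) / κ) with hη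
  have hdist : ∀ a ∈ S, ‖window M a.1 y - a.2‖ = η := by
    intro a ha
    have h1 := hb a ha
    rw [penalty] at h1
    have h2 : (b - Q) / κ = ‖window M a.1 y - a.2‖ ^ 2 := by
      rw [← h1]
      field_simp
      ring
    rw [hη, h2, Real.sqrt_sq (norm_nonneg _)]
  have hSne : S.Nonempty := Finset.card_pos.1 (by omega)
  have hbQ : b = Q + κ * η ^ 2 := by
    obtain ⟨a, ha⟩ := hSne
    rw [← hdist a ha, ← hb a ha, penalty]
  have hη0 : 0 ≤ η := Real.sqrt_nonneg _
  have hb1 : b ≤ hi + 1 := by linarith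
  have hQb : Q ≤ b := by
    have : 0 ≤ κ * η ^ 2 := by positivity
    linarith
  have hηε : η ≤ ε := by
    have h1 : η ^ 2 ≤ ε ^ 2 := by
      refine le_trans ?_ hκε
      rw [le_div_iff₀ hκ]
      linarith
    exact (sq_le_sq₀ hη0 hε.le).1 h1
  have hwinR : ∀ i, ‖window M i y‖ ≤ R - 1 := by
    refine norm_window_le hM fun i => ?_
    have h1 : ‖y i‖ ≤ √((C + 1) * (hi + 1)) := by
      refine Real.le_sqrt_of_sq_le ((norm_sq_apply_le hC y i).trans ?_)
      have := neg_le_greenAvg (N := N)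
      have := greenAvg_nonpos (N := N)
      refine mul_le_mul ?_ ?_ hE0 ?_ <;> linarith
    linarith
  have hR0 : 0 < R := by
    have := Real.sqrt_nonneg ((C + 1) * (hi + 1))
    linarith
  have hFn : ∀ a ∈ S, ‖F a‖ = κ * η * μ a := by
    intro a ha
    rw [hF, norm_smul, Real.norm_of_nonneg (mul_nonneg hκ.le (hμ0 a ha)), norm_sub_rev, hdist a ha]
    ring
  have hQη : Q ≤ κ * η * (R - 1) := by
    rw [hE]
    calc ∑ a ∈ S, ⟪F a, window M a.1 y⟫ ≤ ∑ a ∈ S, κ * η * (R - 1) * μ a :=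
          Finset.sum_le_sum fun a ha => by
            refine (real_inner_le_norm _ _).trans ?_
            rw [hFn a ha]
            have := hμ0 a ha
            calc κ * η * μ a * ‖window M a.1 y‖ ≤ κ * η * μ a * (R - 1) := by
                  gcongr
                  exact hwinR _
              _ = _ := by ring
      _ = _ := by rw [← Finset.mul_sum, hμ1, mul_one]
  have hηlo : lo / (κ * R) ≤ η := by
    rw [div_le_iff₀ (by positivity)]
    have : κ * η ^ 2 ≤ κ * η * 1 := by
      rw [sq, ← mul_assoc]
      gcongr
      linarith
    nlinarith
  have hηpos : 0 < η := lt_of_lt_of_le (by positivity) hηlo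
  let e : Fin (n + 1) ≃ S := (S.equivFinOfCardEq hS).symm
  have hsumS : ∀ {A : Type} [AddCommMonoid A] (G : ZMod N × P → A),
      ∑ j : Fin (n + 1), G (e j) = ∑ a ∈ S, G a := fun G => by
    rw [← Finset.sum_coe_sort S, ← Equiv.sum_comp e]
  have hval : ∀ d : ZMod N, ((d.val : ℤ) : ZMod N) = d := fun d => by simp
  set θ : Fin (n + 1) → ℝ := fun j => ((e j).1.1.val : ℝ) / N with hθ
  set m : E n := (C - greenAvg N) • ∑ a ∈ S, F a with hm
  have hloop : ∀ z : ℤ, forcedLoop (smoothGreen M N) θ (fun j => F (e j)) m (z / N) =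
      window M (z : ZMod N) y := by
    intro z
    rw [hwin, forcedLoop, hm]
    have h1 : ∀ a ∈ S, (C - greenAvg N + smoothZ M ((z : ZMod N) - a.1)) • F a =
        (C - greenAvg N) • F a + smoothGreen M N (z / N - a.1.val / N) • F a := by
      intro a _
      have h2 : (z : ZMod N) - a.1 = ((z - a.1.val : ℤ) : ZMod N) := by
        rw [Int.cast_sub, hval]
      rw [add_smul, h2, smoothZ_intCast]
      push_cast
      rw [sub_div]
    rw [Finset.sum_congr rfl h1, Finset.sum_add_distrib, Finset.smul_sum,
      ← hsumS fun a => smoothGreen M N (z / N - a.1.val / N) • F a]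
  have hloopθ : ∀ j, forcedLoop (smoothGreen M N) θ (fun j => F (e j)) m (θ j) =
      window M (e j).1.1 y := by
    intro j
    have h1 := hloop ((e j).1.1.val : ℤ)
    rwa [hval, Int.cast_natCast] at h1
  have hnear : ∀ i, ∀ p ∈ P, η ≤ ‖window M i y - p‖ := by
    intro i p hp
    have h2 := hle i p hp
    rw [penalty, hbQ] at h2
    have h3 : κ * η ^ 2 ≤ κ * ‖window M i y - p‖ ^ 2 := by linarith
    exact (sq_le_sq₀ hη0 (norm_nonneg _)).1 (le_of_mul_le_mul_left h3 hκ)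
  have hbal : ∀ i, |∑ j, ⟪F (e i), F (e j)⟫ * (smoothGreen M N (θ i - θ j + 1 / N) -
      smoothGreen M N (θ i - θ j - 1 / N))| ≤ ε * (1 / N) := by
    intro i
    set z : ℤ := ((e i).1.1.val : ℤ) with hz
    have hzθ : ((z : ℤ) : ℝ) / N = θ i := by rw [hz, Int.cast_natCast]
    have hzd : ∀ j, θ i - θ j = ((z - (e j).1.1.val : ℤ) : ℝ) / N := by
      intro j
      rw [← hzθ]
      push_cast
      rw [sub_div]
    set Dp : E n := ∑ j, (smoothGreen M N (θ i - θ j + 1 / N) - smoothGreen M N (θ i - θ j)) •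
      F (e j) with hDp
    set Dm : E n := ∑ j, (smoothGreen M N (θ i - θ j - 1 / N) - smoothGreen M N (θ i - θ j)) •
      F (e j) with hDm
    have hwp : window M ((z + 1 : ℤ) : ZMod N) y = window M (e i).1.1 y + Dp := by
      rw [← hloop, ← hloopθ, forcedLoop, forcedLoop, hDp, add_assoc, ← Finset.sum_add_distrib]
      congr 1
      refine Finset.sum_congr rfl fun j _ => ?_
      rw [← add_smul, Int.cast_add, add_div, hzθ, Int.cast_one, add_sub_right_comm]
      congr 1
      ring
    have hwm : window M ((z - 1 : ℤ) : ZMod N) y = window M (e i).1.1 y + Dm := by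
      rw [← hloop, ← hloopθ, forcedLoop, forcedLoop, hDm, add_assoc, ← Finset.sum_add_distrib]
      congr 1
      refine Finset.sum_congr rfl fun j _ => ?_
      rw [← add_smul, Int.cast_sub, sub_div, hzθ, Int.cast_one, sub_right_comm]
      congr 1
      ring
    have hnF : ∀ (c : Fin (n + 1) → ℝ) (B : ℝ), (∀ j, |c j| ≤ B) →
        ‖∑ j, c j • F (e j)‖ ≤ κ * η * B := by
      intro c B hc
      calc ‖∑ j, c j • F (e j)‖ ≤ ∑ j, B * (κ * η) * μ (e j) :=
            norm_sum_le_of_le _ fun j _ => by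
              rw [norm_smul, hFn _ (e j).2, Real.norm_eq_abs, mul_assoc B]
              exact mul_le_mul_of_nonneg_right (hc j)
                (mul_nonneg (mul_nonneg hκ.le hη0) (hμ0 _ (e j).2))
        _ = _ := by
          rw [← Finset.mul_sum, hsumS μ, hμ1]
          ring
    have hlip : ∀ t u : ℝ, |u| = 1 / N → |smoothGreen M N (t + u) - smoothGreen M N t| ≤ 1 / N := by
      intro t u hu
      refine (abs_smoothGreen_sub_le hM _ _).trans ?_
      rw [add_sub_cancel_left, hu]
    have hDpn : ‖Dp‖ ≤ κ * η * (1 / N) :=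
      hnF _ _ fun j => hlip _ _ (abs_of_pos (by positivity))
    have hDmn : ‖Dm‖ ≤ κ * η * (1 / N) :=
      hnF _ _ fun j => by
        have := hlip (θ i - θ j) (-(1 / N)) (by rw [abs_neg, abs_of_pos (by positivity)])
        rwa [← sub_eq_add_neg] at this
    have hDs : ‖Dp + Dm‖ ≤ κ * η * (1 / N ^ 2 + 1 / (N * M)) := by
      rw [hDp, hDm, ← Finset.sum_add_distrib]
      simp only [← add_smul]
      refine hnF _ _ fun j => ?_
      have := abs_smoothGreen_second_difference_le hM hMN (z - (e j).1.1.val)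
      rw [← hzd] at this
      refine le_trans (le_of_eq ?_) this
      congr 1
      ring
    have hμ1' : μ (e i) ≤ 1 := by
      rw [← hμ1]
      exact Finset.single_le_sum hμ0 (e i).2
    have hFw : F (e i) = (κ * μ (e i)) • -(window M (e i).1.1 y - (e i).1.2) := by
      rw [hF, neg_sub]
    have hp : ⟪F (e i), Dp⟫ ≤ κ * ‖Dp‖ ^ 2 / 2 := by
      rw [hFw]
      refine inner_le_of_le_norm_add hκ.le (hμ0 _ (e i).2) hμ1' (hdist _ (e i).2) ?_
      rw [← add_sub_right_comm, ← hwp]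
      exact hnear _ _ (e i).1.2.2
    have hq : ⟪F (e i), Dm⟫ ≤ κ * ‖Dm‖ ^ 2 / 2 := by
      rw [hFw]
      refine inner_le_of_le_norm_add hκ.le (hμ0 _ (e i).2) hμ1' (hdist _ (e i).2) ?_
      rw [← add_sub_right_comm, ← hwm]
      exact hnear _ _ (e i).1.2.2
    have hinn : |⟪F (e i), Dp + Dm⟫| ≤ κ * η * (κ * η * (1 / N ^ 2 + 1 / (N * M))) := by
      refine (abs_real_inner_le_norm _ _).trans ?_
      rw [hFn _ (e i).2]
      exact mul_le_mul (mul_le_of_le_one_right (by positivity) hμ1') hDs (norm_nonneg _)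
        (by positivity)
    have hsum' : ∑ j, ⟪F (e i), F (e j)⟫ * (smoothGreen M N (θ i - θ j + 1 / N) -
        smoothGreen M N (θ i - θ j - 1 / N)) = ⟪F (e i), Dp⟫ - ⟪F (e i), Dm⟫ := by
      rw [hDp, hDm, inner_sum, inner_sum, ← Finset.sum_sub_distrib]
      refine Finset.sum_congr rfl fun j _ => ?_
      rw [real_inner_smul_right, real_inner_smul_right]
      ring
    rw [hsum']
    rw [inner_add_right] at hinn
    have hη1 : η ≤ 1 := hηε.trans hε1
    have hDp2 : κ * ‖Dp‖ ^ 2 ≤ κ * (κ * (1 / N)) ^ 2 := by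
      have : κ * η * (1 / N) ≤ κ * 1 * (1 / N) := by gcongr
      rw [mul_one] at this
      gcongr
      exact hDpn.trans this
    have hDm2 : κ * ‖Dm‖ ^ 2 ≤ κ * (κ * (1 / N)) ^ 2 := by
      have : κ * η * (1 / N) ≤ κ * 1 * (1 / N) := by gcongr
      rw [mul_one] at this
      gcongr
      exact hDmn.trans this
    have hNM : (1 : ℝ) / N ^ 2 + 1 / (N * M) ≤ 2 / (N * M) := by
      have : (1 : ℝ) / N ^ 2 ≤ 1 / (N * M) := by
        rw [sq]
        gcongr
      have h2 : (2 : ℝ) / (N * M) = 1 / (N * M) + 1 / (N * M) := by ring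
      linarith
    have hinn2 : κ * η * (κ * η * (1 / N ^ 2 + 1 / (N * M))) ≤ κ ^ 2 * (2 / (N * M)) := by
      calc κ * η * (κ * η * (1 / N ^ 2 + 1 / (N * M))) ≤ κ * 1 * (κ * 1 * (2 / (N * M))) := by
            gcongr
        _ = _ := by ring
    have hκN : κ * (κ * (1 / N)) ^ 2 ≤ κ * κ ^ 2 * (1 / (N * M)) := by
      have : (1 : ℝ) / N ^ 2 ≤ 1 / (N * M) := by
        rw [sq]
        gcongr
      calc κ * (κ * (1 / N)) ^ 2 = κ * κ ^ 2 * (1 / N ^ 2) := by ring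
        _ ≤ _ := by gcongr
    have hfin : κ * κ ^ 2 * (1 / (N * M)) + κ ^ 2 * (2 / (N * M)) ≤ ε * (1 / N) := by
      calc κ * κ ^ 2 * (1 / (N * M)) + κ ^ 2 * (2 / (N * M)) =
            ((κ + 2) * κ ^ 2 / M) * (1 / N) := by
              field_simp
        _ ≤ _ := by gcongr
    have := abs_le.1 hinn
    rw [abs_le]
    constructor <;> linarith [this.1, this.2]
  refine ⟨⟨smoothGreen M N, Set.range fun z : ℤ => (z : ℝ) / N, θ, fun j =>
    η⁻¹ • ((e j).1.2 - window M (e j).1.1 y), fun j => (e j).1.2, fun j => F (e j),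
    fun j => μ (e j), m, κ * η, η, b, 1 / N, ?_, fun t => smoothGreen_neg t,
    fun t k => smoothGreen_add_int t k, concaveOn_smoothGreen hM, ?_, ?_, ?_, ?_, ?_, ?_,
    by positivity, hηpos, hηε, ?_, ?_, ?_, ?_, ?_, by positivity, ?_, hbal, ?_, hlob, hbhi, ?_⟩⟩
  · exact fun t => (abs_smoothGreen_sub_green_le hM t).trans hMNε
  · intro j
    refine ⟨by positivity, div_le_one_of_le₀ ?_ hN.le⟩
    exact_mod_cast (ZMod.val_lt _).le
  · exact fun j => ⟨((e j).1.1.val : ℤ), by simp [hθ]⟩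
  · intro t
    refine ⟨_, ⟨⌊t * N⌋, rfl⟩, ?_⟩
    have h1 := Int.floor_le (t * N)
    have h2 := Int.lt_floor_add_one (t * N)
    have h3 : (1 : ℝ) / N ≤ ε := by
      refine le_trans ?_ hMNε
      gcongr
      exact_mod_cast hM
    refine le_trans ?_ h3
    have h4 : (⌊t * N⌋ : ℝ) / N - t = (⌊t * N⌋ - t * N) / N := by
      field_simp
    rw [h4, abs_div, abs_of_pos hN]
    gcongr
    rw [abs_le]
    constructor <;> linarith
  · intro j
    rw [norm_smul, norm_sub_rev, hdist _ (e j).2, norm_inv, Real.norm_of_nonneg hη0,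
      inv_mul_cancel₀ hηpos.ne']
  · exact fun j => hμ0 _ (e j).2
  · rw [hsumS μ, hμ1]
  · intro j
    rw [hF, smul_smul]
    congr 1
    field_simp
  · exact fun j => hPV _ (e j).1.2.2
  · intro j
    rw [hloopθ, smul_inv_smul₀ hηpos.ne', sub_sub_cancel]
  · rintro _ ⟨z, rfl⟩ x hx
    change _ ≤ ‖forcedLoop _ _ _ _ ((z : ℝ) / N) - x‖
    rw [hloop]
    by_cases hxR : ‖x‖ ≤ R
    · obtain ⟨p, hp, hxp⟩ := hnet x hx hxR
      have h2 := norm_sub_le_norm_sub_add_norm_sub (window M (z : ZMod N) y) x p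
      have h3 := hnear z p hp
      have h4 : ε * (lo / (κ * R)) ≤ ε * η := by gcongr
      linarith
    · push Not at hxR
      have h2 := norm_sub_norm_le x (window M (z : ZMod N) y)
      rw [norm_sub_rev] at h2
      have h3 := hwinR z
      nlinarith
  · rintro _ ⟨z, rfl⟩ _ ⟨z', rfl⟩
    change ‖forcedLoop _ _ _ _ ((z : ℝ) / N) - forcedLoop _ _ _ _ ((z' : ℝ) / N)‖ ^ 2 ≤
      2 * b * (smoothGreen M N 0 - smoothGreen M N ((z : ℝ) / N - (z' : ℝ) / N))
    rw [hloop, hloop]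
    have h1 := norm_sq_window_sub_le hC hM y (z : ZMod N) (z' : ZMod N)
    have h2 := smoothZ_le hM ((z : ZMod N) - (z' : ZMod N))
    have h3 : smoothZ M (0 : ZMod N) = smoothGreen M N 0 := by
      simpa using smoothZ_intCast (N := N) M 0
    have h4 : smoothZ M ((z : ZMod N) - (z' : ZMod N)) =
        smoothGreen M N ((z : ℝ) / N - (z' : ℝ) / N) := by
      have := smoothZ_intCast (N := N) M (z - z')
      push_cast at this
      rw [this, sub_div]
    rw [h3, h4] at h1 h2
    refine h1.trans ?_
    gcongr
  · refine le_trans ?_ hMNε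
    gcongr
    exact_mod_cast hM
  · simp only [hloopθ]
    rw [hsumS fun a => ⟪F a, window M a.1 y⟫, ← hE, hbQ]
    ring
  · rw [hsumS F]
    have h1 : ‖∑ a ∈ S, F a‖ ^ 2 ≤ ε ^ 2 := by
      refine le_trans ?_ hCε
      rw [le_div_iff₀ hC]
      linarith
    exact (sq_le_sq₀ (norm_nonneg _) hε.le).1 h1

end ApproxOrbit

section Construction

variable {n : ℕ}

lemma norm_le_of_forall_abs_le {x : E n} {B : ℝ} (hB : 0 ≤ B) (h : ∀ i, |x i| ≤ B) :
    ‖x‖ ≤ n * B := by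
  have h1 : ‖x‖ ^ 2 ≤ (n * B) ^ 2 := by
    rw [EuclideanSpace.norm_sq_eq]
    calc ∑ i, ‖x i‖ ^ 2 ≤ ∑ _i : Fin n, B ^ 2 := Finset.sum_le_sum fun i _ => by
          rw [Real.norm_eq_abs]
          exact pow_le_pow_left₀ (abs_nonneg _) (h i) 2
      _ = n * B ^ 2 := by simp
      _ ≤ n ^ 2 * B ^ 2 := by
          gcongr
          exact_mod_cast Nat.le_self_pow two_ne_zero n
      _ = _ := by ring
  exact (sq_le_sq₀ (norm_nonneg _) (by positivity)).1 h1

lemma tendsto_mesh_bound (a c A : ℝ) :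
    Tendsto (fun k : ℕ => a ^ 2 * (c + n * (2 * A / k)) ^ 2 * ((k : ℝ) / (k - 1))) atTop
      (nhds ((a * c) ^ 2)) := by
  have h1 : Tendsto (fun k : ℕ => (k : ℝ) / (k - 1)) atTop (nhds 1) := by
    simpa [sub_eq_add_neg] using tendsto_natCast_div_add_atTop (-1 : ℝ)
  have h2 : Tendsto (fun k : ℕ => 2 * A / (k : ℝ)) atTop (nhds 0) :=
    tendsto_const_div_atTop_nhds_zero_nat _
  have h3 := (((h2.const_mul (n : ℝ)).const_add c).pow 2).const_mul (a ^ 2) |>.mul h1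
  convert h3 using 2
  ring

set_option maxHeartbeats 1000000 in
theorem nonempty_approxOrbit (hn : 1 ≤ n) {V : Set (E n)} {r A : ℝ} (hr : 0 < r) {x₁ : E n}
    (hx₁ : ∀ x ∉ V, 19 / 20 * r ≤ ‖x - x₁‖) (hproj : ∀ x ∈ V, ∃ p ∉ V, ‖x - p‖ ≤ r)
    (hA : ∀ x ∈ V, ‖x‖ < A) {ε : ℝ} (hε : 0 < ε) (hε1 : ε ≤ 1) :
    Nonempty (ApproxOrbit V (4 * r ^ 2) ((2 * (n + 1) * r) ^ 2) ε) := by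
  classical
  have hx₁V : x₁ ∈ V := by
    by_contra h
    have := hx₁ x₁ h
    rw [sub_self, norm_zero] at this
    linarith
  have hA0 : 0 < A := (norm_nonneg _).trans_lt (hA x₁ hx₁V)
  have hproj' : ∀ x, ∃ p ∉ V, ‖p - x‖ ≤ r ∧ (x ∉ V → p = x) := by
    intro x
    by_cases hx : x ∈ V
    · obtain ⟨p, hp, h⟩ := hproj x hx
      exact ⟨p, hp, by rwa [norm_sub_rev], fun h => absurd hx h⟩
    · exact ⟨x, hx, by simpa using hr.le, fun _ => rfl⟩
  choose π hπV hπr hπ using hproj'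
  set lo : ℝ := 4 * r ^ 2 with hlo
  set hi : ℝ := (2 * (n + 1) * r) ^ 2 with hhi
  have hlo0 : 0 < lo := by positivity
  set R₀ : ℝ := n * A + r with hR₀
  have hdiv : ∀ a δ : ℝ, 0 < δ → ∀ᶠ x : ℝ in atTop, a / x ≤ δ := fun a δ hδ =>
    (tendsto_const_nhds.div_atTop tendsto_id).eventually (eventually_le_nhds hδ)
  obtain ⟨C, hC, hC1, hC2, hC3⟩ : ∃ C : ℝ, 0 < C ∧ R₀ ^ 2 / C ≤ ε / 2 ∧ R₀ ^ 2 / C ≤ r ^ 2 ∧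
      (hi + 1) / C ≤ ε ^ 2 :=
    ((eventually_gt_atTop 0).and ((hdiv _ _ (by positivity)).and ((hdiv _ _ (by positivity)).and
      (hdiv _ _ (by positivity))))).exists
  obtain ⟨κ, hκ, hκ1, hκ2⟩ : ∃ κ : ℝ, 0 < κ ∧ lo / κ ≤ (r / 20) ^ 2 ∧ (hi + 1) / κ ≤ ε ^ 2 :=
    ((eventually_gt_atTop 0).and ((hdiv _ _ (by positivity)).and (hdiv _ _ (by positivity)))).exists
  obtain ⟨k, hk, hkε, hk1, hk2⟩ : ∃ k : ℕ, 100 ≤ k ∧ (1 : ℝ) / k ≤ ε ∧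
      ((n : ℝ) + 1) ^ 2 * (2 * r + n * (2 * A / k)) ^ 2 * ((k : ℝ) / (k - 1)) ≤ hi + ε / 2 ∧
      ((n : ℝ) + 1) ^ 2 * (0 + n * (2 * A / k)) ^ 2 * ((k : ℝ) / (k - 1)) ≤ r ^ 2 := by
    refine ((eventually_ge_atTop 100).and
      (((tendsto_const_div_atTop_nhds_zero_nat _).eventually (eventually_le_nhds hε)).and
      (((tendsto_mesh_bound _ _ A).eventually (eventually_le_nhds ?_)).and
      ((tendsto_mesh_bound _ _ A).eventually (eventually_le_nhds ?_))))).exists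
    · have : ((n : ℝ) + 1) * (2 * r) = 2 * (n + 1) * r := by ring
      rw [this]
      linarith
    · rw [mul_zero, zero_pow two_ne_zero]
      positivity
  obtain ⟨M, hM, hM1⟩ : ∃ M : ℕ, 0 < M ∧ (κ + 2) * κ ^ 2 / (M : ℝ) ≤ ε :=
    ((eventually_gt_atTop 0).and (tendsto_natCast_atTop_atTop.eventually (hdiv _ _ hε))).exists
  set N : ℕ := (n + 1) * (k * M) with hN
  have hMN : M ≤ N := by
    rw [hN, ← mul_assoc]
    exact Nat.le_mul_of_pos_left _ (by positivity)
  have : NeZero N := ⟨(hM.trans_le hMN).ne'⟩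
  have hM' : (0 : ℝ) < M := Nat.cast_pos.2 hM
  have hk' : (100 : ℝ) ≤ k := by exact_mod_cast hk
  have hMNk : (M : ℝ) / N ≤ 1 / k := by
    rw [div_le_div_iff₀ (by exact_mod_cast hM.trans_le hMN) (by linarith), hN]
    push_cast
    have : 0 ≤ (n : ℝ) * (k * M) := by positivity
    linarith
  set s : ℝ := 2 * A / k with hs
  have hs0 : 0 < s := by positivity
  have hsk : s * k = 2 * A := by
    rw [hs]
    field_simp
  set o : E n := WithLp.toLp 2 fun _ => -A with ho
  set q : (Fin n → ℕ) → E n := fun v => o + s • latticePoint v with hq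
  have hqi : ∀ v i, q v i = -A + s * v i := fun v i => by
    simp [hq, ho, latticePoint]
  have hcube : ∀ v, v ∈ latticeCube n k → ∀ i, v i ≤ k := fun v hv i => by
    simpa [latticeCube, Nat.lt_succ_iff] using Fintype.mem_piFinset.1 hv i
  have hqn : ∀ v ∈ latticeCube n k, ‖q v‖ ≤ n * A := by
    intro v hv
    refine norm_le_of_forall_abs_le hA0.le fun i => ?_
    have h1 : (v i : ℝ) ≤ k := by exact_mod_cast hcube v hv i
    have h2 : s * v i ≤ s * k := by gcongr
    have h3 : 0 ≤ s * v i := by positivity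
    rw [hqi, abs_le]
    constructor <;> linarith
  have hqsub : ∀ v w : Fin n → ℕ, (∀ i, v i ≤ w i + 1 ∧ w i ≤ v i + 1) → ‖q v - q w‖ ≤ n * s := by
    intro v w h
    refine norm_le_of_forall_abs_le hs0.le fun i => ?_
    have h1 : (v i : ℝ) ≤ w i + 1 := by exact_mod_cast (h i).1
    have h2 : (w i : ℝ) ≤ v i + 1 := by exact_mod_cast (h i).2
    have h3 := mul_le_mul_of_nonneg_left h1 hs0.le
    have h4 := mul_le_mul_of_nonneg_left h2 hs0.le
    rw [PiLp.sub_apply, hqi, hqi, abs_le]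
    constructor <;> linarith
  have hqbd : ∀ v : Fin n → ℕ, (∃ i, v i = 0 ∨ v i = k) → q v ∉ V := by
    rintro v ⟨i, hi⟩ hv
    have h1 := hA _ hv
    have h2 := PiLp.norm_apply_le (q v) i
    rw [Real.norm_eq_abs, hqi] at h2
    rcases hi with hi | hi
    · rw [hi, Nat.cast_zero, mul_zero, add_zero, abs_neg, abs_of_pos hA0] at h2
      linarith
    · rw [hi, hsk, show -A + 2 * A = A by ring, abs_of_pos hA0] at h2
      linarith
  set lab : (Fin n → ℕ) → E n := fun v => if v ∈ latticeCube n k then π (q v) else π (q 0) with hlab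
  have hlab1 : ∀ v ∈ latticeCube n k, lab v = π (q v) := fun v hv => if_pos hv
  have hlabR : ∀ v, ‖lab v‖ ≤ R₀ := by
    have h1 : ∀ v ∈ latticeCube n k, ‖π (q v)‖ ≤ R₀ := by
      intro v hv
      have h2 := norm_sub_norm_le (π (q v)) (q v)
      have h3 := hπr (q v)
      have h4 := hqn v hv
      linarith
    intro v
    by_cases hv : v ∈ latticeCube n k
    · rw [hlab1 v hv]
      exact h1 v hv
    · rw [hlab]
      simp only [if_neg hv]
      exact h1 _ (by simp [latticeCube])
  set R : ℝ := √((C + 1) * (hi + 1)) + 1 with hR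
  have hR0 : 0 < R := by positivity
  obtain ⟨t, htV, htfin, ht⟩ := Metric.finite_approx_of_totallyBounded
    ((isCompact_closedBall (0 : E n) R).totallyBounded.subset
      (Set.inter_subset_right (s := Vᶜ))) (ε * (lo / (κ * R))) (by positivity)
  set P : Finset (E n) := htfin.toFinset ∪ (insert (0 : Fin n → ℕ) (latticeCube n k)).image
    (fun v => π (q v)) with hP
  have hPV : ∀ p ∈ P, p ∉ V := by
    intro p hp
    rw [hP, Finset.mem_union, Finset.mem_image, Set.Finite.mem_toFinset] at hp
    rcases hp with hp | ⟨v, -, rfl⟩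
    · exact (htV hp).1
    · exact hπV _
  have hlabP : ∀ v, lab v ∈ P := by
    intro v
    refine Finset.mem_union_right _ (Finset.mem_image.2 ?_)
    by_cases hv : v ∈ latticeCube n k
    · exact ⟨v, Finset.mem_insert_of_mem hv, (hlab1 v hv).symm⟩
    · exact ⟨0, Finset.mem_insert_self _ _, (if_neg hv).symm⟩
  obtain ⟨x₀, hx₀, hgen⟩ := exists_generic (P ∪ (latticeCube n k).image q) id x₁
    (show 0 < r / 20 by positivity)
  rw [Metric.mem_ball, dist_eq_norm] at hx₀
  have hx₀V : x₀ ∈ V := by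
    by_contra h
    have := hx₁ _ h
    linarith
  obtain ⟨S, y, b, h1, h2, h3, h4, h5, h6⟩ := exists_minimax_loop (N := N) (D := k) (M := M) (m := k)
    (κ := κ) hn hC hκ (by omega) hM hN o hs0 P lab hlabP
    (fun v hv hvb => (hlab1 v hv).trans (hπ _ (hqbd v hvb)))
    (R := R₀) (Li := 2 * r + n * s) (Lb := 0 + n * s) (c₀ := lo) (B := hi + ε) (ρ := 9 / 10 * r)
    hlabR
    (fun v hv w hw h => by
      rw [hlab1 v hv, hlab1 w hw]
      have e : π (q v) - π (q w) = (π (q v) - q v) + (q v - q w) + (q w - π (q w)) := by abel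
      rw [e]
      refine norm_add₃_le.trans ?_
      have := hπr (q v)
      have := hπr (q w)
      have := hqsub v w h
      rw [norm_sub_rev (q w)]
      linarith)
    (fun v hv w hw h hvb hwb => by
      rw [hlab1 v hv, hlab1 w hw, hπ _ (hqbd v hvb), hπ _ (hqbd w hwb), zero_add]
      exact hqsub v w h)
    (by linarith) (by nlinarith) (x₀ := x₀)
    (fun i => by
      have h1 := hA _ hx₀V
      have h2 := PiLp.norm_apply_le x₀ i
      rw [Real.norm_eq_abs, abs_le] at h2
      have h3 : o i = -A := rfl
      rw [h3, hsk]
      constructor <;> linarith)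
    hgen Finset.subset_union_left
    (fun v hv => Finset.mem_union_right _ (Finset.mem_image_of_mem _ hv)) (by positivity)
    (fun p hp => by
      have h1 := hx₁ p (hPV p hp)
      have h2 := norm_sub_le_norm_sub_add_norm_sub p x₀ x₁
      linarith)
    hlo0
    (by
      have h1 : √(lo / κ) ≤ r / 20 := Real.sqrt_le_iff.2 ⟨by positivity, hκ1⟩
      have h2 : √(2 * lo * (1 / 8 + 2 * (M / N))) ≤ 27 / 25 * r := by
        refine Real.sqrt_le_iff.2 ⟨by positivity, ?_⟩
        have h3 : (M : ℝ) / N ≤ 1 / 100 := hMNk.trans (by gcongr)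
        have h4 : 2 * lo * (1 / 8 + 2 * ((M : ℝ) / N)) ≤ 2 * lo * (1 / 8 + 2 * (1 / 100)) := by
          gcongr
        refine h4.trans ?_
        rw [hlo]
        nlinarith [sq_nonneg r]
      have h3 : (141 / 100 : ℝ) ≤ √2 := Real.le_sqrt_of_sq_le (by norm_num)
      nlinarith)
  exact nonempty_approxOrbit_of_minimax hC hκ hM hMN hPV h1 h4 h5 h6 hε hε1 hlo0 h2 h3 le_rfl
    (fun x hxV hxR => by
      obtain ⟨p, hp, hxp⟩ := Set.mem_iUnion₂.1 (ht ⟨hxV, by simpa using hxR⟩)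
      rw [Metric.mem_ball, dist_eq_norm] at hxp
      exact ⟨p, Finset.mem_union_left _ (htfin.mem_toFinset.2 hp), hxp.le⟩)
    hC3 hκ2 (hMNk.trans hkε) hM1

end Construction

section Limits

lemma Ultrafilter.exists_tendsto_of_norm_le {X ι : Type*} [NormedAddCommGroup X] [ProperSpace X]
    (l : Ultrafilter ι) {u : ι → X} {C : ℝ} (h : ∀ᶠ k in (l : Filter ι), ‖u k‖ ≤ C) :
    ∃ x, ‖x‖ ≤ C ∧ Tendsto u l (nhds x) := by
  obtain ⟨x, hx, h⟩ := (isCompact_closedBall (0 : X) C).ultrafilter_le_nhds' (l.map u)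
    (Filter.mem_map.2 (by filter_upwards [h] with k hk using by simpa using hk))
  exact ⟨x, by simpa using hx, h⟩

lemma green_add_of_fract_eq_zero {t : ℝ} (ht : Int.fract t = 0) {s : ℝ} (hs : |s| ≤ 1) :
    green (t + s) = green t - |s| / 2 + s ^ 2 / 2 := by
  have h1 : t = ⌊t⌋ := (sub_eq_zero.1 ht)
  have h2 : green t = 0 := by simp [green, ht]
  rw [h2, h1, add_comm, green_add_int]
  rcases le_total 0 s with h | h
  · rw [abs_of_nonneg h] at hs ⊢
    rw [green_eq (k := 0) (by simpa using h) (by simpa using hs)]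
    push_cast
    ring
  · rw [abs_of_nonpos h] at hs ⊢
    rw [← green_neg, green_eq (k := 0) (by simpa using h) (by simpa using hs)]
    push_cast
    ring

lemma green_add_of_fract_ne_zero {t : ℝ} {s : ℝ} (h1 : -Int.fract t ≤ s)
    (h2 : s ≤ 1 - Int.fract t) :
    green (t + s) = green t + (Int.fract t - 1 / 2) * s + s ^ 2 / 2 := by
  have h3 := Int.floor_add_fract t
  rw [green_eq (k := ⌊t⌋) (by linarith) (by linarith), green]
  have h4 : t + s - ⌊t⌋ = Int.fract t + s := by rw [Int.fract]; ring
  rw [h4]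
  ring

lemma tendsto_kernel {ι : Type*} {l : Filter ι} {g : ι → ℝ → ℝ} {ε : ι → ℝ}
    (hε : Tendsto ε l (nhds 0)) (hg : ∀ k t, |g k t - green t| ≤ ε k) {x : ι → ℝ} {a : ℝ}
    (hx : Tendsto x l (nhds a)) : Tendsto (fun k => g k (x k)) l (nhds (green a)) := by
  have h1 : Tendsto (fun k => g k (x k) - green (x k)) l (nhds 0) :=
    squeeze_zero_norm (fun k => hg k (x k)) hε
  have h2 := h1.add ((continuous_green.tendsto a).comp hx)
  simpa using h2

/-- The symmetric difference quotients of concave perturbations of the Green kernel converge. -/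
lemma tendsto_kernel_slope {ι : Type*} {l : Filter ι} {g : ι → ℝ → ℝ} {ε : ι → ℝ}
    (hε : Tendsto ε l (nhds 0)) (hg : ∀ k t, |g k t - green t| ≤ ε k)
    (hconc : ∀ k, ConcaveOn ℝ Set.univ fun t => g k t - t ^ 2 / 2) {x s : ι → ℝ} {a : ℝ}
    (hx : Tendsto x l (nhds a)) (hs : Tendsto s l (nhds 0)) (hs0 : ∀ k, 0 < s k)
    (ha : Int.fract a ≠ 0) :
    Tendsto (fun k => (g k (x k + s k) - g k (x k - s k)) / (2 * s k)) l
      (nhds (Int.fract a - 1 / 2)) := by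
  obtain ⟨δ, hδ, hδ1, hδ2⟩ : ∃ δ : ℝ, 0 < δ ∧ δ ≤ Int.fract a ∧ δ ≤ 1 - Int.fract a := by
    have h1 : 0 < Int.fract a := (Int.fract_nonneg a).lt_of_ne' ha
    have h2 := Int.fract_lt_one a
    exact ⟨min (Int.fract a) (1 - Int.fract a), by simp [h1, h2], min_le_left _ _, min_le_right _ _⟩
  have h : ∀ {y : ι → ℝ} {c : ℝ}, Tendsto y l (nhds c) →
      Tendsto (fun k => g k (y k)) l (nhds (green c)) := fun h => tendsto_kernel hε hg h
  have hup : Tendsto (fun k => ((g k (x k - s k) - (x k - s k) ^ 2 / 2) -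
      (g k (x k - δ) - (x k - δ) ^ 2 / 2)) / (δ - s k) + x k) l (nhds (Int.fract a - 1 / 2)) := by
    have h1 := (((h (hx.sub hs)).sub (((hx.sub hs).pow 2).div_const 2)).sub
      ((h (hx.sub_const δ)).sub (((hx.sub_const δ).pow 2).div_const 2))).div
      (hs.const_sub δ) (by simpa using hδ.ne') |>.add hx
    convert h1 using 2
    · rfl
    have := green_add_of_fract_ne_zero (t := a) (s := -δ) (by linarith) (by linarith)
    rw [sub_zero, sub_zero, sub_eq_add_neg a δ, this]
    field_simp
    ring
  have hlow : Tendsto (fun k => ((g k (x k + δ) - (x k + δ) ^ 2 / 2) -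
      (g k (x k + s k) - (x k + s k) ^ 2 / 2)) / (δ - s k) + x k) l
      (nhds (Int.fract a - 1 / 2)) := by
    have h1 := (((h (hx.add_const δ)).sub (((hx.add_const δ).pow 2).div_const 2)).sub
      ((h (hx.add hs)).sub (((hx.add hs).pow 2).div_const 2))).div
      (hs.const_sub δ) (by simpa using hδ.ne') |>.add hx
    convert h1 using 2
    · rfl
    have := green_add_of_fract_ne_zero (t := a) (s := δ) (by linarith) (by linarith)
    rw [add_zero, sub_zero, this]
    field_simp
    ring
  have hev : ∀ᶠ k in l, s k < δ := hs.eventually (gt_mem_nhds hδ)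
  have key : ∀ k, (g k (x k + s k) - g k (x k - s k)) / (2 * s k) =
      ((g k (x k + s k) - (x k + s k) ^ 2 / 2) - (g k (x k - s k) - (x k - s k) ^ 2 / 2)) /
        ((x k + s k) - (x k - s k)) + x k := by
    intro k
    have := (hs0 k).ne'
    have e : (x k + s k) - (x k - s k) = 2 * s k := by ring
    rw [e]
    field_simp
    ring
  refine tendsto_of_tendsto_of_tendsto_of_le_of_le' hlow hup ?_ ?_
  · filter_upwards [hev] with k hk
    rw [key]
    have := (hconc k).slope_anti_adjacent (Set.mem_univ (x k - s k)) (Set.mem_univ (x k + δ))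
      (y := x k + s k) (by linarith [hs0 k]) (by linarith)
    rw [add_sub_add_left_eq_sub] at this
    linarith
  · filter_upwards [hev] with k hk
    rw [key]
    have := (hconc k).slope_anti_adjacent (Set.mem_univ (x k - δ)) (Set.mem_univ (x k + s k))
      (y := x k - s k) (by linarith) (by linarith [hs0 k])
    rw [sub_sub_sub_cancel_left] at this
    linarith

variable {n : ℕ}

/-- Points approached by complementary points which are almost nearest to inner points lie on the
boundary, in the direction of the outward normal vector. -/
lemma eq_norm_smul_of_tendsto {ι : Type*} {l : Filter ι} [l.NeBot] {f : E n → ℝ} {V : Set (E n)}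
    (hVf : V = {x | f x < 0}) {p₀ G ν₀ : E n} (hG : HasStrictFDerivAt f (innerSL ℝ G) p₀)
    {p ν : ι → E n} {η ε : ι → ℝ} (hε : Tendsto ε l (nhds 0)) (hε0 : ∀ k, 0 < ε k)
    (hη : Tendsto η l (nhds 0)) (hη0 : ∀ k, 0 < η k) (hν1 : ∀ k, ‖ν k‖ = 1)
    (hp : Tendsto p l (nhds p₀)) (hν : Tendsto ν l (nhds ν₀)) (hpV : ∀ k, p k ∉ V)
    (hfar : ∀ k, ∀ x ∉ V, (1 - ε k) * η k ≤ ‖(p k - η k • ν k) - x‖) :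
    f p₀ = 0 ∧ G = ‖G‖ • ν₀ := by
  have hev : ∀ᶠ k in l, ε k < 1 / 2 := hε.eventually (gt_mem_nhds (by norm_num))
  have hin : ∀ u : E n, ‖u‖ ≤ 1 → ∀ᶠ k in l,
      f (p k + η k • ((1 - 2 * ε k) • u - ν k)) < 0 := by
    intro u hu
    filter_upwards [hev] with k hk
    by_contra hneg
    have h1 := hfar k (p k + η k • ((1 - 2 * ε k) • u - ν k)) (by rw [hVf]; exact hneg)
    have e : p k - η k • ν k - (p k + η k • ((1 - 2 * ε k) • u - ν k)) =
        -((η k * (1 - 2 * ε k)) • u) := by module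
    have h3 : 0 < η k * (1 - 2 * ε k) := mul_pos (hη0 k) (by linarith)
    rw [e, norm_neg, norm_smul, Real.norm_of_nonneg h3.le] at h1
    have h2 := mul_le_mul_of_nonneg_left hu h3.le
    have := mul_pos (hε0 k) (hη0 k)
    linarith
  have hlim : ∀ u : E n, Tendsto (fun k => (1 - 2 * ε k) • u - ν k) l (nhds (u - ν₀)) := by
    intro u
    have h1 : Tendsto (fun k => (1 - 2 * ε k) • u) l (nhds u) := by
      simpa using ((hε.const_mul 2).const_sub 1).smul_const u
    exact h1.sub hν
  have hlim' : ∀ u : E n,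
      Tendsto (fun k => p k + η k • ((1 - 2 * ε k) • u - ν k)) l (nhds p₀) := by
    intro u
    simpa using hp.add (hη.smul (hlim u))
  have hp0 : ∀ k, 0 ≤ f (p k) := fun k => by
    have := hpV k
    rw [hVf] at this
    exact not_lt.1 this
  refine ⟨le_antisymm ?_ ?_, ?_⟩
  · exact le_of_tendsto (hG.continuousAt.tendsto.comp (hlim' 0))
      ((hin 0 (by simp)).mono fun k hk => hk.le)
  · exact ge_of_tendsto (hG.continuousAt.tendsto.comp hp) (Eventually.of_forall hp0)
  have hle : ∀ u : E n, ‖u‖ ≤ 1 → ⟪G, u - ν₀⟫ ≤ 0 := by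
    intro u hu
    have h1 : Tendsto (fun k => ⟪G, (1 - 2 * ε k) • u - ν k⟫) l (nhds ⟪G, u - ν₀⟫) :=
      tendsto_const_nhds.inner (hlim u)
    refine le_of_forall_pos_le_add fun δ hδ => ?_
    refine le_of_tendsto h1 ?_
    have h2 := (((hlim' u).prodMk_nhds hp).eventually
      (hG.isLittleO.def (c := δ / 2) (by positivity)))
    filter_upwards [h2, hin u hu, hev] with k hk hk1 hk2
    have h4 : ‖(1 - 2 * ε k) • u - ν k‖ ≤ 2 := by
      refine (norm_sub_le _ _).trans ?_
      rw [norm_smul, hν1, Real.norm_of_nonneg (by linarith)]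
      have := mul_le_mul_of_nonneg_left hu (show 0 ≤ 1 - 2 * ε k by linarith)
      linarith [hε0 k]
    simp only [add_sub_cancel_left, map_smul, innerSL_apply_apply, norm_smul, smul_eq_mul] at hk
    rw [Real.norm_of_nonneg (hη0 k).le, Real.norm_eq_abs] at hk
    have h5 := (abs_le.1 hk).1
    have h6 := hp0 k
    have h7 : η k * ⟪G, (1 - 2 * ε k) • u - ν k⟫ ≤ η k * δ := by
      have := mul_le_mul_of_nonneg_left h4 (mul_pos (half_pos hδ) (hη0 k)).le
      nlinarith
    rw [zero_add]
    exact le_of_mul_le_mul_left h7 (hη0 k)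
  have hν₀ : ‖ν₀‖ = 1 := by
    refine tendsto_nhds_unique hν.norm ?_
    simp [hν1]
  by_cases hG0 : G = 0
  · simp [hG0]
  have hGn : ‖G‖ ≠ 0 := norm_ne_zero_iff.2 hG0
  have h1 := hle (‖G‖⁻¹ • G) (by rw [norm_smul, norm_inv, norm_norm, inv_mul_cancel₀ hGn])
  rw [inner_sub_right, inner_smul_right, real_inner_self_eq_norm_sq] at h1
  have h2 : ‖G‖⁻¹ * ‖G‖ ^ 2 = ‖G‖ := by field_simp
  have h3 := real_inner_le_norm G ν₀
  rw [hν₀, mul_one] at h3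
  have h4 : ⟪G, ν₀⟫ = ‖G‖ * ‖ν₀‖ := by
    rw [hν₀]
    linarith
  have h5 := inner_eq_norm_mul_iff_real.1 h4
  rw [hν₀, one_smul] at h5
  exact h5

end Limits

section Expansion

variable {ι X : Type*} [Fintype ι] [AddCommGroup X] [Module ℝ X]

/-- The total force exerted at the time `t` of the circle `ℝ / ℤ`. -/
def impulse (θ : ι → ℝ) (F : ι → X) (t : ℝ) : X :=
  ∑ j, if Int.fract (t - θ j) = 0 then F j else 0

/-- The mean of the one-sided velocities at time `t`. -/
def meanVelocity (θ : ι → ℝ) (F : ι → X) (t : ℝ) : X :=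
  ∑ j, if Int.fract (t - θ j) = 0 then 0 else (Int.fract (t - θ j) - 1 / 2) • F j

lemma exists_forall_sum_green_add (θ : ι → ℝ) (t : ℝ) :
    ∃ δ > 0, ∀ s, |s| ≤ δ → ∀ F : ι → X, ∑ j, green (t + s - θ j) • F j =
      ∑ j, green (t - θ j) • F j + s • meanVelocity θ F t - (|s| / 2) • impulse θ F t +
        (s ^ 2 / 2) • ∑ j, F j := by
  have h : ∀ j, ∀ᶠ δ : ℝ in nhdsWithin 0 (Set.Ioi 0), ∀ s, |s| ≤ δ →
      green (t + s - θ j) = green (t - θ j) +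
        s * (if Int.fract (t - θ j) = 0 then 0 else Int.fract (t - θ j) - 1 / 2) -
        |s| / 2 * (if Int.fract (t - θ j) = 0 then 1 else 0) + s ^ 2 / 2 := by
    intro j
    by_cases hj : Int.fract (t - θ j) = 0
    · filter_upwards [Ioc_mem_nhdsGT (zero_lt_one' ℝ)] with δ hδ s hs
      rw [if_pos hj, if_pos hj, add_sub_right_comm,
        green_add_of_fract_eq_zero hj (hs.trans hδ.2)]
      ring
    · have h1 : 0 < Int.fract (t - θ j) := (Int.fract_nonneg _).lt_of_ne' hj
      have h2 := Int.fract_lt_one (t - θ j)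
      filter_upwards [Ioc_mem_nhdsGT h1, Ioc_mem_nhdsGT (sub_pos.2 h2)] with δ hδ hδ' s hs
      have h3 := abs_le.1 hs
      rw [if_neg hj, if_neg hj, add_sub_right_comm,
        green_add_of_fract_ne_zero (by linarith [hδ.2]) (by linarith [hδ'.2])]
      ring
  obtain ⟨δ, hδ, hδ0⟩ := ((eventually_all.2 h).and self_mem_nhdsWithin).exists
  refine ⟨δ, hδ0, fun s hs F => ?_⟩
  rw [impulse, meanVelocity, Finset.smul_sum, Finset.smul_sum, Finset.smul_sum,
    ← Finset.sum_add_distrib, ← Finset.sum_sub_distrib, ← Finset.sum_add_distrib]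
  refine Finset.sum_congr rfl fun j _ => ?_
  rw [hδ j s hs]
  split_ifs <;> module

lemma impulse_eq_zero_of_const {θ : ι → ℝ} {F : ι → X}
    (h : ∀ t t', ∑ j, green (t - θ j) • F j = ∑ j, green (t' - θ j) • F j) (t : ℝ) :
    impulse θ F t = 0 := by
  obtain ⟨δ, hδ, hexp⟩ := exists_forall_sum_green_add (X := X) θ t
  have key : ∀ s, 0 < s → s ≤ δ → impulse θ F t = s • ∑ j, F j := by
    intro s hs hsδ
    have h1 := hexp s (by rwa [abs_of_pos hs]) F
    have h2 := hexp (-s) (by rwa [abs_neg, abs_of_pos hs]) F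
    rw [h _ t, abs_of_pos hs] at h1
    rw [h _ t, abs_neg, abs_of_pos hs] at h2
    set S := ∑ j, green (t - θ j) • F j
    have h3 : s • (s • ∑ j, F j - impulse θ F t) =
        (S + s • meanVelocity θ F t - (s / 2) • impulse θ F t + (s ^ 2 / 2) • ∑ j, F j) +
        (S + (-s) • meanVelocity θ F t - (s / 2) • impulse θ F t + ((-s) ^ 2 / 2) • ∑ j, F j) -
        (S + S) := by module
    rw [← h1, ← h2, sub_self] at h3
    rcases smul_eq_zero.1 h3 with h4 | h4
    · exact absurd h4 hs.ne'
    · exact (sub_eq_zero.1 h4).symm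
  have h1 := key δ hδ le_rfl
  have h2 := key (δ / 2) (half_pos hδ) (half_le_self hδ.le)
  have h3 : (δ / 2) • ∑ j, F j = 0 := by
    have : (δ / 2) • ∑ j, F j = δ • ∑ j, F j - (δ / 2) • ∑ j, F j := by module
    rw [this, ← h1, ← h2, sub_self]
  rw [h2, h3]

end Expansion

section Compactness

variable {n : ℕ}

lemma hasStrictFDerivAt_innerSL_gradient {f : E n → ℝ} (hf : ContDiff ℝ (⊤ : ℕ∞) f) (x : E n) :
    HasStrictFDerivAt f (innerSL ℝ (gradient f x)) x := by
  have h := (hf.contDiffAt (x := x)).hasStrictFDerivAt (by simp)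
  have e : innerSL ℝ (gradient f x) = fderiv ℝ f x := by
    refine ContinuousLinearMap.ext fun v => ?_
    rw [innerSL_apply_apply, gradient, InnerProductSpace.toDual_symm_apply]
  rwa [e]

lemma inner_impulse_meanVelocity_eq_zero {κ ι : Type*} [Fintype ι] {l : Filter κ} [l.NeBot]
    {g : κ → ℝ → ℝ} {ε s : κ → ℝ} (hε : Tendsto ε l (nhds 0))
    (hg : ∀ k t, |g k t - green t| ≤ ε k) (hneg : ∀ k t, g k (-t) = g k t)
    (hconc : ∀ k, ConcaveOn ℝ Set.univ fun t => g k t - t ^ 2 / 2) {τ : κ → ι → ℝ} {θ : ι → ℝ}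
    (hθ : ∀ j, Tendsto (fun k => τ k j) l (nhds (θ j))) {G : κ → ι → E n} {F : ι → E n}
    (hF : ∀ j, Tendsto (fun k => G k j) l (nhds (F j))) (hs : Tendsto s l (nhds 0))
    (hs0 : ∀ k, 0 < s k) (hbal : ∀ k i,
      |∑ j, ⟪G k i, G k j⟫ * (g k (τ k i - τ k j + s k) - g k (τ k i - τ k j - s k))| ≤ ε k * s k)
    (t : ℝ) : ⟪impulse θ F t, meanVelocity θ F t⟫ = 0 := by
  have hfract : ∀ i j, Int.fract (t - θ i) = 0 →
      Int.fract (θ i - θ j) = Int.fract (t - θ j) := by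
    intro i j h
    have h1 : t - θ i = ⌊t - θ i⌋ := sub_eq_zero.1 h
    have h2 : t - θ j = θ i - θ j + ⌊t - θ i⌋ := by rw [← h1]; ring
    rw [h2, Int.fract_add_intCast]
  set S : Finset ι := Finset.univ.filter fun j => Int.fract (t - θ j) = 0 with hS
  set U : Finset ι := Finset.univ.filter fun j => ¬ Int.fract (t - θ j) = 0 with hU
  set D : κ → ι → ι → ℝ := fun k i j => ⟪G k i, G k j⟫ *
    ((g k (τ k i - τ k j + s k) - g k (τ k i - τ k j - s k)) / (2 * s k)) with hD
  have hlim : Tendsto (fun k => ∑ i ∈ S, ∑ j ∈ U, D k i j) l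
      (nhds (∑ i ∈ S, ∑ j ∈ U, ⟪F i, F j⟫ * (Int.fract (t - θ j) - 1 / 2))) := by
    refine tendsto_finsetSum _ fun i hi => tendsto_finsetSum _ fun j hj => ?_
    have hi' := (Finset.mem_filter.1 hi).2
    have hj' := (Finset.mem_filter.1 hj).2
    rw [← hfract i j hi'] at hj' ⊢
    exact ((hF i).inner (hF j)).mul
      (tendsto_kernel_slope hε hg hconc ((hθ i).sub (hθ j)) hs hs0 hj')
  have hanti : ∀ k, ∑ i ∈ S, ∑ j ∈ S, D k i j = 0 := by
    intro k
    have h1 : ∀ i j, D k i j = - D k j i := by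
      intro i j
      have e1 : τ k i - τ k j + s k = -(τ k j - τ k i - s k) := by ring
      have e2 : τ k i - τ k j - s k = -(τ k j - τ k i + s k) := by ring
      simp only [hD]
      rw [e1, e2, hneg, hneg, real_inner_comm]
      ring
    have h2 : ∑ i ∈ S, ∑ j ∈ S, D k i j = - ∑ i ∈ S, ∑ j ∈ S, D k i j := by
      conv_lhs => rw [Finset.sum_comm]
      rw [← Finset.sum_neg_distrib]
      refine Finset.sum_congr rfl fun i _ => ?_
      rw [← Finset.sum_neg_distrib]
      exact Finset.sum_congr rfl fun j _ => h1 _ _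
    linarith
  have hzero : Tendsto (fun k => ∑ i ∈ S, ∑ j ∈ U, D k i j) l (nhds 0) := by
    have h0 : Tendsto (fun k => ∑ _i ∈ S, ε k / 2) l (nhds 0) := by
      simpa using tendsto_finsetSum S fun _ _ => hε.div_const 2
    refine squeeze_zero_norm (fun k => ?_) h0
    have h1 : ∑ i ∈ S, ∑ j ∈ U, D k i j = ∑ i ∈ S, ∑ j, D k i j := by
      rw [← zero_add (∑ i ∈ S, ∑ j ∈ U, D k i j), ← hanti k, ← Finset.sum_add_distrib]
      exact Finset.sum_congr rfl fun i _ => Finset.sum_filter_add_sum_filter_not _ _ _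
    rw [h1]
    refine (norm_sum_le _ _).trans (Finset.sum_le_sum fun i _ => ?_)
    have h2 : ∑ j, D k i j =
        (∑ j, ⟪G k i, G k j⟫ * (g k (τ k i - τ k j + s k) - g k (τ k i - τ k j - s k))) /
          (2 * s k) := by
      rw [Finset.sum_div]
      exact Finset.sum_congr rfl fun j _ => (mul_div_assoc _ _ _).symm
    have h3 := hs0 k
    rw [h2, norm_div, Real.norm_eq_abs, Real.norm_of_nonneg (by positivity),
      div_le_iff₀ (by positivity)]
    refine (hbal k i).trans (le_of_eq ?_)
    ring
  rw [← tendsto_nhds_unique hlim hzero, impulse, meanVelocity, ← Finset.sum_filter, sum_inner]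
  refine Finset.sum_congr rfl fun i _ => ?_
  rw [inner_sum, hU, Finset.sum_filter]
  refine Finset.sum_congr rfl fun j _ => ?_
  by_cases hj : Int.fract (t - θ j) = 0
  · rw [if_pos hj, if_neg (not_not.2 hj), inner_zero_right]
  · rw [if_neg hj, if_pos hj, inner_smul_right, mul_comm]

/-- The limit of approximate orbits. -/
theorem exists_limit_orbit {V : Set (E n)} (hVbdd : Bornology.IsBounded V) {f : E n → ℝ}
    (hf : ContDiff ℝ (⊤ : ℕ∞) f) (hVf : V = {x | f x < 0}) (hfr : frontier V = {x | f x = 0})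
    (hreg : ∀ x ∈ frontier V, gradient f x ≠ 0) {lo hi : ℝ} (hlo : 0 < lo)
    (ho : ∀ ε : ℝ, 0 < ε → ε ≤ 1 → Nonempty (ApproxOrbit V lo hi ε)) :
    ∃ (θ c : Fin (n + 1) → ℝ) (F : Fin (n + 1) → E n) (m : E n),
      (∀ t, forcedLoop green θ F m t ∈ closure V) ∧ ∑ j, F j = 0 ∧
      (∀ j, forcedLoop green θ F m (θ j) ∈ frontier V) ∧
      (∀ j, 0 ≤ c j ∧ F j = c j • gradient f (forcedLoop green θ F m (θ j))) ∧
      (∀ t, ⟪impulse θ F t, meanVelocity θ F t⟫ = 0) ∧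
      lo ≤ ∑ j, ⟪F j, forcedLoop green θ F m (θ j)⟫ ∧
      ∑ j, ⟪F j, forcedLoop green θ F m (θ j)⟫ ≤ hi := by
  obtain ⟨ε, hε0, hε1, hε⟩ : ∃ ε : ℕ → ℝ, (∀ k, 0 < ε k) ∧ (∀ k, ε k ≤ 1 / 2) ∧
      Tendsto ε (hyperfilter ℕ) (nhds 0) := by
    refine ⟨fun k => 1 / 2 * (1 / ((k : ℝ) + 1)), fun k => by positivity, fun k => ?_, ?_⟩
    · refine mul_le_of_le_one_right (by norm_num) ?_
      rw [div_le_one (by positivity)]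
      linarith [Nat.cast_nonneg (α := ℝ) k]
    · have := (tendsto_one_div_add_atTop_nhds_zero_nat (𝕜 := ℝ)).const_mul (1 / 2)
      rw [mul_zero] at this
      exact this.mono_left Nat.hyperfilter_le_atTop
  generalize hyperfilter ℕ = l at hε
  have o : ∀ k, ApproxOrbit V lo hi (ε k) := fun k =>
    (ho (ε k) (hε0 k) ((hε1 k).trans (by norm_num))).some
  clear ho
  set L : ℕ → ℝ → E n := fun k => forcedLoop (o k).g (o k).θ (o k).F (o k).m with hL
  obtain ⟨A, hA⟩ := hVbdd.exists_norm_le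
  have hLV : ∀ k, ∀ t ∈ (o k).grid, L k t ∈ V := by
    intro k t ht
    by_contra h
    have h1 := (o k).le_norm_loop_sub t ht _ h
    rw [sub_self, norm_zero] at h1
    have h2 : 0 < (1 - ε k) * (o k).η := mul_pos (by linarith [hε1 k]) (o k).η_pos
    linarith
  have hη : Tendsto (fun k => (o k).η) l (nhds 0) :=
    squeeze_zero (fun k => (o k).η_pos.le) (fun k => (o k).η_le) hε
  have hs : Tendsto (fun k => (o k).s) l (nhds 0) :=
    squeeze_zero (fun k => (o k).s_pos.le) (fun k => (o k).s_le) hε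
  have hθ' : ∀ j, ∃ x, Tendsto (fun k => (o k).θ j) l (nhds x) := fun j =>
    (l.exists_tendsto_of_norm_le (C := 1) (Eventually.of_forall fun k => by
      rw [Real.norm_of_nonneg ((o k).θ_mem j).1]
      exact ((o k).θ_mem j).2)).imp fun _ h => h.2
  choose θ hθ using hθ'
  have hν' : ∀ j, ∃ x, Tendsto (fun k => (o k).ν j) l (nhds x) := fun j =>
    (l.exists_tendsto_of_norm_le (C := 1) (Eventually.of_forall fun k =>
      ((o k).norm_ν j).le)).imp fun _ h => h.2
  choose ν hν using hν'
  have hμ' : ∀ j, ∃ x, Tendsto (fun k => (o k).μ j) l (nhds x) := fun j =>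
    (l.exists_tendsto_of_norm_le (C := 1) (Eventually.of_forall fun k => by
      rw [Real.norm_of_nonneg ((o k).μ_nonneg j), ← (o k).sum_μ]
      exact Finset.single_le_sum (fun i _ => (o k).μ_nonneg i) (Finset.mem_univ j))).imp
      fun _ h => h.2
  choose μ hμ using hμ'
  have hP' : ∀ j, ∃ x, Tendsto (fun k => L k ((o k).θ j)) l (nhds x) := fun j =>
    (l.exists_tendsto_of_norm_le (C := A) (Eventually.of_forall fun k =>
      hA _ (hLV k _ ((o k).θ_mem_grid j)))).imp fun _ h => h.2
  choose P hP using hP'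
  obtain ⟨b, hb⟩ : ∃ b, Tendsto (fun k => (o k).b) l (nhds b) :=
    (l.exists_tendsto_of_norm_le (C := hi + 1) (Eventually.of_forall fun k => by
      rw [Real.norm_of_nonneg (hlo.le.trans (o k).lo_le)]
      linarith [(o k).le_hi, hε1 k])).imp fun _ h => h.2
  have hg : ∀ {x : ℕ → ℝ} {a : ℝ}, Tendsto x l (nhds a) →
      Tendsto (fun k => (o k).g (x k)) l (nhds (green a)) := fun h =>
    tendsto_kernel hε (fun k => (o k).abs_g_sub_green_le) h
  have hp : ∀ j, Tendsto (fun k => (o k).p j) l (nhds (P j)) := by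
    intro j
    have h1 := (hP j).add (hη.smul (hν j))
    rw [zero_smul, add_zero] at h1
    refine h1.congr fun k => ?_
    rw [hL]
    simp only [(o k).loop_θ j, sub_add_cancel]
  have hnormal : ∀ j, f (P j) = 0 ∧ gradient f (P j) = ‖gradient f (P j)‖ • ν j := fun j =>
    eq_norm_smul_of_tendsto hVf (hasStrictFDerivAt_innerSL_gradient hf (P j)) hε hε0 hη
      (fun k => (o k).η_pos) (fun k => (o k).norm_ν j) (hp j) (hν j) (fun k => (o k).p_notMem j)
      (fun k x hx => by
        rw [← (o k).loop_θ]
        exact (o k).le_norm_loop_sub _ ((o k).θ_mem_grid j) x hx)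
  have hPfr : ∀ j, P j ∈ frontier V := fun j => by
    rw [hfr]
    exact (hnormal j).1
  have hG0 : ∀ j, ‖gradient f (P j)‖ ≠ 0 := fun j => norm_ne_zero_iff.2 (hreg _ (hPfr j))
  have hνG : ∀ j, ν j = ‖gradient f (P j)‖⁻¹ • gradient f (P j) := fun j => by
    conv_rhs => rw [(hnormal j).2, norm_smul, norm_norm]
    have h1 : ‖ν j‖ = 1 := tendsto_nhds_unique (hν j).norm (by simp [(o _).norm_ν j])
    rw [h1, mul_one, smul_smul, inv_mul_cancel₀ (hG0 j), one_smul]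
  have hPeq : ∀ i j, Int.fract (θ i - θ j) = 0 → P i = P j := by
    intro i j hij
    have h1 : Tendsto (fun k => ‖L k ((o k).θ i) - L k ((o k).θ j)‖ ^ 2) l
        (nhds (‖P i - P j‖ ^ 2)) := ((hP i).sub (hP j)).norm.pow 2
    have h2 := (hb.const_mul 2).mul
      ((hg (tendsto_const_nhds (x := (0 : ℝ)))).sub (hg ((hθ i).sub (hθ j))))
    have h3 := le_of_tendsto_of_tendsto' h1 h2 fun k =>
      (o k).norm_sq_loop_sub_le _ ((o k).θ_mem_grid i) _ ((o k).θ_mem_grid j)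
    have h4 : green (θ i - θ j) = 0 := by simp [green, hij]
    rw [h4, green_zero, sub_zero, mul_zero] at h3
    have h5 := pow_eq_zero_iff (two_ne_zero) |>.1 (le_antisymm h3 (sq_nonneg _))
    exact sub_eq_zero.1 (norm_eq_zero.1 h5)
  have hμ0 : ∀ j, 0 ≤ μ j := fun j => ge_of_tendsto' (hμ j) fun k => (o k).μ_nonneg j
  have hμ1 : ∑ j, μ j = 1 :=
    tendsto_nhds_unique (tendsto_finsetSum _ fun j _ => hμ j) (by simp [(o _).sum_μ])
  have hgrid : ∀ t, ∃ τ : ℕ → ℝ, (∀ k, τ k ∈ (o k).grid) ∧ Tendsto τ l (nhds t) := by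
    intro t
    choose τ hτ hτ' using fun k => (o k).exists_grid t
    refine ⟨τ, hτ, ?_⟩
    rw [tendsto_iff_norm_sub_tendsto_zero]
    exact squeeze_zero (fun k => norm_nonneg _) hτ' hε
  obtain ⟨Λ, hΛ⟩ : ∃ Λ, Tendsto (fun k => (o k).Λ) l (nhds Λ) := by
    by_cases hbd : ∃ C, ∀ᶠ k in (l : Filter ℕ), (o k).Λ ≤ C
    · obtain ⟨C, hC⟩ := hbd
      refine (l.exists_tendsto_of_norm_le (C := C) ?_).imp fun _ h => h.2
      filter_upwards [hC] with k hk
      rwa [Real.norm_of_nonneg (o k).Λ_pos.le]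
    exfalso
    push Not at hbd
    have hΛ : Tendsto (fun k => (o k).Λ) l atTop := tendsto_atTop.2 fun C =>
      (hbd C).mono fun k hk => hk.le
    have hconst : ∀ t t', ∑ j, green (t - θ j) • (μ j • ν j) =
        ∑ j, green (t' - θ j) • (μ j • ν j) := by
      intro t t'
      obtain ⟨τ, hτ, hτ'⟩ := hgrid t
      obtain ⟨σ, hσ, hσ'⟩ := hgrid t'
      have hlim : ∀ {τ : ℕ → ℝ} {t : ℝ}, Tendsto τ l (nhds t) →
          Tendsto (fun k => ∑ j, (o k).g (τ k - (o k).θ j) • ((o k).μ j • (o k).ν j)) l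
            (nhds (∑ j, green (t - θ j) • (μ j • ν j))) := fun h =>
        tendsto_finsetSum _ fun j _ => (hg (h.sub (hθ j))).smul ((hμ j).smul (hν j))
      refine sub_eq_zero.1 (tendsto_nhds_unique ((hlim hτ').sub (hlim hσ')) ?_)
      refine squeeze_zero_norm (a := fun k => (o k).Λ⁻¹ * (2 * A)) (fun k => ?_) ?_
      · have h1 : ∑ j, (o k).g (τ k - (o k).θ j) • ((o k).μ j • (o k).ν j) -
            ∑ j, (o k).g (σ k - (o k).θ j) • ((o k).μ j • (o k).ν j) =
              (o k).Λ⁻¹ • (L k (τ k) - L k (σ k)) := by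
          simp only [hL, forcedLoop]
          rw [add_sub_add_left_eq_sub, smul_sub, Finset.smul_sum, Finset.smul_sum]
          congr 1 <;>
          · refine Finset.sum_congr rfl fun j _ => ?_
            have := (o k).Λ_pos.ne'
            rw [(o k).F_eq]
            simp only [smul_smul]
            congr 1
            field_simp
        have h2 : 0 < (o k).Λ⁻¹ := inv_pos.2 (o k).Λ_pos
        rw [h1, norm_smul, Real.norm_of_nonneg h2.le]
        refine mul_le_mul_of_nonneg_left ((norm_sub_le _ _).trans ?_) h2.le
        linarith [hA _ (hLV k _ (hτ k)), hA _ (hLV k _ (hσ k))]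
      · simpa using hΛ.inv_tendsto_atTop.mul_const (2 * A)
    have hμz : ∀ i, μ i = 0 := by
      intro i
      have h1 := impulse_eq_zero_of_const hconst (θ i)
      have h2 : impulse θ (fun j => μ j • ν j) (θ i) =
          (∑ j, if Int.fract (θ i - θ j) = 0 then μ j else 0) • ν i := by
        rw [impulse, Finset.sum_smul]
        refine Finset.sum_congr rfl fun j _ => ?_
        split_ifs with hij
        · rw [hνG i, hνG j, hPeq i j hij]
        · rw [zero_smul]
      rw [h2, hνG, smul_smul] at h1
      have h3 := (smul_eq_zero.1 h1).resolve_right (hreg _ (hPfr i))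
      have h4 := (mul_eq_zero.1 h3).resolve_right (inv_ne_zero (hG0 i))
      have h5 := (Finset.sum_eq_zero_iff_of_nonneg fun j _ => by
        split_ifs
        exacts [hμ0 j, le_rfl]).1 h4 i (Finset.mem_univ i)
      simpa using h5
    simp [hμz] at hμ1
  have hF : ∀ j, Tendsto (fun k => (o k).F j) l (nhds ((Λ * μ j) • ν j)) := fun j =>
    ((hΛ.mul (hμ j)).smul (hν j)).congr fun k => ((o k).F_eq j).symm
  have hm : Tendsto (fun k => (o k).m) l
      (nhds (P 0 - ∑ j, green (θ 0 - θ j) • ((Λ * μ j) • ν j))) := by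
    refine ((hP 0).sub (tendsto_finsetSum _ fun j _ =>
      (hg ((hθ 0).sub (hθ j))).smul (hF j))).congr fun k => ?_
    simp only [hL, forcedLoop, add_sub_cancel_right]
  generalize P 0 - ∑ j, green (θ 0 - θ j) • ((Λ * μ j) • ν j) = m at hm
  have hΛ0 : 0 ≤ Λ := ge_of_tendsto' hΛ fun k => (o k).Λ_pos.le
  have hloop : ∀ {τ : ℕ → ℝ} {t : ℝ}, Tendsto τ l (nhds t) → Tendsto (fun k => L k (τ k)) l
      (nhds (forcedLoop green θ (fun j => (Λ * μ j) • ν j) m t)) := fun h =>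
    hm.add (tendsto_finsetSum _ fun j _ => (hg (h.sub (hθ j))).smul (hF j))
  have hPθ : ∀ j, forcedLoop green θ (fun j => (Λ * μ j) • ν j) m (θ j) = P j := fun j =>
    tendsto_nhds_unique (hloop (hθ j)) (hP j)
  have hbal : b = ∑ j, ⟪(Λ * μ j) • ν j, P j⟫ := by
    refine tendsto_nhds_unique hb ?_
    have h1 := (tendsto_finsetSum Finset.univ fun j _ => (hF j).inner (hP j)).add (hΛ.mul hη)
    rw [mul_zero, add_zero] at h1
    exact h1.congr fun k => (o k).b_eq.symm
  refine ⟨θ, fun j => Λ * μ j * ‖gradient f (P j)‖⁻¹, fun j => (Λ * μ j) • ν j, m, ?_, ?_, ?_, ?_,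
    ?_, ?_, ?_⟩
  · intro t
    obtain ⟨τ, hτ, hτ'⟩ := hgrid t
    exact mem_closure_of_tendsto (hloop hτ') (Eventually.of_forall fun k => hLV k _ (hτ k))
  · exact tendsto_nhds_unique (tendsto_finsetSum _ fun j _ => hF j)
      (squeeze_zero_norm (fun k => (o k).norm_sum_F_le) hε)
  · intro j
    rw [hPθ]
    exact hPfr j
  · intro j
    rw [hPθ]
    refine ⟨mul_nonneg (mul_nonneg hΛ0 (hμ0 j)) (inv_nonneg.2 (norm_nonneg _)), ?_⟩
    change (Λ * μ j) • ν j = _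
    rw [hνG, smul_smul]
  · exact inner_impulse_meanVelocity_eq_zero hε (fun k => (o k).abs_g_sub_green_le)
      (fun k => (o k).g_neg) (fun k => (o k).concaveOn_g) hθ hF hs (fun k => (o k).s_pos)
      fun k => (o k).abs_balance_le
  · simp only [hPθ, ← hbal]
    exact ge_of_tendsto' hb fun k => (o k).lo_le
  · simp only [hPθ, ← hbal]
    have h1 := hε.const_add hi
    rw [add_zero] at h1
    exact le_of_tendsto_of_tendsto' hb h1 fun k => (o k).le_hi

end Compactness

section ClosedOrbit

lemma fract_eq_zero_of_impulse_ne_zero {ι X : Type*} [Fintype ι] [AddCommGroup X]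
    {θ : ι → ℝ} {F : ι → X} {t : ℝ} (h : impulse θ F t ≠ 0) :
    ∃ j, Int.fract (t - θ j) = 0 := by
  by_contra! hne
  exact h (Finset.sum_eq_zero fun j _ => if_neg (hne j))

lemma impulse_add_int {ι X : Type*} [Fintype ι] [AddCommGroup X] (θ : ι → ℝ) (F : ι → X) (t : ℝ)
    (k : ℤ) : impulse θ F (t + k) = impulse θ F t := by
  simp only [impulse, add_sub_right_comm, Int.fract_add_intCast]

variable {n : ℕ} {ι : Type*} [Fintype ι] {θ : ι → ℝ} {F : ι → E n} {m : E n}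

lemma forcedLoop_green_add_int (t : ℝ) (k : ℤ) :
    forcedLoop green θ F m (t + k) = forcedLoop green θ F m t := by
  simp only [forcedLoop, add_sub_right_comm, green_add_int]

lemma continuous_forcedLoop_green : Continuous (forcedLoop green θ F m) := by
  refine continuous_const.add (continuous_finsetSum _ fun j _ => ?_)
  exact (continuous_green.comp (continuous_id.sub continuous_const)).smul continuous_const

lemma exists_forcedLoop_green_add (hF : ∑ j, F j = 0) (t : ℝ) :
    ∃ δ > 0, ∀ s, |s| ≤ δ → forcedLoop green θ F m (t + s) =
      forcedLoop green θ F m t + s • meanVelocity θ F t - (|s| / 2) • impulse θ F t := by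
  obtain ⟨δ, hδ, h⟩ := exists_forall_sum_green_add (X := E n) θ t
  refine ⟨δ, hδ, fun s hs => ?_⟩
  rw [forcedLoop, forcedLoop, h s hs, hF, smul_zero, add_zero]
  abel

lemma hasDerivAt_forcedLoop_green (hF : ∑ j, F j = 0) {t : ℝ} (ht : impulse θ F t = 0) :
    HasDerivAt (forcedLoop green θ F m) (meanVelocity θ F t) t := by
  obtain ⟨δ, hδ, h⟩ := exists_forcedLoop_green_add (m := m) hF t
  have h1 : HasDerivAt (fun u => forcedLoop green θ F m t + (u - t) • meanVelocity θ F t)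
      (meanVelocity θ F t) t := by
    simpa using (((hasDerivAt_id t).sub_const t).smul_const (meanVelocity θ F t)).const_add
      (forcedLoop green θ F m t)
  refine h1.congr_of_eventuallyEq ?_
  filter_upwards [Metric.closedBall_mem_nhds t hδ] with u hu
  rw [Metric.mem_closedBall, Real.dist_eq] at hu
  have := h _ hu
  rwa [ht, smul_zero, sub_zero, add_sub_cancel] at this

/-- Away from a bounce the velocity is locally one of the two one-sided velocities. -/
lemma exists_velocity_eq (hF : ∑ j, F j = 0) (t : ℝ) :
    ∃ δ > 0, ∀ s σ : ℝ, 0 < |s| → |s| < δ → |σ| = 1 → |s| = σ * s →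
      impulse θ F (t + s) = 0 ∧
        meanVelocity θ F (t + s) = meanVelocity θ F t - (σ / 2) • impulse θ F t := by
  obtain ⟨δ, hδ, h⟩ := exists_forcedLoop_green_add (m := (0 : E n)) (θ := θ) hF t
  refine ⟨δ, hδ, fun s σ hs hsδ hσ hσs => ?_⟩
  obtain ⟨δ', hδ', h'⟩ := exists_forcedLoop_green_add (m := (0 : E n)) (θ := θ) hF (t + s)
  obtain ⟨x, hx, hx1, hx2, hx3⟩ : ∃ x : ℝ, 0 < x ∧ x ≤ δ' ∧ x ≤ |s| ∧ x ≤ δ - |s| :=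
    ⟨min δ' (min |s| (δ - |s|)), by simp [hδ', abs_pos.1 hs, hsδ], min_le_left _ _,
      (min_le_right _ _).trans (min_le_left _ _), (min_le_right _ _).trans (min_le_right _ _)⟩
  have key : ∀ y : ℝ, |y| = x → y • meanVelocity θ F (t + s) - (x / 2) • impulse θ F (t + s) =
      y • (meanVelocity θ F t - (σ / 2) • impulse θ F t) := by
    intro y hy
    have h1 := h' y (hy.le.trans hx1)
    have h2 := h s hsδ.le
    have h3 := h (s + y) ((abs_add_le _ _).trans (by linarith))
    have h4 : |s + y| = σ * (s + y) := by
      have h5 : |σ * y| = x := by rw [abs_mul, hσ, one_mul, hy]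
      have h6 : 0 ≤ σ * (s + y) := by
        have := neg_abs_le (σ * y)
        rw [mul_add, ← hσs]
        linarith
      rw [← abs_of_nonneg h6, abs_mul, hσ, one_mul]
    rw [← add_assoc, h1, h2, h4, hσs, hy] at h3
    rw [← sub_eq_zero] at h3 ⊢
    rw [← h3]
    module
  have k1 := key x (abs_of_pos hx)
  have k2 := key (-x) (by rw [abs_neg, abs_of_pos hx])
  have hI : impulse θ F (t + s) = 0 := by
    have h1 : x • impulse θ F (t + s) = 0 := by
      have e : x • impulse θ F (t + s) =
          -((x • meanVelocity θ F (t + s) - (x / 2) • impulse θ F (t + s)) +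
            ((-x) • meanVelocity θ F (t + s) - (x / 2) • impulse θ F (t + s))) := by module
      rw [e, k1, k2]
      module
    exact (smul_eq_zero.1 h1).resolve_left hx.ne'
  refine ⟨hI, ?_⟩
  rw [hI, smul_zero, sub_zero] at k1
  exact smul_right_injective _ hx.ne' k1

lemma sq_speed_const (hF : ∑ j, F j = 0)
    (hperp : ∀ t, ⟪impulse θ F t, meanVelocity θ F t⟫ = 0) (t t' : ℝ) :
    ‖meanVelocity θ F t‖ ^ 2 + ‖impulse θ F t‖ ^ 2 / 4 =
      ‖meanVelocity θ F t'‖ ^ 2 + ‖impulse θ F t'‖ ^ 2 / 4 := by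
  have h : IsLocallyConstant fun t =>
      ‖meanVelocity θ F t‖ ^ 2 + ‖impulse θ F t‖ ^ 2 / 4 := by
    refine IsLocallyConstant.iff_eventually_eq _ |>.2 fun t => ?_
    obtain ⟨δ, hδ, h⟩ := exists_velocity_eq hF t (θ := θ)
    filter_upwards [Metric.ball_mem_nhds t hδ] with u hu
    rw [Metric.mem_ball, Real.dist_eq] at hu
    rcases eq_or_ne u t with rfl | hne
    · rfl
    have hs : 0 < |u - t| := abs_pos.2 (sub_ne_zero.2 hne)
    obtain ⟨σ, hσ, hσs⟩ : ∃ σ : ℝ, |σ| = 1 ∧ |u - t| = σ * (u - t) := by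
      rcases abs_choice (u - t) with h | h
      · exact ⟨1, by simp, by rw [one_mul, h]⟩
      · exact ⟨-1, by simp, by rw [neg_one_mul, h]⟩
    obtain ⟨h1, h2⟩ := h _ σ hs hu hσ hσs
    rw [add_sub_cancel] at h1 h2
    have h3 : σ ^ 2 = 1 := by rw [← sq_abs, hσ, one_pow]
    rw [h1, h2, norm_sub_sq_real, inner_smul_right, real_inner_comm, hperp, norm_smul, mul_pow,
      Real.norm_eq_abs, sq_abs, div_pow, h3, norm_zero]
    ring
  exact h.apply_eq_of_preconnectedSpace t t'

/-- The energy identity: the squared speed equals the virial of the forces. -/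
lemma sq_speed_eq (hF : ∑ j, F j = 0)
    (hperp : ∀ t, ⟪impulse θ F t, meanVelocity θ F t⟫ = 0) (t : ℝ) :
    ‖meanVelocity θ F t‖ ^ 2 + ‖impulse θ F t‖ ^ 2 / 4 =
      ∑ j, ⟪F j, forcedLoop green θ F m (θ j)⟫ := by
  set e : ι → ℝ := fun j => ⟪F j, forcedLoop green θ F m (θ j)⟫ with he
  set W := ‖meanVelocity θ F t‖ ^ 2 + ‖impulse θ F t‖ ^ 2 / 4 with hW
  set φ : ℝ → ℝ := fun t => ‖forcedLoop green θ F m t‖ ^ 2 / 2 - ∑ j, green (t - θ j) • e j with hφ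
  have hcont : Continuous φ := by
    refine (continuous_forcedLoop_green.norm.pow 2).div_const 2 |>.sub
      (continuous_finsetSum _ fun j _ => ?_)
    exact (continuous_green.comp (continuous_id.sub continuous_const)).smul continuous_const
  have hper : ∀ t, ∃ t' ∈ Set.Icc (0 : ℝ) 1, φ t' = φ t := by
    intro t
    refine ⟨Int.fract t, ⟨Int.fract_nonneg t, (Int.fract_lt_one t).le⟩, ?_⟩
    have h1 : φ (Int.fract t + ⌊t⌋) = φ (Int.fract t) := by
      simp only [hφ, forcedLoop_green_add_int, add_sub_right_comm, green_add_int]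
    rw [← h1, Int.fract_add_floor]
  have himp : ∀ u, impulse θ e u = ⟪forcedLoop green θ F m u, impulse θ F u⟫ := by
    intro u
    rw [impulse, impulse, inner_sum]
    refine Finset.sum_congr rfl fun j _ => ?_
    split_ifs with hj
    · have h1 : u = θ j + ⌊u - θ j⌋ := by
        have := sub_eq_zero.1 hj
        rw [← this]
        ring
      have h2 : forcedLoop green θ F m u = forcedLoop green θ F m (θ j) := by
        rw [h1, forcedLoop_green_add_int]
      rw [h2, real_inner_comm]
    · rw [inner_zero_right]
  have hexp : ∀ u, ∃ s, 0 < s ∧ φ (u + s) + φ (u + -s) = 2 * φ u + s ^ 2 * (W - ∑ j, e j) := by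
    intro u
    obtain ⟨δ, hδ, h⟩ := exists_forcedLoop_green_add (m := m) (θ := θ) hF u
    obtain ⟨δ', hδ', h'⟩ := exists_forall_sum_green_add (X := ℝ) θ u
    have hs : 0 < min δ δ' := lt_min hδ hδ'
    refine ⟨min δ δ', hs, ?_⟩
    set s := min δ δ'
    have hs1 : |s| ≤ δ := by rw [abs_of_pos hs]; exact min_le_left _ _
    have hs2 : |s| ≤ δ' := by rw [abs_of_pos hs]; exact min_le_right _ _
    have hWu : W = ‖meanVelocity θ F u‖ ^ 2 + ‖impulse θ F u‖ ^ 2 / 4 :=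
      sq_speed_const hF hperp t u
    simp only [hφ]
    rw [h s hs1, h (-s) (by rwa [abs_neg]), h' s hs2, h' (-s) (by rwa [abs_neg]), abs_neg,
      abs_of_pos hs, himp, hWu]
    simp only [← real_inner_self_eq_norm_sq, inner_add_left, inner_add_right, inner_sub_left,
      inner_sub_right, inner_smul_left, inner_smul_right, smul_eq_mul, RCLike.conj_to_real]
    rw [real_inner_comm (impulse θ F u) (meanVelocity θ F u), hperp,
      real_inner_comm (forcedLoop green θ F m u) (impulse θ F u)]
    ring
  obtain ⟨u, -, hu⟩ := isCompact_Icc.exists_isMaxOn (Set.nonempty_Icc.2 (zero_le_one' ℝ))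
    hcont.continuousOn
  obtain ⟨v, -, hv⟩ := isCompact_Icc.exists_isMinOn (Set.nonempty_Icc.2 (zero_le_one' ℝ))
    hcont.continuousOn
  have hu' : ∀ t, φ t ≤ φ u := fun t => by
    obtain ⟨t', ht', h⟩ := hper t
    exact h ▸ hu ht'
  have hv' : ∀ t, φ v ≤ φ t := fun t => by
    obtain ⟨t', ht', h⟩ := hper t
    exact h ▸ hv ht'
  obtain ⟨s, hs, h1⟩ := hexp u
  obtain ⟨s', hs', h2⟩ := hexp v
  have h3 : W - ∑ j, e j ≤ 0 := by
    by_contra! hpos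
    have := mul_pos (pow_pos hs 2) hpos
    linarith [hu' (u + s), hu' (u + -s)]
  have h4 : 0 ≤ W - ∑ j, e j := by
    by_contra! hneg
    have := mul_neg_of_pos_of_neg (pow_pos hs' 2) hneg
    linarith [hv' (v + s'), hv' (v + -s')]
  linarith

end ClosedOrbit

section Inradius

variable {n : ℕ} {V : Set (E n)}

/-- A segment from a point of a set to a point outside of it meets the frontier. -/
lemma infDist_frontier_le_norm_sub {x y : E n} (hx : x ∈ V) (hy : y ∉ V) :
    Metric.infDist x (frontier V) ≤ ‖y - x‖ := by
  obtain ⟨z, hz, hzV⟩ : (segment ℝ x y ∩ frontier V).Nonempty := by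
    by_contra hempty
    rw [Set.not_nonempty_iff_eq_empty] at hempty
    have hnot : ∀ z ∈ segment ℝ x y, z ∉ frontier V := fun z hz h =>
      (hempty ▸ ⟨hz, h⟩ : z ∈ (∅ : Set (E n)))
    obtain ⟨z, -, h1, h2⟩ := (convex_segment x y).isPreconnected (interior V) (closure V)ᶜ
      isOpen_interior isClosed_closure.isOpen_compl
      (fun z hz => by
        by_contra h
        simp only [Set.mem_union, Set.mem_compl_iff, not_or, not_not] at h
        exact hnot z hz ⟨h.2, h.1⟩)
      ⟨x, left_mem_segment ℝ x y, by
        by_contra h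
        exact hnot x (left_mem_segment ℝ x y) ⟨subset_closure hx, h⟩⟩
      ⟨y, right_mem_segment ℝ x y, fun h =>
        hnot y (right_mem_segment ℝ x y) ⟨h, fun h' => hy (interior_subset h')⟩⟩
    exact h2 (subset_closure (interior_subset h1))
  refine (Metric.infDist_le_dist_of_mem hzV).trans ?_
  obtain ⟨t, ht, rfl⟩ := (segment_eq_image' ℝ x y ▸ hz :)
  rw [dist_eq_norm, sub_add_cancel_left, norm_neg, norm_smul, Real.norm_of_nonneg ht.1]
  exact mul_le_of_le_one_left (norm_nonneg _) ht.2

variable (hbdd : Bornology.IsBounded V)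
include hbdd

lemma bddAbove_infDist_frontier :
    BddAbove ((fun x => Metric.infDist x (frontier V)) '' V) := by
  rcases (frontier V).eq_empty_or_nonempty with h | ⟨y, hy⟩
  · refine ⟨0, ?_⟩
    rintro _ ⟨x, -, rfl⟩
    simp [h]
  · obtain ⟨C, hC⟩ := hbdd.closure.subset_closedBall y
    refine ⟨C, ?_⟩
    rintro _ ⟨x, hx, rfl⟩
    exact (Metric.infDist_le_dist_of_mem hy).trans (hC (subset_closure hx))

lemma infDist_frontier_le_inradius {x : E n} (hx : x ∈ V) :
    Metric.infDist x (frontier V) ≤ inradius V :=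
  le_csSup (bddAbove_infDist_frontier hbdd) (Set.mem_image_of_mem _ hx)

lemma nonempty_frontier_of_isBounded (hn : 1 ≤ n) (hne : V.Nonempty) : (frontier V).Nonempty := by
  have : Nonempty (Fin n) := ⟨⟨0, hn⟩⟩
  rw [nonempty_frontier_iff]
  refine ⟨hne, ?_⟩
  rintro rfl
  exact NormedSpace.unbounded_univ ℝ (E n) hbdd

lemma inradius_pos (hn : 1 ≤ n) (hV : IsOpen V) (hne : V.Nonempty) : 0 < inradius V := by
  obtain ⟨x, hx⟩ := hne
  refine lt_of_lt_of_le ?_ (infDist_frontier_le_inradius hbdd hx)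
  refine (isClosed_frontier.notMem_iff_infDist_pos
    (nonempty_frontier_of_isBounded hbdd hn ⟨x, hx⟩)).1 ?_
  rw [hV.frontier_eq]
  exact fun h => h.2 hx

end Inradius

section Trajectory

variable {n : ℕ}

/-- A closed orbit parametrized by the circle of length `1`, scaled to unit speed. -/
theorem exists_billiard_trajectory {V : Set (E n)} {N : E n → E n} {θ c : Fin (n + 1) → ℝ}
    {F : Fin (n + 1) → E n} {m : E n} {a b : ℝ} (ha : 0 < a) (hb : 0 ≤ b)
    (hcl : ∀ t, forcedLoop green θ F m t ∈ closure V) (hF : ∑ j, F j = 0)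
    (hfr : ∀ j, forcedLoop green θ F m (θ j) ∈ frontier V)
    (hc : ∀ j, F j = c j • N (forcedLoop green θ F m (θ j)))
    (hperp : ∀ t, ⟪impulse θ F t, meanVelocity θ F t⟫ = 0)
    (hlo : a ^ 2 ≤ ∑ j, ⟪F j, forcedLoop green θ F m (θ j)⟫)
    (hhi : ∑ j, ⟪F j, forcedLoop green θ F m (θ j)⟫ ≤ b ^ 2) :
    ∃ (T : ℝ) (γ : ℝ → E n) (B : Finset ℝ),
      0 < T ∧ Continuous γ ∧ (∀ t, γ (t + T) = γ t) ∧ (∀ t, γ t ∈ closure V) ∧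
      (B : Set ℝ) ⊆ Set.Ico 0 T ∧ B.card ≤ n + 1 ∧
      (∀ t : ℝ, ¬ (∃ b ∈ B, ∃ k : ℤ, t = b + (k : ℝ) * T) →
        DifferentiableAt ℝ γ t ∧ ‖deriv γ t‖ = 1 ∧
        DifferentiableAt ℝ (deriv γ) t ∧ deriv (deriv γ) t = 0) ∧
      (∀ b ∈ B, γ b ∈ frontier V ∧
        ∃ vp vm : E n,
          Tendsto (deriv γ) (nhdsWithin b (Set.Ioi b)) (nhds vp) ∧
          Tendsto (deriv γ) (nhdsWithin b (Set.Iio b)) (nhds vm) ∧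
          ⟪vp + vm, N (γ b)⟫ = 0 ∧
          ∃ c : ℝ, c ≠ 0 ∧ vp - vm = c • N (γ b)) ∧
      a ≤ T ∧ T ≤ b := by
  classical
  set W := ∑ j, ⟪F j, forcedLoop green θ F m (θ j)⟫ with hW
  have hW0 : 0 < W := (pow_pos ha 2).trans_le hlo
  obtain ⟨T, hT, hTW⟩ : ∃ T : ℝ, 0 < T ∧ T ^ 2 = W := ⟨√W, Real.sqrt_pos.2 hW0, Real.sq_sqrt hW0.le⟩
  set γ : ℝ → E n := fun t => forcedLoop green θ F m (t / T) with hγ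
  set B : Finset ℝ := (Finset.univ.filter fun j => impulse θ F (θ j) ≠ 0).image
    fun j => T * Int.fract (θ j) with hB
  have hspeed : ∀ t, impulse θ F t = 0 → ‖meanVelocity θ F t‖ = T := by
    intro t ht
    have h1 := sq_speed_eq (m := m) hF hperp t
    rw [ht, norm_zero, zero_pow two_ne_zero, zero_div, add_zero, ← hW, ← hTW] at h1
    exact (sq_eq_sq₀ (norm_nonneg _) hT.le).1 h1
  have hderiv : ∀ t, impulse θ F (t / T) = 0 →
      HasDerivAt γ (T⁻¹ • meanVelocity θ F (t / T)) t := by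
    intro t ht
    have h1 : HasDerivAt (fun t => t / T) T⁻¹ t := by
      simpa using (hasDerivAt_id t).div_const T
    exact (hasDerivAt_forcedLoop_green (m := m) hF ht).scomp t h1
  have hlocal : ∀ t, ∃ δ > 0, ∀ u σ : ℝ, 0 < |u - t| → |u - t| < δ → |σ| = 1 →
      |u - t| = σ * (u - t) →
      deriv γ u = T⁻¹ • (meanVelocity θ F (t / T) - (σ / 2) • impulse θ F (t / T)) := by
    intro t
    obtain ⟨δ, hδ, h⟩ := exists_velocity_eq (θ := θ) hF (t / T)
    refine ⟨δ * T, mul_pos hδ hT, fun u σ hu huδ hσ hσu => ?_⟩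
    have e : |(u - t) / T| = |u - t| / T := by rw [abs_div, abs_of_pos hT]
    obtain ⟨h1, h2⟩ := h ((u - t) / T) σ (by rw [e]; exact div_pos hu hT)
      (by rwa [e, div_lt_iff₀ hT]) hσ (by rw [e, hσu, mul_div_assoc])
    rw [← add_div, add_sub_cancel] at h1 h2
    rw [(hderiv u h1).deriv, h2]
  refine ⟨T, γ, B, hT, ?_, ?_, fun t => hcl _, ?_, ?_, ?_, ?_, ?_, ?_⟩
  · exact continuous_forcedLoop_green.comp (continuous_id.div_const T)
  · intro t
    have h1 := forcedLoop_green_add_int (θ := θ) (F := F) (m := m) (t / T) 1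
    simp only [hγ]
    rw [← h1, add_div, div_self hT.ne', Int.cast_one]
  · intro x hx
    rw [hB, Finset.mem_coe, Finset.mem_image] at hx
    obtain ⟨j, -, rfl⟩ := hx
    exact ⟨mul_nonneg hT.le (Int.fract_nonneg _), mul_lt_of_lt_one_right hT (Int.fract_lt_one _)⟩
  · refine Finset.card_image_le.trans ((Finset.card_filter_le _ _).trans ?_)
    simp
  · intro t ht
    have hI : impulse θ F (t / T) = 0 := by
      by_contra hne
      obtain ⟨j, hj⟩ := fract_eq_zero_of_impulse_ne_zero hne
      have h1 : t / T = θ j + ⌊t / T - θ j⌋ := by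
        have := sub_eq_zero.1 hj
        rw [← this]
        ring
      rw [h1, impulse_add_int] at hne
      refine ht ⟨T * Int.fract (θ j), Finset.mem_image.2 ⟨j, by simpa using hne, rfl⟩,
        ⌊θ j⌋ + ⌊t / T - θ j⌋, ?_⟩
      calc t = t / T * T := (div_mul_cancel₀ t hT.ne').symm
        _ = (θ j + (⌊t / T - θ j⌋ : ℝ)) * T := by rw [← h1]
        _ = _ := by
          rw [Int.fract]
          push_cast
          ring
    have hd := hderiv t hI
    obtain ⟨δ, hδ, h⟩ := hlocal t
    have hconst : deriv γ =ᶠ[nhds t] fun _ => T⁻¹ • meanVelocity θ F (t / T) := by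
      filter_upwards [Metric.ball_mem_nhds t hδ] with u hu
      rw [Metric.mem_ball, Real.dist_eq] at hu
      rcases eq_or_ne u t with rfl | hne
      · exact hd.deriv
      obtain ⟨σ, hσ, hσs⟩ : ∃ σ : ℝ, |σ| = 1 ∧ |u - t| = σ * (u - t) := by
        rcases abs_choice (u - t) with h | h
        · exact ⟨1, by simp, by rw [one_mul, h]⟩
        · exact ⟨-1, by simp, by rw [neg_one_mul, h]⟩
      rw [h u σ (abs_pos.2 (sub_ne_zero.2 hne)) hu hσ hσs, hI, smul_zero, sub_zero]
    refine ⟨hd.differentiableAt, ?_, ?_, ?_⟩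
    · rw [hd.deriv, norm_smul, hspeed _ hI, norm_inv, Real.norm_of_nonneg hT.le,
        inv_mul_cancel₀ hT.ne']
    · exact (differentiableAt_const _).congr_of_eventuallyEq hconst
    · rw [hconst.deriv_eq, deriv_const]
  · intro x hx
    obtain ⟨j, hj, rfl⟩ := Finset.mem_image.1 hx
    have hj' := (Finset.mem_filter.1 hj).2
    have e1 : T * Int.fract (θ j) / T = θ j + ((-⌊θ j⌋ : ℤ) : ℝ) := by
      rw [mul_div_cancel_left₀ _ hT.ne', Int.fract]
      push_cast
      ring
    have e2 : γ (T * Int.fract (θ j)) = forcedLoop green θ F m (θ j) := by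
      simp only [hγ]
      rw [e1, forcedLoop_green_add_int]
    set x := T * Int.fract (θ j)
    have e3 : impulse θ F (x / T) = impulse θ F (θ j) := by rw [e1, impulse_add_int]
    obtain ⟨C, hC⟩ : ∃ C : ℝ, impulse θ F (x / T) = C • N (γ x) := by
      refine ⟨∑ i, if Int.fract (θ j - θ i) = 0 then c i else 0, ?_⟩
      rw [e3, e2, impulse, Finset.sum_smul]
      refine Finset.sum_congr rfl fun i _ => ?_
      split_ifs with hi
      · have h1 : θ j = θ i + ⌊θ j - θ i⌋ := by
          have := sub_eq_zero.1 hi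
          rw [← this]
          ring
        have h2 : forcedLoop green θ F m (θ j) = forcedLoop green θ F m (θ i) := by
          rw [h1, forcedLoop_green_add_int]
        rw [h2, ← hc]
      · rw [zero_smul]
    have hC0 : C ≠ 0 := by
      rintro rfl
      rw [zero_smul, e3] at hC
      exact hj' hC
    obtain ⟨δ, hδ, h⟩ := hlocal x
    refine ⟨e2 ▸ hfr j, T⁻¹ • (meanVelocity θ F (x / T) - ((1 : ℝ) / 2) • impulse θ F (x / T)),
      T⁻¹ • (meanVelocity θ F (x / T) - ((-1 : ℝ) / 2) • impulse θ F (x / T)), ?_, ?_, ?_,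
      -(T⁻¹ * C), ?_, ?_⟩
    · refine tendsto_const_nhds.congr' ?_
      filter_upwards [Ioo_mem_nhdsGT (show x < x + δ by linarith)] with u hu
      have h1 : |u - x| = u - x := abs_of_pos (sub_pos.2 hu.1)
      exact (h u 1 (by rw [h1]; linarith [hu.1]) (by rw [h1]; linarith [hu.2]) (by simp)
        (by rw [h1, one_mul])).symm
    · refine tendsto_const_nhds.congr' ?_
      filter_upwards [Ioo_mem_nhdsLT (show x - δ < x by linarith)] with u hu
      have h1 : |u - x| = -(u - x) := abs_of_neg (sub_neg.2 hu.2)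
      exact (h u (-1) (by rw [h1]; linarith [hu.2]) (by rw [h1]; linarith [hu.1]) (by simp)
        (by rw [h1, neg_one_mul])).symm
    · have h1 := hperp (x / T)
      rw [hC, inner_smul_left, RCLike.conj_to_real, real_inner_comm] at h1
      have h2 := (mul_eq_zero.1 h1).resolve_left hC0
      have h3 : T⁻¹ • (meanVelocity θ F (x / T) - ((1 : ℝ) / 2) • impulse θ F (x / T)) +
          T⁻¹ • (meanVelocity θ F (x / T) - ((-1 : ℝ) / 2) • impulse θ F (x / T)) =
          (2 * T⁻¹) • meanVelocity θ F (x / T) := by module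
      rw [h3, inner_smul_left, h2, mul_zero]
    · exact neg_ne_zero.2 (mul_ne_zero (inv_ne_zero hT.ne') hC0)
    · rw [hC]
      module
  · exact (sq_le_sq₀ ha.le hT.le).1 (hTW ▸ hlo)
  · exact (sq_le_sq₀ hT.le hb).1 (hTW ▸ hhi)

end Trajectory

/-- Corollary 1.7. The trajectory is encoded as a `T`-periodic
continuous map `γ : ℝ → V̄` together with the finite set `B ⊂ [0,T)` of bounce times
(extended `T`-periodically); away from bounce times `γ` is a unit-speed straight line,
and at each bounce time the one-sided velocities exist and satisfy the law of
reflection with respect to the outward normal direction `∇f`. -/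
theorem stmt11 (n : ℕ) (hn : 1 ≤ n) (V : Set (E n)) (hVconn : IsConnected V)
    (hVbdd : Bornology.IsBounded V)
    (f : E n → ℝ) (hf : ContDiff ℝ (⊤ : ℕ∞) f)
    (hVf : V = {x | f x < 0}) (hfr : frontier V = {x | f x = 0})
    (hreg : ∀ x ∈ frontier V, gradient f x ≠ 0) :
    ∃ (T : ℝ) (γ : ℝ → E n) (B : Finset ℝ),
      0 < T ∧
      Continuous γ ∧
      (∀ t, γ (t + T) = γ t) ∧
      (∀ t, γ t ∈ closure V) ∧
      (B : Set ℝ) ⊆ Set.Ico 0 T ∧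
      -- at most n+1 bounce times
      B.card ≤ n + 1 ∧
      -- away from the (T-periodically extended) bounce times: straight unit-speed line
      (∀ t : ℝ, ¬ (∃ b ∈ B, ∃ k : ℤ, t = b + (k : ℝ) * T) →
        DifferentiableAt ℝ γ t ∧ ‖deriv γ t‖ = 1 ∧
        DifferentiableAt ℝ (deriv γ) t ∧ deriv (deriv γ) t = 0) ∧
      -- at bounce times: reflection law
      (∀ b ∈ B, γ b ∈ frontier V ∧
        ∃ vp vm : E n,
          Tendsto (deriv γ) (nhdsWithin b (Set.Ioi b)) (nhds vp) ∧
          Tendsto (deriv γ) (nhdsWithin b (Set.Iio b)) (nhds vm) ∧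
          ⟪vp + vm, gradient f (γ b)⟫ = 0 ∧
          ∃ c : ℝ, c ≠ 0 ∧ vp - vm = c • gradient f (γ b)) ∧
      -- length bounds
      2 * inradius V ≤ T ∧ T ≤ 2 * (n + 1) * inradius V := by
  have hVo : IsOpen V := by
    rw [hVf]
    exact isOpen_lt hf.continuous continuous_const
  have hr := inradius_pos hVbdd hn hVo hVconn.nonempty
  obtain ⟨A, hA⟩ := hVbdd.exists_norm_le
  obtain ⟨_, ⟨x₁, hx₁V, rfl⟩, hx₁⟩ := exists_lt_of_lt_csSup (hVconn.nonempty.image _)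
    (show 19 / 20 * inradius V < sSup ((fun x => Metric.infDist x (frontier V)) '' V) by
      change _ < inradius V
      linarith)
  have hclosed : IsClosed (frontier V) := isClosed_frontier
  obtain ⟨θ, c, F, m, h1, h2, h3, h4, h5, h6, h7⟩ := exists_limit_orbit hVbdd hf hVf hfr hreg
    (lo := 4 * inradius V ^ 2) (hi := (2 * (n + 1) * inradius V) ^ 2) (by positivity)
    fun ε hε hε1 => nonempty_approxOrbit hn hr (x₁ := x₁) (A := A + 1)
      (fun x hx => hx₁.le.trans (infDist_frontier_le_norm_sub hx₁V hx))
      (fun x hx => by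
        obtain ⟨p, hp, hxp⟩ := hclosed.exists_infDist_eq_dist
          (nonempty_frontier_of_isBounded hVbdd hn ⟨x, hx⟩) x
        refine ⟨p, ?_, ?_⟩
        · rw [hVo.frontier_eq] at hp
          exact hp.2
        · rw [← dist_eq_norm, ← hxp]
          exact infDist_frontier_le_inradius hVbdd hx)
      (fun x hx => by linarith [hA x hx]) hε hε1
  exact exists_billiard_trajectory (N := gradient f) (by positivity) (by positivity) h1 h2 h3
    (fun j => (h4 j).2) h5 (by linarith [h6]) h7

end
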